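/- For every integer n ≥ 0: 11·N(0,11,11n+6) ≥ p(11n+6) and p(11n+6) ≥ 11·N(5,11,11n+6). -/

import Mathlib

/-- `p n`: the number of partitions of `n`. -/
def partitionCount (n : ℕ) : ℕ := Fintype.card (Nat.Partition n)

/-- The rank of a partition: its largest part minus its number of parts
(the empty partition has rank 0). -/
def partitionRank {n : ℕ} (π : Nat.Partition n) : ℤ :=
  (π.parts.sup : ℤ) - (Multiset.card π.parts : ℤ)

/-- The crank of a partition `π`: if `π` has no parts equal to 1, it is the largest part;
otherwise it is (number of parts larger than the number of ones) − (number of ones). -/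
def partitionCrank {n : ℕ} (π : Nat.Partition n) : ℤ :=
  if π.parts.count 1 = 0 then (π.parts.sup : ℤ)
  else ((π.parts.filter fun x => π.parts.count 1 < x).card : ℤ) - (π.parts.count 1 : ℤ)

/-- `rankCount a r n` = `N(a,r,n)`: the number of partitions of `n` whose rank is
congruent to `a` modulo `r`. -/
def rankCount (a r : ℤ) (n : ℕ) : ℕ :=
  (Finset.univ.filter fun π : Nat.Partition n => partitionRank π % r = a % r).card

/-- `crankCount a n` = `M(a,11,n)`: for `n ≠ 1`, the number of partitions of `n` whose crank
is congruent to `a` modulo 11; at `n = 1` the standard convention `M(0,11,1) = −1`,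
`M(1,11,1) = M(10,11,1) = 1`, and `M(a,11,1) = 0` otherwise. -/
def crankCount (a : ℤ) (n : ℕ) : ℤ :=
  if n = 1 then
    if a % 11 = 0 then -1
    else if a % 11 = 1 ∨ a % 11 = 10 then 1
    else 0
  else ((Finset.univ.filter fun π : Nat.Partition n => partitionCrank π % 11 = a % 11).card : ℤ)

/-- Dyson's map: remove the first column of a Young diagram of `ℓ` rows and insert a row of
length `ℓ + ρ`. -/
def dysonMap (ρ : ℤ) (s : Multiset ℕ) : Multiset ℕ :=
  ((Multiset.card s + ρ).toNat ::ₘ s.map Nat.pred).filter (0 < ·)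

/-- The inverse of `dysonMap`: remove the largest row `m` and insert a column of length
`m - ρ`. -/
def dysonInv (ρ : ℤ) (s : Multiset ℕ) : Multiset ℕ :=
  (s.erase s.sup).map Nat.succ +
    Multiset.replicate (((s.sup : ℤ) - ρ).toNat - Multiset.card (s.erase s.sup)) 1

lemma Multiset.sum_filter_pos (s : Multiset ℕ) : (s.filter (0 < ·)).sum = s.sum := by
  induction s using Multiset.induction_on with
  | empty => simp
  | cons a s ih =>
    rcases Nat.eq_zero_or_pos a with h | h
    · simp [h, ih]
    · rw [Multiset.filter_cons_of_pos s (p := (0 < ·)) h]; simp [ih]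

lemma Multiset.sum_map_pred_add_card {s : Multiset ℕ} (hs : ∀ a ∈ s, 0 < a) :
    (s.map Nat.pred).sum + Multiset.card s = s.sum := by
  induction s using Multiset.induction_on with
  | empty => simp
  | cons a s ih =>
    have h1 := hs a (Multiset.mem_cons_self a s)
    have h2 := ih fun b hb => hs b (Multiset.mem_cons_of_mem hb)
    simp only [Multiset.map_cons, Multiset.sum_cons, Multiset.card_cons, Nat.pred_eq_sub_one]
    simp only [Nat.pred_eq_sub_one] at h2
    omega

lemma Multiset.sup_nat_mem {s : Multiset ℕ} (hs : s ≠ 0) : s.sup ∈ s := by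
  induction s using Multiset.induction_on with
  | empty => exact absurd rfl hs
  | cons a s ih =>
    rw [Multiset.sup_cons]
    by_cases h : s = 0
    · simp [h]
    · rcases le_total a s.sup with h' | h'
      · rw [sup_eq_right.2 h']; exact Multiset.mem_cons_of_mem (ih h)
      · rw [sup_eq_left.2 h']; exact Multiset.mem_cons_self _ _

lemma Multiset.eq_zero_of_forall_pos_of_sum {s : Multiset ℕ} (hs : ∀ a ∈ s, 0 < a)
    (h : s.sum = 0) : s = 0 := by
  by_contra h0
  have := Multiset.le_sum_of_mem (Multiset.sup_nat_mem h0)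
  have := hs _ (Multiset.sup_nat_mem h0)
  omega

lemma Multiset.map_succ_filter_pred {s : Multiset ℕ} (hs : ∀ a ∈ s, 0 < a) :
    ((s.map Nat.pred).filter (0 < ·)).map Nat.succ +
      Multiset.replicate (Multiset.card s - Multiset.card ((s.map Nat.pred).filter (0 < ·))) 1
      = s := by
  induction s using Multiset.induction_on with
  | empty => simp
  | cons a s ih =>
    have h1 := hs a (Multiset.mem_cons_self a s)
    have h2 := ih fun b hb => hs b (Multiset.mem_cons_of_mem hb)
    have hc : Multiset.card ((s.map Nat.pred).filter (0 < ·)) ≤ Multiset.card s := by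
      simpa using Multiset.card_le_card (Multiset.filter_le (0 < ·) (s.map Nat.pred))
    rw [Multiset.map_cons]
    rcases Nat.lt_or_ge 1 a with h | h
    · have : 0 < Nat.pred a := by simp; omega
      rw [Multiset.filter_cons_of_pos _ this, Multiset.map_cons, Multiset.card_cons,
        Multiset.card_cons, Nat.add_sub_add_right, Multiset.cons_add, h2,
        Nat.succ_pred_eq_of_pos h1]
    · obtain rfl : a = 1 := by omega
      rw [Multiset.filter_cons_of_neg _ (by simp), Multiset.card_cons,
        Nat.succ_sub hc, Multiset.replicate_succ, Multiset.add_cons, h2]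

lemma Multiset.erase_sup_cons_filter {s : Multiset ℕ} (hs : ∀ a ∈ s, 0 < a) :
    (s.sup ::ₘ s.erase s.sup).filter (0 < ·) = s := by
  by_cases h : s = 0
  · simp [h]
  · rw [Multiset.cons_erase (Multiset.sup_nat_mem h), Multiset.filter_eq_self.2 hs]

lemma dysonMap_pos (ρ : ℤ) (s : Multiset ℕ) : ∀ a ∈ dysonMap ρ s, 0 < a := fun _ ha =>
  (Multiset.mem_filter.1 ha).2

lemma dysonInv_pos (ρ : ℤ) (s : Multiset ℕ) : ∀ a ∈ dysonInv ρ s, 0 < a := by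
  intro a ha
  rcases Multiset.mem_add.1 ha with h | h
  · obtain ⟨b, -, rfl⟩ := Multiset.mem_map.1 h; exact Nat.succ_pos b
  · rw [Multiset.eq_of_mem_replicate h]; exact one_pos

lemma dyson_cond {ρ : ℤ} {s : Multiset ℕ} (hs : ∀ a ∈ s, 0 < a) (h0 : 0 ≤ (s.sum : ℤ) + ρ)
    (hr : (s.sup : ℤ) - Multiset.card s ≤ ρ + 1) : 0 ≤ (Multiset.card s : ℤ) + ρ := by
  by_cases h : s = 0
  · subst h; simpa using h0
  · have := hs _ (Multiset.sup_nat_mem h)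
    omega

lemma dysonMap_sum {ρ : ℤ} {s : Multiset ℕ} (hs : ∀ a ∈ s, 0 < a)
    (h : 0 ≤ (Multiset.card s : ℤ) + ρ) : ((dysonMap ρ s).sum : ℤ) = s.sum + ρ := by
  have := Multiset.sum_map_pred_add_card hs
  rw [dysonMap, Multiset.sum_filter_pos, Multiset.sum_cons]
  omega

lemma Multiset.sup_filter_pos (s : Multiset ℕ) : (s.filter (0 < ·)).sup = s.sup := by
  induction s using Multiset.induction_on with
  | empty => simp
  | cons a s ih =>
    rcases Nat.eq_zero_or_pos a with h | h
    · simp [h, ih]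
    · rw [Multiset.filter_cons_of_pos s (p := (0 < ·)) h]; simp [ih]

lemma dysonMap_sup {ρ : ℤ} {s : Multiset ℕ} (h : 0 ≤ (Multiset.card s : ℤ) + ρ)
    (hr : (s.sup : ℤ) - Multiset.card s ≤ ρ + 1) :
    (dysonMap ρ s).sup = (Multiset.card s + ρ).toNat := by
  rw [dysonMap, Multiset.sup_filter_pos, Multiset.sup_cons]
  apply sup_eq_left.2
  rw [Multiset.sup_le]
  intro b hb
  obtain ⟨a, ha, rfl⟩ := Multiset.mem_map.1 hb
  have := Multiset.le_sup ha
  simp only [Nat.pred_eq_sub_one]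
  omega

lemma dysonInv_dysonMap {ρ : ℤ} {s : Multiset ℕ} (hs : ∀ a ∈ s, 0 < a)
    (h : 0 ≤ (Multiset.card s : ℤ) + ρ)
    (hr : (s.sup : ℤ) - Multiset.card s ≤ ρ + 1) : dysonInv ρ (dysonMap ρ s) = s := by
  have he : (dysonMap ρ s).erase (dysonMap ρ s).sup = (s.map Nat.pred).filter (0 < ·) := by
    rw [dysonMap_sup h hr]
    rcases Nat.eq_zero_or_pos (Multiset.card s + ρ).toNat with h0 | h0
    · rw [dysonMap, Multiset.filter_cons_of_neg _ (by omega), h0, Multiset.erase_of_notMem]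
      simp
    · rw [dysonMap, Multiset.filter_cons_of_pos _ (p := (0 < ·)) h0, Multiset.erase_cons_head]
  rw [dysonInv, he, dysonMap_sup h hr, Int.toNat_of_nonneg h]
  simpa using Multiset.map_succ_filter_pred hs

lemma dysonInv_cond {ρ : ℤ} {s : Multiset ℕ} (h0 : 0 ≤ (s.sum : ℤ) - ρ)
    (hr : ρ - 1 ≤ (s.sup : ℤ) - Multiset.card s) :
    (Multiset.card (s.erase s.sup) : ℤ) ≤ (s.sup : ℤ) - ρ := by
  by_cases h : s = 0
  · subst h; simpa using h0
  · have := Multiset.card_erase_add_one (Multiset.sup_nat_mem h)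
    omega

lemma dysonInv_card {ρ : ℤ} {s : Multiset ℕ}
    (h : (Multiset.card (s.erase s.sup) : ℤ) ≤ (s.sup : ℤ) - ρ) :
    (Multiset.card (dysonInv ρ s) : ℤ) = s.sup - ρ := by
  simp only [dysonInv, Multiset.card_add, Multiset.card_map, Multiset.card_replicate]
  omega

lemma dysonMap_dysonInv {ρ : ℤ} {s : Multiset ℕ} (hs : ∀ a ∈ s, 0 < a)
    (h : (Multiset.card (s.erase s.sup) : ℤ) ≤ (s.sup : ℤ) - ρ) :
    dysonMap ρ (dysonInv ρ s) = s := by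
  rw [dysonMap, dysonInv_card h, sub_add_cancel, Int.toNat_natCast]
  have : (dysonInv ρ s).map Nat.pred = s.erase s.sup +
    Multiset.replicate (((s.sup : ℤ) - ρ).toNat - Multiset.card (s.erase s.sup)) 0 := by
    simp [dysonInv, Multiset.map_map]
  rw [this, ← Multiset.cons_add, Multiset.filter_add, Multiset.erase_sup_cons_filter hs]
  simp [Multiset.filter_eq_nil, Multiset.mem_replicate]

/-- Dyson's bijection on partitions with bounded rank. -/
theorem dyson_card (n N : ℕ) (ρ : ℤ) (h : (N : ℤ) = n + ρ) :
    (Finset.univ.filter fun π : n.Partition => partitionRank π ≤ ρ + 1).card =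
      (Finset.univ.filter fun π : N.Partition => ρ - 1 ≤ partitionRank π).card := by
  have key1 : ∀ π : n.Partition, partitionRank π ≤ ρ + 1 → 
      0 ≤ (Multiset.card π.parts : ℤ) + ρ := fun π hπ =>
    dyson_cond (fun a ha => π.parts_pos ha) (by rw [π.parts_sum]; omega) hπ
  have key2 : ∀ π : N.Partition, ρ - 1 ≤ partitionRank π → 
      (Multiset.card (π.parts.erase π.parts.sup) : ℤ) ≤ (π.parts.sup : ℤ) - ρ := fun π hπ =>
    dysonInv_cond (by rw [π.parts_sum]; omega) hπ
  refine Finset.card_bij' (fun π hπ => ⟨dysonMap ρ π.parts, fun {a} => dysonMap_pos _ _ a, ?_⟩)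
    (fun π hπ => ⟨dysonInv ρ π.parts, fun {a} => dysonInv_pos _ _ a, ?_⟩) ?_ ?_ ?_ ?_
  · have := dysonMap_sum (fun a ha => π.parts_pos ha) (key1 π (Finset.mem_filter.1 hπ).2)
    rw [π.parts_sum] at this
    omega
  · have hk := key2 π (Finset.mem_filter.1 hπ).2
    have h1 := dysonInv_card hk
    have h2 := dysonMap_dysonInv (fun a ha => π.parts_pos ha) hk
    have h3 := dysonMap_sum (ρ := ρ) (dysonInv_pos ρ π.parts) (by omega)
    rw [h2, π.parts_sum] at h3
    omega
  · intro π hπ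
    have hr := (Finset.mem_filter.1 hπ).2
    have hk := key1 π hr
    refine Finset.mem_filter.2 ⟨Finset.mem_univ _, ?_⟩
    simp only [partitionRank]
    rw [dysonMap_sup hk hr]
    have : Multiset.card (dysonMap ρ π.parts) ≤ Multiset.card π.parts + 1 := by
      refine (Multiset.card_le_card (Multiset.filter_le _ _)).trans ?_
      simp
    omega
  · intro π hπ
    have hk := key2 π (Finset.mem_filter.1 hπ).2
    refine Finset.mem_filter.2 ⟨Finset.mem_univ _, ?_⟩
    simp only [partitionRank]
    rw [dysonInv_card hk]
    have : (dysonInv ρ π.parts).sup ≤ π.parts.sup + 1 := by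
      rw [Multiset.sup_le]
      intro b hb
      rcases Multiset.mem_add.1 hb with hb | hb
      · obtain ⟨a, ha, rfl⟩ := Multiset.mem_map.1 hb
        exact Nat.succ_le_succ (Multiset.le_sup (Multiset.mem_of_mem_erase ha))
      · rw [Multiset.eq_of_mem_replicate hb]; omega
    omega
  · intro π hπ
    have hr := (Finset.mem_filter.1 hπ).2
    exact Nat.Partition.ext (dysonInv_dysonMap (fun a ha => π.parts_pos ha) (key1 π hr) hr)
  · intro π hπ
    have hk := key2 π (Finset.mem_filter.1 hπ).2
    exact Nat.Partition.ext (dysonMap_dysonInv (fun a ha => π.parts_pos ha) hk)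

/-- The number of partitions of `n` with rank at least `r`. -/
def rankGE (r : ℤ) (n : ℕ) : ℕ :=
  (Finset.univ.filter fun π : n.Partition => r ≤ partitionRank π).card

/-- The number of partitions of `n` with rank at most `-r`. -/
def rankLE (r : ℤ) (n : ℕ) : ℕ :=
  (Finset.univ.filter fun π : n.Partition => partitionRank π ≤ -r).card

lemma rankGE_le (r : ℤ) (n : ℕ) : rankGE r n ≤ partitionCount n :=
  Finset.card_filter_le _ _

lemma rankGE_add_rankLE (r : ℤ) (n : ℕ) : rankGE r n + rankLE (1 - r) n = partitionCount n := by
  have h : rankLE (1 - r) n =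
      (Finset.univ.filter fun π : n.Partition => ¬ r ≤ partitionRank π).card := by
    refine congrArg Finset.card (Finset.filter_congr fun π _ => ?_)
    omega
  rw [h, rankGE, partitionCount, ← Finset.card_univ, Finset.card_filter_add_card_filter_not]

lemma partitionRank_lt {n : ℕ} (hn : n ≠ 0) (π : n.Partition) :
    partitionRank π < n ∧ -(n : ℤ) < partitionRank π := by
  have h0 : π.parts ≠ 0 := by
    intro h; have := π.parts_sum; rw [h] at this; exact hn this.symm
  have h1 := Multiset.le_sum_of_mem (Multiset.sup_nat_mem h0)
  have h2 := π.parts_pos (Multiset.sup_nat_mem h0)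
  have h3 := Multiset.card_pos.2 h0
  have h4 := Multiset.sum_map_pred_add_card (fun a ha => π.parts_pos (i := a) ha)
  rw [π.parts_sum] at h1 h4
  simp only [partitionRank]
  omega

lemma partitionRank_zero (π : (0 : ℕ).Partition) : partitionRank π = 0 := by
  have : π.parts = 0 :=
    Multiset.eq_zero_of_forall_pos_of_sum (fun a ha => π.parts_pos ha) π.parts_sum
  rw [partitionRank, this]
  rfl

lemma rankGE_of_le {r n : ℕ} (h : n ≤ r) (h' : ¬ (n = 0 ∧ r = 0)) : rankGE r n = 0 := by
  rw [rankGE, Finset.card_eq_zero, Finset.filter_eq_empty_iff]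
  intro π _
  by_cases hn : n = 0
  · subst hn; rw [partitionRank_zero]; omega
  · have := partitionRank_lt hn π; omega

lemma rankLE_of_le {r n : ℕ} (h : n ≤ r) (h' : ¬ (n = 0 ∧ r = 0)) : rankLE r n = 0 := by
  rw [rankLE, Finset.card_eq_zero, Finset.filter_eq_empty_iff]
  intro π _
  by_cases hn : n = 0
  · subst hn; rw [partitionRank_zero]; omega
  · have := partitionRank_lt hn π; omega

lemma rankGE_zero_zero : rankGE 0 0 = 1 := by
  rw [rankGE, Finset.filter_true_of_mem fun π _ => (partitionRank_zero π).ge]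
  simp

lemma rankLE_zero_zero : rankLE 0 0 = 1 := by
  rw [rankLE, neg_zero, Finset.filter_true_of_mem fun π _ => (partitionRank_zero π).le]
  simp

lemma rankGE_add (r n : ℕ) :
    rankGE r (n + r + 1) + rankGE (r + 3 : ℕ) n = partitionCount n := by
  have h := dyson_card n (n + r + 1) (r + 1) (by push_cast; ring)
  have h2 := rankGE_add_rankLE (r + 3 : ℕ) n
  have e1 : (r : ℤ) + 1 + 1 = -(1 - ((r + 3 : ℕ) : ℤ)) := by push_cast; ring
  rw [e1, show (r : ℤ) + 1 - 1 = r by ring] at h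
  change rankLE _ _ = rankGE _ _ at h
  omega

lemma rankLE_add (r n : ℕ) :
    rankLE r (n + r + 1) + rankLE (r + 3 : ℕ) n = partitionCount n := by
  have h := dyson_card (n + r + 1) n (-r - 1) (by push_cast; ring)
  have h2 := rankGE_add_rankLE (-r - 2) n
  rw [show (-r : ℤ) - 1 + 1 = -r by ring, show (-r : ℤ) - 1 - 1 = -r - 2 by ring] at h
  change rankLE _ _ = rankGE _ _ at h
  rw [show (1 : ℤ) - (-r - 2) = (r + 3 : ℕ) by push_cast; ring] at h2
  omega

/-- The distribution of the rank is symmetric. -/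
lemma rankGE_eq_rankLE (n : ℕ) : ∀ r : ℕ, rankGE r n = rankLE r n := by
  induction n using Nat.strong_induction_on with
  | _ n ih =>
    intro r
    rcases Nat.lt_or_ge r n with h | h
    · obtain ⟨m, rfl⟩ := Nat.exists_eq_add_of_lt h
      have h1 := rankGE_add r m
      have h2 := rankLE_add r m
      have h3 := ih m (by omega) (r + 3)
      rw [show r + m + 1 = m + r + 1 by ring]
      omega
    · by_cases h' : n = 0 ∧ r = 0
      · obtain ⟨rfl, rfl⟩ := h'
        exact rankGE_zero_zero.trans rankLE_zero_zero.symm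
      · rw [rankGE_of_le h h', rankLE_of_le h h']

lemma partitionCount_eq (n : ℕ) : partitionCount n = rankGE 0 n + rankGE 1 n := by
  have h := rankGE_add_rankLE 0 n
  have := rankGE_eq_rankLE n 1
  simp only [sub_zero, Nat.cast_one] at *
  omega

lemma partitionRank_bound {n : ℕ} (π : n.Partition) :
    partitionRank π ≤ n ∧ -(n : ℤ) ≤ partitionRank π := by
  by_cases hn : n = 0
  · subst hn; simp [partitionRank_zero]
  · have := partitionRank_lt hn π; omega

lemma rankGE_eq_sum (r : ℤ) (n : ℕ) :
    (rankGE r n : ℤ) = ∑ π : n.Partition, if r ≤ partitionRank π then 1 else 0 := by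
  simp [rankGE]

lemma rankGE_eq_sum' (r n : ℕ) :
    (rankGE r n : ℤ) = ∑ π : n.Partition, if partitionRank π ≤ -r then 1 else 0 := by
  rw [rankGE_eq_rankLE]
  simp [rankLE]

lemma sum_indicator_int (N : ℕ) (k : ℤ) (a b : ℕ) (hab : a ≤ b) (hb : b ≤ a + 11) (ha : 1 ≤ a)
    (hk : k ≤ N) :
    (∑ m ∈ Finset.range (N + 1), (((if ((11 * m + a : ℕ) : ℤ) ≤ k then 1 else 0) : ℤ) -
      if ((11 * m + b : ℕ) : ℤ) ≤ k then 1 else 0)) =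
      if 0 ≤ k - a ∧ (k - a) % 11 < b - a then 1 else 0 := by
  by_cases h : 0 ≤ k - a
  · rw [Finset.sum_eq_single ((k - a) / 11).toNat]
    · have : (((k - a) / 11).toNat : ℤ) = (k - a) / 11 := Int.toNat_of_nonneg (by omega)
      push_cast
      rw [this]
      split_ifs <;> omega
    · intro m _ hm
      split_ifs <;> omega
    · intro hm
      simp only [Finset.mem_range] at hm
      omega
  · rw [if_neg (by tauto)]
    refine Finset.sum_eq_zero fun m _ => ?_
    split_ifs <;> omega

lemma rankCount_zero_eq (n : ℕ) : (rankCount 0 11 n : ℤ) = partitionCount n -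
    2 * ∑ m ∈ Finset.range (n + 1),
      ((rankGE (11 * m + 1 : ℕ) n : ℤ) - rankGE (11 * m + 11 : ℕ) n) := by
  have h1 : ∑ m ∈ Finset.range (n + 1),
      ((rankGE (11 * m + 1 : ℕ) n : ℤ) - rankGE (11 * m + 11 : ℕ) n) = ∑ π : n.Partition,
      if 0 ≤ partitionRank π - 1 ∧ (partitionRank π - 1) % 11 < 10 then 1 else 0 := by
    simp only [rankGE_eq_sum, ← Finset.sum_sub_distrib]
    rw [Finset.sum_comm]
    refine Finset.sum_congr rfl fun π _ => ?_
    simpa using sum_indicator_int n (partitionRank π) 1 11 (by norm_num) (by norm_num) le_rfl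
      (partitionRank_bound π).1
  have h2 : ∑ m ∈ Finset.range (n + 1),
      ((rankGE (11 * m + 1 : ℕ) n : ℤ) - rankGE (11 * m + 11 : ℕ) n) = ∑ π : n.Partition,
      if 0 ≤ -partitionRank π - 1 ∧ (-partitionRank π - 1) % 11 < 10 then 1 else 0 := by
    simp only [rankGE_eq_sum', ← Finset.sum_sub_distrib]
    rw [Finset.sum_comm]
    refine Finset.sum_congr rfl fun π _ => ?_
    have := sum_indicator_int n (-partitionRank π) 1 11 (by norm_num) (by norm_num) le_rfl
      (by have := (partitionRank_bound π).2; omega)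
    simp only [le_neg (b := partitionRank π)] at this
    exact this
  rw [two_mul]
  nth_rewrite 1 [h1]
  rw [h2, rankCount, partitionCount, ← Finset.sum_add_distrib, ← Finset.card_univ,
    Finset.card_filter, Finset.card_eq_sum_ones]
  push_cast
  rw [← Finset.sum_sub_distrib]
  refine Finset.sum_congr rfl fun π _ => ?_
  split_ifs <;> omega

lemma rankCount_five_eq (n : ℕ) : (rankCount 5 11 n : ℤ) = ∑ m ∈ Finset.range (n + 1),
      ((rankGE (11 * m + 5 : ℕ) n : ℤ) - rankGE (11 * m + 7 : ℕ) n) := by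
  have h1 : ∑ m ∈ Finset.range (n + 1),
      ((rankGE (11 * m + 5 : ℕ) n : ℤ) - rankGE (11 * m + 6 : ℕ) n) = ∑ π : n.Partition,
      if 0 ≤ partitionRank π - 5 ∧ (partitionRank π - 5) % 11 < 1 then 1 else 0 := by
    simp only [rankGE_eq_sum, ← Finset.sum_sub_distrib]
    rw [Finset.sum_comm]
    refine Finset.sum_congr rfl fun π _ => ?_
    simpa using sum_indicator_int n (partitionRank π) 5 6 (by norm_num) (by norm_num) (by norm_num)
      (partitionRank_bound π).1
  have h2 : ∑ m ∈ Finset.range (n + 1),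
      ((rankGE (11 * m + 6 : ℕ) n : ℤ) - rankGE (11 * m + 7 : ℕ) n) = ∑ π : n.Partition,
      if 0 ≤ -partitionRank π - 6 ∧ (-partitionRank π - 6) % 11 < 1 then 1 else 0 := by
    simp only [rankGE_eq_sum', ← Finset.sum_sub_distrib]
    rw [Finset.sum_comm]
    refine Finset.sum_congr rfl fun π _ => ?_
    have := sum_indicator_int n (-partitionRank π) 6 7 (by norm_num) (by norm_num) (by norm_num)
      (by have := (partitionRank_bound π).2; omega)
    simp only [le_neg (b := partitionRank π)] at this
    exact this
  have h3 : ∀ m : ℕ, (rankGE (11 * m + 5 : ℕ) n : ℤ) - rankGE (11 * m + 7 : ℕ) n =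
      ((rankGE (11 * m + 5 : ℕ) n : ℤ) - rankGE (11 * m + 6 : ℕ) n) +
      ((rankGE (11 * m + 6 : ℕ) n : ℤ) - rankGE (11 * m + 7 : ℕ) n) := fun m => by ring
  simp only [h3]
  rw [Finset.sum_add_distrib, h1, h2, rankCount, ← Finset.sum_add_distrib, Finset.card_filter]
  push_cast
  refine Finset.sum_congr rfl fun π _ => ?_
  split_ifs <;> omega

lemma partitionCount_le (n : ℕ) : partitionCount n ≤ 2 ^ n := by
  have h : Function.Surjective (Nat.Partition.ofComposition n) :=
    Nat.Partition.ofComposition_surj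
  refine (Fintype.card_le_of_surjective _ h).trans ?_
  rw [composition_card]
  exact Nat.pow_le_pow_right (by norm_num) (Nat.sub_le n 1)

lemma hasSum_iff_of_eq {ι α : Type*} [AddCommMonoid α] [TopologicalSpace α] {f g : ι → α} {a : α}
    (h : ∀ i, f i = g i) : HasSum f a ↔ HasSum g a := by
  rw [funext h]

/-- The generating function of the partition function. -/
noncomputable def partitionGF (x : ℂ) : ℂ := ∑' n, (partitionCount n : ℂ) * x ^ n

/-- The generating function of partitions with rank at least `r`. -/
noncomputable def rankGEGF (r : ℕ) (x : ℂ) : ℂ := ∑' n, (rankGE r n : ℂ) * x ^ n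

/-- The generating function of partitions with rank congruent to `a` modulo `11`. -/
noncomputable def rankGF (a : ℤ) (x : ℂ) : ℂ := ∑' n, (rankCount a 11 n : ℂ) * x ^ n

lemma norm_coeff_mul_pow_le {x : ℂ} (hx : ‖x‖ ≤ 1 / 9) {c n : ℕ} (hc : c ≤ partitionCount n) :
    ‖(c : ℂ) * x ^ n‖ ≤ (2 / 9) ^ n := by
  rw [norm_mul, norm_pow, Complex.norm_natCast]
  have h1 : (c : ℝ) ≤ 2 ^ n := by exact_mod_cast hc.trans (partitionCount_le n)
  calc (c : ℝ) * ‖x‖ ^ n ≤ 2 ^ n * (1 / 9) ^ n := by gcongr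
    _ = (2 / 9) ^ n := by rw [← mul_pow]; norm_num

lemma summable_coeff_mul_pow {x : ℂ} (hx : ‖x‖ ≤ 1 / 9) {c : ℕ → ℕ}
    (hc : ∀ n, c n ≤ partitionCount n) : Summable fun n => (c n : ℂ) * x ^ n :=
  Summable.of_norm_bounded (summable_geometric_of_lt_one (by norm_num) (by norm_num))
    fun n => norm_coeff_mul_pow_le hx (hc n)

lemma norm_tsum_coeff_le {x : ℂ} (hx : ‖x‖ ≤ 1 / 9) {c : ℕ → ℕ}
    (hc : ∀ n, c n ≤ partitionCount n) : ‖∑' n, (c n : ℂ) * x ^ n‖ ≤ 2 :=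
  (tsum_of_norm_bounded (hasSum_geometric_of_lt_one (by norm_num) (by norm_num))
    fun n => norm_coeff_mul_pow_le hx (hc n)).trans (by norm_num)

lemma rankGEGF_rec {x : ℂ} (hx : ‖x‖ ≤ 1 / 9) (r : ℕ) :
    rankGEGF r x = (if r = 0 then 1 else 0) +
      x ^ (r + 1) * (partitionGF x - rankGEGF (r + 3) x) := by
  rw [rankGEGF, ← (summable_coeff_mul_pow hx fun n => rankGE_le r n).sum_add_tsum_nat_add (r + 1)]
  congr 1
  · split_ifs with h
    · subst h
      simpa using rankGE_zero_zero
    · refine Finset.sum_eq_zero fun n hn => ?_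
      rw [rankGE_of_le (by simpa [Nat.lt_succ_iff] using hn) (by tauto)]
      simp
  · rw [partitionGF, rankGEGF, ← (summable_coeff_mul_pow hx fun n => le_rfl).tsum_sub
      (summable_coeff_mul_pow hx fun n => rankGE_le (r + 3 : ℕ) n), ← tsum_mul_left]
    refine tsum_congr fun n => ?_
    rw [← rankGE_add r n]
    push_cast
    rw [add_assoc n r 1]
    ring

/-- The alternating series appearing in the generating function of partitions with rank at
least `r`. -/
noncomputable def rankSeries (r : ℕ) (q : ℂ) : ℂ :=
  ∑' k : ℕ, (-1) ^ k * q ^ ((k + 1) * (3 * k + 2) + 2 * (k + 1) * r)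

lemma norm_pow_le_of_le {q : ℂ} (hq : ‖q‖ ≤ 1 / 3) {m n : ℕ} (h : m ≤ n) :
    ‖q ^ n‖ ≤ (1 / 3) ^ m := by
  rw [norm_pow]
  exact (pow_le_pow_left₀ (norm_nonneg q) hq n).trans
    (pow_le_pow_of_le_one (by norm_num) (by norm_num) h)

lemma norm_rankSeries_term_le {q : ℂ} (hq : ‖q‖ ≤ 1 / 3) (r k : ℕ) :
    ‖(-1 : ℂ) ^ k * q ^ ((k + 1) * (3 * k + 2) + 2 * (k + 1) * r)‖ ≤ (1 / 3) ^ r * (1 / 3) ^ k := by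
  rw [norm_mul, norm_pow, norm_neg, norm_one, one_pow, one_mul, ← pow_add]
  exact norm_pow_le_of_le hq (by nlinarith [Nat.zero_le (k * r), Nat.zero_le (k * k)])

lemma summable_rankSeries {q : ℂ} (hq : ‖q‖ ≤ 1 / 3) (r : ℕ) :
    Summable fun k : ℕ => (-1 : ℂ) ^ k * q ^ ((k + 1) * (3 * k + 2) + 2 * (k + 1) * r) :=
  Summable.of_norm_bounded
    ((summable_geometric_of_lt_one (by norm_num) (by norm_num)).mul_left _)
    (norm_rankSeries_term_le hq r)

lemma norm_rankSeries_le {q : ℂ} (hq : ‖q‖ ≤ 1 / 3) (r : ℕ) : ‖rankSeries r q‖ ≤ 2 := by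
  refine (tsum_of_norm_bounded ((hasSum_geometric_of_lt_one (by norm_num) (by norm_num)).mul_left _)
    (norm_rankSeries_term_le hq r)).trans ?_
  have : ((1 : ℝ) / 3) ^ r ≤ 1 := pow_le_one₀ (by norm_num) (by norm_num)
  norm_num at *
  linarith

lemma rankSeries_rec {q : ℂ} (hq : ‖q‖ ≤ 1 / 3) (r : ℕ) :
    rankSeries r q = q ^ (2 * (r + 1)) * (1 - rankSeries (r + 3) q) := by
  rw [rankSeries, (summable_rankSeries hq r).tsum_eq_zero_add, rankSeries, mul_sub, mul_one,
    sub_eq_add_neg, ← tsum_mul_left, ← tsum_neg]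
  congr 1
  · ring
  · refine tsum_congr fun k => ?_
    rw [pow_succ (-1 : ℂ), mul_left_comm _ ((-1 : ℂ) ^ k), ← pow_add]
    rw [mul_neg_one, neg_mul]
    congr 3
    ring

lemma norm_sq_le {q : ℂ} (hq : ‖q‖ ≤ 1 / 3) : ‖q ^ 2‖ ≤ 1 / 9 := by
  rw [norm_pow]; nlinarith [norm_nonneg q]

lemma rankGEGF_eq {q : ℂ} (hq : ‖q‖ ≤ 1 / 3) (r : ℕ) :
    rankGEGF r (q ^ 2) = (if r = 0 then 1 else 0) + partitionGF (q ^ 2) * rankSeries r q := by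
  have hx := norm_sq_le hq
  have key : ∀ k r : ℕ, ‖rankGEGF (r + 1) (q ^ 2) - partitionGF (q ^ 2) * rankSeries (r + 1) q‖ ≤
      6 * (1 / 9) ^ k := by
    intro k
    induction k with
    | zero =>
      intro r
      have h1 : ‖rankGEGF (r + 1) (q ^ 2)‖ ≤ 2 := norm_tsum_coeff_le hx fun n => rankGE_le _ n
      have h2 : ‖partitionGF (q ^ 2)‖ ≤ 2 := norm_tsum_coeff_le hx fun n => le_rfl
      have h3 := norm_rankSeries_le hq (r + 1)
      refine (norm_sub_le _ _).trans ?_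
      rw [norm_mul]
      nlinarith [norm_nonneg (rankSeries (r + 1) q), norm_nonneg (partitionGF (q ^ 2))]
    | succ k ih =>
      intro r
      have h := ih (r + 3)
      rw [rankGEGF_rec hx, rankSeries_rec hq, if_neg (by omega), zero_add]
      rw [show (q ^ 2) ^ (r + 1 + 1) * (partitionGF (q ^ 2) - rankGEGF (r + 1 + 3) (q ^ 2)) -
        partitionGF (q ^ 2) * (q ^ (2 * (r + 1 + 1)) * (1 - rankSeries (r + 1 + 3) q)) =
        -((q ^ 2) ^ (r + 2) * (rankGEGF (r + 3 + 1) (q ^ 2) -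
          partitionGF (q ^ 2) * rankSeries (r + 3 + 1) q)) by ring, norm_neg, norm_mul, norm_pow]
      calc ‖q ^ 2‖ ^ (r + 2) * _ ≤ (1 / 9) ^ (r + 2) * (6 * (1 / 9) ^ k) := by gcongr
        _ ≤ (1 / 9) ^ 1 * (6 * (1 / 9) ^ k) :=
          mul_le_mul_of_nonneg_right (pow_le_pow_of_le_one (by norm_num) (by norm_num) (by omega))
            (by positivity)
        _ = _ := by ring
  have key2 : ∀ r, rankGEGF (r + 1) (q ^ 2) = partitionGF (q ^ 2) * rankSeries (r + 1) q := by
    intro r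
    rw [← sub_eq_zero, ← norm_le_zero_iff]
    refine ge_of_tendsto' (x := Filter.atTop) (f := fun k : ℕ => (6 : ℝ) * (1 / 9) ^ k) ?_
      fun k => key k r
    simpa using (tendsto_pow_atTop_nhds_zero_of_lt_one (r := (1 / 9 : ℝ)) (by norm_num)
      (by norm_num)).const_mul 6
  rcases r with _ | r
  · rw [rankGEGF_rec hx, rankSeries_rec hq, key2]
    ring
  · rw [key2]; simp

/-- The Lambert series obtained by summing `rankSeries (11 m + a)` over `m`. -/
noncomputable def rankLambert (a : ℕ) (q : ℂ) : ℂ :=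
  ∑' k : ℕ, (-1) ^ k * q ^ ((k + 1) * (3 * k + 2) + 2 * (k + 1) * a) / (1 - q ^ (22 * (k + 1)))

lemma norm_pow_lt_one {q : ℂ} (hq : ‖q‖ < 1) {n : ℕ} (hn : n ≠ 0) : ‖q ^ n‖ < 1 := by
  rw [norm_pow]
  exact pow_lt_one₀ (norm_nonneg q) hq hn

lemma hasSum_rankSeries {q : ℂ} (hq : ‖q‖ ≤ 1 / 3) (a : ℕ) :
    HasSum (fun m : ℕ => rankSeries (11 * m + a) q) (rankLambert a q) := by
  let F : ℕ × ℕ → ℂ := fun p =>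
    (-1) ^ p.1 * q ^ ((p.1 + 1) * (3 * p.1 + 2) + 2 * (p.1 + 1) * (11 * p.2 + a))
  have hg : Summable fun k : ℕ => ((1 : ℝ) / 3) ^ k :=
    summable_geometric_of_lt_one (by norm_num) (by norm_num)
  have hF : Summable F := by
    refine Summable.of_norm_bounded (hg.mul_of_nonneg hg (fun k => by positivity)
      (fun k => by positivity)) fun p => ?_
    refine (norm_rankSeries_term_le hq _ _).trans ?_
    rw [mul_comm]
    exact mul_le_mul_of_nonneg_left (pow_le_pow_of_le_one (by norm_num) (by norm_num) (by omega))
      (by positivity)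
  have h1 : ∀ k, HasSum (fun m => F (k, m)) ((-1) ^ k *
      q ^ ((k + 1) * (3 * k + 2) + 2 * (k + 1) * a) / (1 - q ^ (22 * (k + 1)))) := by
    intro k
    have h := (hasSum_geometric_of_norm_lt_one (norm_pow_lt_one (q := q) (n := 22 * (k + 1))
      (by linarith) (by omega))).mul_left ((-1) ^ k * q ^ ((k + 1) * (3 * k + 2) + 2 * (k + 1) * a))
    rw [← div_eq_mul_inv] at h
    refine (hasSum_iff_of_eq fun m => ?_).1 h
    rw [mul_assoc, ← pow_mul, ← pow_add]
    congr 2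
    ring
  have h2 := hF.hasSum.prod_fiberwise h1
  have h3 := (Equiv.prodComm ℕ ℕ).hasSum_iff.2 hF.hasSum
  have h4 := h3.prod_fiberwise fun m => (summable_rankSeries hq (11 * m + a)).hasSum
  rw [rankLambert, h2.tsum_eq]
  exact h4

lemma hasSum_rankGE_sum {x : ℂ} (hx : ‖x‖ ≤ 1 / 9) (r : ℕ → ℕ) (hr : ∀ m, m + 1 ≤ r m) :
    HasSum (fun n => (∑ m ∈ Finset.range (n + 1), (rankGE (r m) n : ℂ)) * x ^ n)
      (∑' m, rankGEGF (r m) x) ∧ Summable fun m => rankGEGF (r m) x := by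
  let F : ℕ × ℕ → ℂ := fun p => (rankGE (r p.1) p.2 : ℂ) * x ^ p.2
  have h0 : ∀ m n, n ≤ m → rankGE (r m) n = 0 := fun m n h =>
    rankGE_of_le (by have := hr m; omega) (by have := hr m; omega)
  have hF : Summable F := by
    refine Summable.of_norm_bounded ((summable_geometric_of_lt_one (r := (1 / 3 : ℝ)) (by norm_num)
      (by norm_num)).mul_of_nonneg (summable_geometric_of_lt_one (r := (2 / 3 : ℝ)) (by norm_num)
      (by norm_num)) (fun k => by positivity) (fun k => by positivity)) fun p => ?_
    rcases Nat.lt_or_ge p.1 p.2 with h | h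
    · refine (norm_coeff_mul_pow_le hx (rankGE_le _ _)).trans ?_
      calc ((2 : ℝ) / 9) ^ p.2 = (1 / 3) ^ p.2 * (2 / 3) ^ p.2 := by rw [← mul_pow]; norm_num
        _ ≤ _ := mul_le_mul_of_nonneg_right
          (pow_le_pow_of_le_one (by norm_num) (by norm_num) h.le) (by positivity)
    · simp only [F]
      rw [h0 _ _ h]
      simp only [Nat.cast_zero, zero_mul, norm_zero]
      positivity
  have h2 := hF.hasSum.prod_fiberwise
    fun m => (summable_coeff_mul_pow hx fun n => rankGE_le (r m) n).hasSum
  have h3 := (Equiv.prodComm ℕ ℕ).hasSum_iff.2 hF.hasSum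
  have h4 : ∀ n, HasSum (fun m => F (m, n))
      ((∑ m ∈ Finset.range (n + 1), (rankGE (r m) n : ℂ)) * x ^ n) := by
    intro n
    rw [Finset.sum_mul]
    refine hasSum_sum_of_ne_finset_zero fun m hm => ?_
    simp only [F]
    rw [h0 _ _ (by simp at hm; omega)]
    simp
  have h5 := h3.prod_fiberwise h4
  refine ⟨?_, h2.summable⟩
  have : ∑' m, rankGEGF (r m) x = ∑' p, F p := h2.tsum_eq
  rw [this]
  exact h5

lemma tsum_rankGEGF {q : ℂ} (hq : ‖q‖ ≤ 1 / 3) {a : ℕ} (ha : a ≠ 0) :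
    ∑' m, rankGEGF (11 * m + a) (q ^ 2) = partitionGF (q ^ 2) * rankLambert a q := by
  rw [← ((hasSum_rankSeries hq a).mul_left _).tsum_eq]
  refine tsum_congr fun m => ?_
  rw [rankGEGF_eq hq, if_neg (by omega), zero_add]

lemma rankGF_zero_eq {q : ℂ} (hq : ‖q‖ ≤ 1 / 3) : rankGF 0 (q ^ 2) =
    partitionGF (q ^ 2) * (1 - 2 * (rankLambert 1 q - rankLambert 11 q)) := by
  have hx := norm_sq_le hq
  have h1 := (hasSum_rankGE_sum hx (fun m => 11 * m + 1) fun m => by omega).1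
  have h2 := (hasSum_rankGE_sum hx (fun m => 11 * m + 11) fun m => by omega).1
  rw [tsum_rankGEGF hq (by omega)] at h1 h2
  have h := (summable_coeff_mul_pow hx fun n => le_rfl).hasSum.sub ((h1.sub h2).mul_left 2)
  rw [rankGF]
  have e : ∀ n, (rankCount 0 11 n : ℂ) = partitionCount n - 2 * (
      ∑ m ∈ Finset.range (n + 1), (rankGE (11 * m + 1 : ℕ) n : ℂ) -
      ∑ m ∈ Finset.range (n + 1), (rankGE (11 * m + 11 : ℕ) n : ℂ)) := by
    intro n
    rw [← Finset.sum_sub_distrib]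
    exact_mod_cast rankCount_zero_eq n
  have h' := (hasSum_iff_of_eq (f := fun n => (rankCount 0 11 n : ℂ) * (q ^ 2) ^ n) fun n => ?_).2 h
  · rw [h'.tsum_eq]
    change partitionGF (q ^ 2) - _ = _
    ring
  · rw [e]; ring

lemma rankGF_five_eq {q : ℂ} (hq : ‖q‖ ≤ 1 / 3) : rankGF 5 (q ^ 2) =
    partitionGF (q ^ 2) * (rankLambert 5 q - rankLambert 7 q) := by
  have hx := norm_sq_le hq
  have h1 := (hasSum_rankGE_sum hx (fun m => 11 * m + 5) fun m => by omega).1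
  have h2 := (hasSum_rankGE_sum hx (fun m => 11 * m + 7) fun m => by omega).1
  rw [tsum_rankGEGF hq (by omega)] at h1 h2
  have h := h1.sub h2
  rw [rankGF]
  have e : ∀ n, (rankCount 5 11 n : ℂ) = 
      ∑ m ∈ Finset.range (n + 1), (rankGE (11 * m + 5 : ℕ) n : ℂ) -
      ∑ m ∈ Finset.range (n + 1), (rankGE (11 * m + 7 : ℕ) n : ℂ) := by
    intro n
    rw [← Finset.sum_sub_distrib]
    exact_mod_cast rankCount_five_eq n
  have h' := (hasSum_iff_of_eq (f := fun n => (rankCount 5 11 n : ℂ) * (q ^ 2) ^ n) fun n => ?_).2 h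
  · rw [h'.tsum_eq]
    ring
  · rw [e]; ring

/-- The bilateral pentagonal series in `q ^ 2`. -/
noncomputable def pentagonalSeries (q : ℂ) : ℂ := ∑' n : ℤ, (-1) ^ n * q ^ (n * (3 * n + 1))

/-- The bilateral Lambert series with pole terms removed that appears in the generating
functions of the rank modulo `11`. -/
noncomputable def rankBilateral (a : ℤ) (q : ℂ) : ℂ :=
  ∑' n : ℤ, if n = 0 then 0 else (-1) ^ n * q ^ (n * (3 * n + 1) + 2 * a * n) / (1 - q ^ (22 * n))

lemma pentagonalSeries_eq {q : ℂ} (hq : ‖q‖ ≤ 1 / 3) :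
    pentagonalSeries q = 1 - rankSeries 0 q - rankSeries 1 q := by
  have h0 := (summable_rankSeries hq 0).hasSum
  have h1 := (summable_rankSeries hq 1).hasSum
  set f : ℤ → ℂ := fun n => (-1) ^ n * q ^ (n * (3 * n + 1)) with hf
  have hp : HasSum (fun n : ℕ => f n) (1 - rankSeries 1 q) := by
    rw [← hasSum_nat_add_iff' 1]
    have h := h1.neg
    simp only [Finset.range_one, Finset.sum_singleton, Nat.cast_zero]
    rw [show f 0 = 1 by simp [hf], sub_sub_cancel_left]
    refine (hasSum_iff_of_eq fun k => ?_).2 h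
    simp only [hf]
    rw [show ((k + 1 : ℕ) : ℤ) * (3 * ((k + 1 : ℕ) : ℤ) + 1) =
      (((k + 1) * (3 * k + 2) + 2 * (k + 1) * 1 : ℕ) : ℤ) by push_cast; ring]
    rw [zpow_natCast, zpow_natCast, pow_succ]
    ring
  have hn : HasSum (fun n : ℕ => f (-((n : ℤ) + 1))) (-rankSeries 0 q) := by
    refine (hasSum_iff_of_eq fun k => ?_).2 h0.neg
    simp only [hf]
    rw [show -((k : ℤ) + 1) * (3 * -((k : ℤ) + 1) + 1) =
      (((k + 1) * (3 * k + 2) + 2 * (k + 1) * 0 : ℕ) : ℤ) by push_cast; ring]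
    rw [zpow_natCast, zpow_neg, ← inv_zpow, inv_neg, inv_one,
      show (k : ℤ) + 1 = ((k + 1 : ℕ) : ℤ) by push_cast; ring, zpow_natCast, pow_succ]
    ring
  rw [pentagonalSeries, (HasSum.of_nat_of_neg_add_one hp hn).tsum_eq]
  ring

lemma summable_rankLambert {q : ℂ} (hq : ‖q‖ ≤ 1 / 3) (a : ℕ) : Summable fun k : ℕ =>
    (-1 : ℂ) ^ k * q ^ ((k + 1) * (3 * k + 2) + 2 * (k + 1) * a) / (1 - q ^ (22 * (k + 1))) := by
  refine Summable.of_norm_bounded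
    (((summable_geometric_of_lt_one (r := (1 / 3 : ℝ)) (by norm_num) (by norm_num)).mul_left
      ((1 / 3) ^ a)).mul_right 2) fun k => ?_
  rw [norm_div]
  have h1 : 1 / 2 ≤ ‖1 - q ^ (22 * (k + 1))‖ := by
    have h2 := norm_pow_le_of_le hq (show 1 ≤ 22 * (k + 1) by omega)
    have h3 := norm_sub_norm_le 1 (q ^ (22 * (k + 1)))
    rw [norm_one] at h3
    linarith
  rw [div_le_iff₀ (by linarith)]
  refine (norm_rankSeries_term_le hq a k).trans ?_
  have : (0 : ℝ) ≤ (1 / 3) ^ a * (1 / 3) ^ k := by positivity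
  nlinarith

lemma rankBilateral_eq {q : ℂ} (hq : ‖q‖ ≤ 1 / 3) (h0 : q ≠ 0) {a : ℕ} (ha : a ≤ 11) :
    rankBilateral a q = rankLambert (11 - a) q - rankLambert (a + 1) q := by
  have h1 := (summable_rankLambert hq (a + 1)).hasSum
  have h2 := (summable_rankLambert hq (11 - a)).hasSum
  set f : ℤ → ℂ := fun n => if n = 0 then 0 else
    (-1) ^ n * q ^ (n * (3 * n + 1) + 2 * (a : ℤ) * n) / (1 - q ^ (22 * n)) with hf
  have hp : HasSum (fun n : ℕ => f n) (-rankLambert (a + 1) q) := by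
    rw [← hasSum_nat_add_iff' 1]
    have h := h1.neg
    simp only [Finset.range_one, Finset.sum_singleton, Nat.cast_zero]
    rw [show f 0 = 0 by simp [hf], sub_zero]
    refine (hasSum_iff_of_eq fun k => ?_).2 h
    simp only [hf]
    rw [if_neg (by omega), show ((k + 1 : ℕ) : ℤ) * (3 * ((k + 1 : ℕ) : ℤ) + 1) +
      2 * (a : ℤ) * ((k + 1 : ℕ) : ℤ) =
      (((k + 1) * (3 * k + 2) + 2 * (k + 1) * (a + 1) : ℕ) : ℤ) by push_cast; ring,
      show 22 * ((k + 1 : ℕ) : ℤ) = ((22 * (k + 1) : ℕ) : ℤ) by push_cast; ring]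
    rw [zpow_natCast, zpow_natCast, zpow_natCast, pow_succ]
    ring
  have hn : HasSum (fun n : ℕ => f (-((n : ℤ) + 1))) (rankLambert (11 - a) q) := by
    refine (hasSum_iff_of_eq fun k => ?_).2 h2
    simp only [hf]
    have e : (((11 - a : ℕ)) : ℤ) = 11 - a := by omega
    have h3 : q ^ (22 * (k + 1)) ≠ 0 := pow_ne_zero _ h0
    have h4 : 1 - q ^ (22 * (k + 1)) ≠ 0 := by
      intro h
      have := norm_pow_lt_one (q := q) (n := 22 * (k + 1)) (by linarith) (by omega)
      rw [← sub_eq_zero.1 h, norm_one] at this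
      exact lt_irrefl _ this
    rw [if_neg (by omega), show -((k : ℤ) + 1) * (3 * -((k : ℤ) + 1) + 1) + 2 * (a : ℤ) *
      -((k : ℤ) + 1) = (((k + 1) * (3 * k + 2) + 2 * (k + 1) * (11 - a) : ℕ) : ℤ) +
        -((22 * (k + 1) : ℕ) : ℤ) by
        push_cast; rw [e]; ring,
      show 22 * (-((k : ℤ) + 1)) = -((22 * (k + 1) : ℕ) : ℤ) by push_cast; ring]
    rw [zpow_add₀ h0, zpow_neg, zpow_neg, zpow_natCast, zpow_natCast, ← inv_zpow, inv_neg,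
      inv_one, show (k : ℤ) + 1 = ((k + 1 : ℕ) : ℤ) by push_cast; ring, zpow_natCast, pow_succ]
    have h5 : 1 - (q ^ (22 * (k + 1)))⁻¹ ≠ 0 := by
      rw [sub_ne_zero] at h4 ⊢
      intro h
      exact h4 (inv_eq_one.1 h.symm).symm
    rw [div_eq_div_iff h5 h4]
    field_simp
    ring
  rw [rankBilateral, (HasSum.of_nat_of_neg_add_one hp hn).tsum_eq]
  ring

lemma partitionGF_mul_pentagonalSeries {q : ℂ} (hq : ‖q‖ ≤ 1 / 3) :
    partitionGF (q ^ 2) * pentagonalSeries q = 1 := by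
  have hx := norm_sq_le hq
  have h : partitionGF (q ^ 2) = rankGEGF 0 (q ^ 2) + rankGEGF 1 (q ^ 2) := by
    rw [partitionGF, rankGEGF, rankGEGF, ← (summable_coeff_mul_pow hx fun n =>
      rankGE_le _ n).tsum_add (summable_coeff_mul_pow hx fun n => rankGE_le _ n)]
    refine tsum_congr fun n => ?_
    rw [partitionCount_eq]
    push_cast
    ring
  rw [rankGEGF_eq hq, rankGEGF_eq hq] at h
  rw [pentagonalSeries_eq hq]
  simp only [if_true, one_ne_zero, if_false] at h
  linear_combination h

theorem rankGF_zero_mul_pentagonalSeries {q : ℂ} (hq : ‖q‖ ≤ 1 / 3) (h0 : q ≠ 0) :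
    (11 * rankGF 0 (q ^ 2) - partitionGF (q ^ 2)) * pentagonalSeries q =
      10 - 22 * rankBilateral 10 q := by
  have h1 := partitionGF_mul_pentagonalSeries hq
  have h2 := rankBilateral_eq hq h0 (a := 10) (by norm_num)
  rw [rankGF_zero_eq hq]
  push_cast at h2
  rw [h2]
  linear_combination (10 - 22 * (rankLambert 1 q - rankLambert 11 q)) * h1

theorem rankGF_five_mul_pentagonalSeries {q : ℂ} (hq : ‖q‖ ≤ 1 / 3) (h0 : q ≠ 0) :
    (11 * rankGF 5 (q ^ 2) - partitionGF (q ^ 2)) * pentagonalSeries q =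
      - 11 * rankBilateral 4 q - 1 := by
  have h1 := partitionGF_mul_pentagonalSeries hq
  have h2 := rankBilateral_eq hq h0 (a := 4) (by norm_num)
  rw [rankGF_five_eq hq]
  push_cast at h2
  rw [h2]
  linear_combination (11 * (rankLambert 5 q - rankLambert 7 q) - 1) * h1

open Filter Topology

/-- The product `∏ (1 - x Q ^ n)` over `n ≥ 0`. -/
noncomputable def qPoch (Q x : ℂ) : ℂ := ∏' n : ℕ, (1 - x * Q ^ n)

/-- The theta function `∏ (1 - x Q ^ n) (1 - Q ^ (n + 1) / x)` over `n ≥ 0`. -/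
noncomputable def thetaQ (Q x : ℂ) : ℂ := qPoch Q x * qPoch Q (Q / x)

/-- The theta function with its zero at `1` removed. -/
noncomputable def thetaReg (Q x : ℂ) : ℂ := qPoch Q (Q * x) * qPoch Q (Q / x)

lemma summable_mul_geometric {Q : ℂ} (hQ : ‖Q‖ < 1) (x : ℂ) : Summable fun n : ℕ => x * Q ^ n :=
  (summable_geometric_of_norm_lt_one hQ).mul_left x

lemma multipliable_qPoch {Q : ℂ} (hQ : ‖Q‖ < 1) (x : ℂ) :
    Multipliable fun n : ℕ => 1 - x * Q ^ n := by
  simp_rw [sub_eq_add_neg]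
  exact multipliable_one_add_of_summable (summable_mul_geometric hQ x).neg.norm

lemma qPoch_eq {Q : ℂ} (hQ : ‖Q‖ < 1) (x : ℂ) : qPoch Q x = (1 - x) * qPoch Q (Q * x) := by
  have h : ∀ n : ℕ, 1 - x * Q ^ (n + 1) = 1 - Q * x * Q ^ n := fun n => by ring
  rw [qPoch, tprod_eq_zero_mul', qPoch]
  · simp_rw [h]; simp
  · simp_rw [h]; exact multipliable_qPoch hQ _

lemma qPoch_ne_zero {Q x : ℂ} (hQ : ‖Q‖ < 1) (h : ∀ n : ℕ, x * Q ^ n ≠ 1) : qPoch Q x ≠ 0 := by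
  rw [qPoch]
  simp_rw [sub_eq_add_neg]
  refine tprod_one_add_ne_zero_of_summable (fun n => ?_) (summable_mul_geometric hQ x).neg.norm
  rw [← sub_eq_add_neg]
  exact sub_ne_zero.2 (h n).symm

lemma differentiable_qPoch {Q : ℂ} (hQ : ‖Q‖ < 1) : Differentiable ℂ (qPoch Q) := by
  have key : ∀ R : ℝ, DifferentiableOn ℂ (qPoch Q) (Metric.ball 0 R) := by
    intro R
    have h := Summable.hasProdLocallyUniformlyOn_nat_one_add (f := fun (n : ℕ) (x : ℂ) => -(x *
        Q ^ n))
      (K := Metric.ball (0 : ℂ) R) (u := fun n => R * ‖Q‖ ^ n) Metric.isOpen_ball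
      ((summable_geometric_of_lt_one (norm_nonneg Q) hQ).mul_left R)
      (Eventually.of_forall fun n x hx => by
        rw [norm_neg, norm_mul, norm_pow]
        gcongr
        exact (mem_ball_zero_iff.1 hx).le) (fun n => by fun_prop)
    have h2 := h.differentiableOn (.of_forall fun _ ↦ by
      simpa [Finset.prod_fn] using DifferentiableOn.finsetProd (fun _ _ ↦ by fun_prop))
      Metric.isOpen_ball
    simpa only [← sub_eq_add_neg] using! h2
  intro x
  exact (key (‖x‖ + 1)).differentiableAt (Metric.isOpen_ball.mem_nhds (by simp))

lemma pow_ne_one_of_norm_lt {Q : ℂ} (hQ : ‖Q‖ < 1) {n : ℕ} (hn : n ≠ 0) : Q ^ n ≠ 1 := by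
  intro h
  have := norm_pow_lt_one hQ hn
  rw [h, norm_one] at this
  exact lt_irrefl _ this

lemma zpow_ne_one_of_norm_lt {Q : ℂ} (hQ : ‖Q‖ < 1) {n : ℤ} (hn : n ≠ 0) : Q ^ n ≠ 1 := by
  rcases lt_trichotomy n 0 with h | h | h
  · obtain ⟨m, hm⟩ := Int.eq_ofNat_of_zero_le (show 0 ≤ -n by omega)
    rw [show n = -(m : ℤ) by omega, zpow_neg, zpow_natCast, ne_eq, inv_eq_one]
    exact pow_ne_one_of_norm_lt hQ (by omega)
  · exact absurd h hn
  · obtain ⟨m, rfl⟩ := Int.eq_ofNat_of_zero_le h.le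
    rw [zpow_natCast]
    exact pow_ne_one_of_norm_lt hQ (by omega)

lemma qPoch_self_ne_zero {Q : ℂ} (hQ : ‖Q‖ < 1) : qPoch Q Q ≠ 0 :=
  qPoch_ne_zero hQ fun n => by
    rw [← pow_succ']; exact pow_ne_one_of_norm_lt hQ (by omega)

lemma thetaQ_eq {Q : ℂ} (hQ : ‖Q‖ < 1) (x : ℂ) : thetaQ Q x = (1 - x) * thetaReg Q x := by
  rw [thetaQ, thetaReg, qPoch_eq hQ x, mul_assoc]

lemma thetaReg_one (Q : ℂ) : thetaReg Q 1 = qPoch Q Q ^ 2 := by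
  rw [thetaReg, mul_one, div_one, sq]

lemma thetaQ_one {Q : ℂ} (hQ : ‖Q‖ < 1) : thetaQ Q 1 = 0 := by
  rw [thetaQ_eq hQ]; simp

lemma thetaQ_mul {Q x : ℂ} (hQ : ‖Q‖ < 1) (h0 : Q ≠ 0) (hx : x ≠ 0) :
    thetaQ Q (Q * x) = -thetaQ Q x / x := by
  have h : Q / (Q * x) = 1 / x := by field_simp
  rw [thetaQ, h, qPoch_eq hQ (1 / x), thetaQ, qPoch_eq hQ x, mul_one_div]
  field_simp
  ring

lemma thetaQ_inv {Q x : ℂ} (hQ : ‖Q‖ < 1) (hx : x ≠ 0) : thetaQ Q x⁻¹ = -thetaQ Q x / x := by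
  rw [thetaQ_eq hQ, thetaQ_eq hQ, thetaReg, thetaReg, div_inv_eq_mul, ← div_eq_mul_inv]
  field_simp
  ring

lemma thetaQ_div {Q x : ℂ} (h0 : Q ≠ 0) : thetaQ Q (Q / x) = thetaQ Q x := by
  rw [thetaQ, thetaQ, div_div_cancel₀ h0, mul_comm]

lemma thetaQ_ne_zero {Q x : ℂ} (hQ : ‖Q‖ < 1) (h0 : Q ≠ 0) (hx : x ≠ 0)
    (h : ∀ n : ℤ, x ≠ Q ^ n) : thetaQ Q x ≠ 0 := by
  refine mul_ne_zero (qPoch_ne_zero hQ fun n hn => ?_) (qPoch_ne_zero hQ fun n hn => ?_)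
  · exact h (-n) (by rw [zpow_neg, zpow_natCast]; exact eq_inv_of_mul_eq_one_left hn)
  · refine h (n + 1) ?_
    rw [zpow_add₀ h0, zpow_natCast, zpow_one]
    field_simp at hn
    rw [← hn]; ring

lemma thetaReg_one_ne_zero {Q : ℂ} (hQ : ‖Q‖ < 1) : thetaReg Q 1 ≠ 0 := by
  rw [thetaReg_one]; exact pow_ne_zero _ (qPoch_self_ne_zero hQ)

lemma differentiableAt_comp_const_div {f : ℂ → ℂ} (hf : Differentiable ℂ f) (c : ℂ) {x : ℂ} 
    (hx : x ≠ 0) : DifferentiableAt ℂ (fun x => f (c / x)) x :=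
  (hf _).comp x ((differentiableAt_const c).div differentiableAt_id hx)

lemma differentiableAt_thetaReg {Q x : ℂ} (hQ : ‖Q‖ < 1) (hx : x ≠ 0) :
    DifferentiableAt ℂ (thetaReg Q) x :=
  (((differentiable_qPoch hQ).comp (differentiable_id.const_mul Q)) x).mul
    (differentiableAt_comp_const_div (differentiable_qPoch hQ) Q hx)

lemma differentiableAt_thetaQ {Q x : ℂ} (hQ : ‖Q‖ < 1) (hx : x ≠ 0) :
    DifferentiableAt ℂ (thetaQ Q) x :=
  ((differentiable_qPoch hQ) x).mul
    (differentiableAt_comp_const_div (differentiable_qPoch hQ) Q hx)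

lemma analyticAt_of_differentiableAt_ne_zero {f : ℂ → ℂ}
    (hf : ∀ x ≠ 0, DifferentiableAt ℂ f x) {x : ℂ} (hx : x ≠ 0) : AnalyticAt ℂ f x :=
  (DifferentiableOn.analyticAt (s := {0}ᶜ) (fun y hy => (hf y hy).differentiableWithinAt)
    (isOpen_compl_singleton.mem_nhds hx))

lemma analyticAt_thetaQ {Q x : ℂ} (hQ : ‖Q‖ < 1) (hx : x ≠ 0) : AnalyticAt ℂ (thetaQ Q) x :=
  analyticAt_of_differentiableAt_ne_zero (fun _ h => differentiableAt_thetaQ hQ h) hx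

lemma analyticAt_thetaReg {Q x : ℂ} (hQ : ‖Q‖ < 1) (hx : x ≠ 0) : AnalyticAt ℂ (thetaReg Q) x :=
  analyticAt_of_differentiableAt_ne_zero (fun _ h => differentiableAt_thetaReg hQ h) hx

lemma thetaReg_inv (Q x : ℂ) : thetaReg Q x⁻¹ = thetaReg Q x := by
  rw [thetaReg, thetaReg, div_inv_eq_mul, ← div_eq_mul_inv, mul_comm]

lemma deriv_thetaReg_one {Q : ℂ} (hQ : ‖Q‖ < 1) : deriv (thetaReg Q) 1 = 0 := by
  have h1 := (differentiableAt_thetaReg hQ one_ne_zero).hasDerivAt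
  have h2 : HasDerivAt (fun x : ℂ => x⁻¹) (-(1 ^ 2)⁻¹) 1 := hasDerivAt_inv one_ne_zero
  have h3 : HasDerivAt (thetaReg Q) (deriv (thetaReg Q) 1) ((1 : ℂ)⁻¹) := by simpa using h1
  have h4 := h3.comp 1 h2
  have h5 : thetaReg Q ∘ (fun x : ℂ => x⁻¹) = thetaReg Q := funext fun x => thetaReg_inv Q x
  rw [h5] at h4
  have h6 := h1.unique h4
  norm_num at h6
  have h7 : (2 : ℂ) * deriv (thetaReg Q) 1 = 0 := by linear_combination h6
  simpa using h7

lemma thetaQ_eq_zero_iff {Q x : ℂ} (hQ : ‖Q‖ < 1) (h0 : Q ≠ 0) (hx : x ≠ 0) :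
    thetaQ Q x = 0 ↔ ∃ n : ℤ, x = Q ^ n := by
  constructor
  · intro h
    by_contra h'
    push Not at h'
    exact thetaQ_ne_zero hQ h0 hx h' h
  · rintro ⟨n, rfl⟩
    have hstep : ∀ y : ℂ, y ≠ 0 → (thetaQ Q (Q * y) = 0 ↔ thetaQ Q y = 0) := by
      intro y hy
      rw [thetaQ_mul hQ h0 hy]
      simp [hy]
    induction n using Int.induction_on with
    | zero => simpa using thetaQ_one hQ
    | succ i ih =>
      rw [zpow_add₀ h0, zpow_one, mul_comm]
      exact (hstep _ (zpow_ne_zero _ h0)).2 (ih (zpow_ne_zero _ h0))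
    | pred i ih =>
      rw [← hstep _ (zpow_ne_zero _ h0)]
      have : Q * Q ^ (-(i : ℤ) - 1) = Q ^ (-(i : ℤ)) := by
        rw [zpow_sub₀ h0, zpow_one]; field_simp
      rw [this]
      exact ih (zpow_ne_zero _ h0)

/-- Duplication for the base: even and odd powers of `κ`. -/
lemma qPoch_sq_base {κ : ℂ} (hκ : ‖κ‖ < 1) (x : ℂ) :
    qPoch κ x = qPoch (κ ^ 2) x * qPoch (κ ^ 2) (κ * x) := by
  have h2 : ‖κ ^ 2‖ < 1 := norm_pow_lt_one hκ two_ne_zero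
  have e1 : ∀ k : ℕ, 1 - x * κ ^ (2 * k) = 1 - x * (κ ^ 2) ^ k := fun k => by rw [pow_mul]
  have e2 : ∀ k : ℕ, 1 - x * κ ^ (2 * k + 1) = 1 - κ * x * (κ ^ 2) ^ k := fun k => by
    rw [pow_succ, pow_mul]; ring
  rw [qPoch, ← tprod_even_mul_odd]
  · simp_rw [e1, e2]; rfl
  · simp_rw [e1]; exact multipliable_qPoch h2 _
  · simp_rw [e2]; exact multipliable_qPoch h2 _

lemma qPoch_mul_neg {κ : ℂ} (hκ : ‖κ‖ < 1) (x : ℂ) :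
    qPoch κ x * qPoch κ (-x) = qPoch (κ ^ 2) (x ^ 2) := by
  rw [qPoch, qPoch, ← (multipliable_qPoch hκ _).tprod_mul (multipliable_qPoch hκ _), qPoch]
  refine tprod_congr fun n => ?_
  rw [← pow_mul, mul_comm 2 n, pow_mul]
  ring

/-- Duplication formula: the half-period product of theta functions. -/
lemma thetaQ_duplication {κ z : ℂ} (hκ : ‖κ‖ < 1) (h0 : κ ≠ 0) (hz : z ≠ 0) :
    thetaQ (κ ^ 2) z * thetaQ (κ ^ 2) (-z) * thetaQ (κ ^ 2) (κ * z) * thetaQ (κ ^ 2) (-(κ * z)) =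
      thetaQ (κ ^ 2) (z ^ 2) := by
  have e1 : κ ^ 2 / (κ * z) = κ / z := by field_simp
  have e2 : κ ^ 2 / (-(κ * z)) = -(κ / z) := by rw [div_neg, e1]
  have e3 : κ ^ 2 / z = κ * (κ / z) := by ring
  have e4 : κ ^ 2 / -z = κ * -(κ / z) := by ring
  have h1 := qPoch_sq_base hκ z
  have h2 := qPoch_sq_base hκ (-z)
  have h3 := qPoch_sq_base hκ (κ / z)
  have h4 := qPoch_sq_base hκ (-(κ / z))
  have h5 := qPoch_mul_neg hκ z
  have h6 := qPoch_mul_neg hκ (κ / z)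
  rw [div_pow] at h6
  simp only [thetaQ]
  rw [e1, e2, e3, e4, ← h5, ← h6, h1, h2, h3, h4, mul_neg κ z]
  ring

/-- `F` agrees with an analytic function on a punctured neighbourhood of `z`. -/
def RemovableAt (F : ℂ → ℂ) (z : ℂ) : Prop := ∃ g : ℂ → ℂ, AnalyticAt ℂ g z ∧ F =ᶠ[𝓝[≠] z] g

lemma AnalyticAt.removableAt {F : ℂ → ℂ} {z : ℂ} (h : AnalyticAt ℂ F z) : RemovableAt F z :=
  ⟨F, h, EventuallyEq.rfl⟩

lemma RemovableAt.add {F G : ℂ → ℂ} {z : ℂ} (hF : RemovableAt F z) (hG : RemovableAt G z) :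
    RemovableAt (fun w => F w + G w) z := by
  obtain ⟨f, hf, hf'⟩ := hF
  obtain ⟨g, hg, hg'⟩ := hG
  exact ⟨fun w => f w + g w, hf.add hg, hf'.add hg'⟩

lemma RemovableAt.mul {F G : ℂ → ℂ} {z : ℂ} (hF : RemovableAt F z) (hG : RemovableAt G z) :
    RemovableAt (fun w => F w * G w) z := by
  obtain ⟨f, hf, hf'⟩ := hF
  obtain ⟨g, hg, hg'⟩ := hG
  exact ⟨fun w => f w * g w, hf.mul hg, hf'.mul hg'⟩

lemma RemovableAt.const_mul {F : ℂ → ℂ} {z : ℂ} (hF : RemovableAt F z) (c : ℂ) :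
    RemovableAt (fun w => c * F w) z :=
  RemovableAt.mul analyticAt_const.removableAt hF

lemma tendsto_mul_const_nhdsNE {a : ℂ} (ha : a ≠ 0) (z : ℂ) :
    Tendsto (fun w => w * a) (𝓝[≠] z) (𝓝[≠] (z * a)) := by
  refine tendsto_nhdsWithin_of_tendsto_nhds_of_eventually_within _ ?_ ?_
  · exact (continuous_id.mul continuous_const).continuousAt.mono_left nhdsWithin_le_nhds
  · filter_upwards [self_mem_nhdsWithin] with w hw
    simpa [ha] using hw

lemma RemovableAt.comp_mul_const {F : ℂ → ℂ} {z a : ℂ} (ha : a ≠ 0)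
    (hF : RemovableAt F (z * a)) : RemovableAt (fun w => F (w * a)) z := by
  obtain ⟨f, hf, hf'⟩ := hF
  refine ⟨fun w => f (w * a), ?_, (tendsto_mul_const_nhdsNE ha z).eventually hf'⟩
  exact AnalyticAt.fun_comp hf (analyticAt_id.mul analyticAt_const)

lemma RemovableAt.congr {F G : ℂ → ℂ} {z : ℂ} (hF : RemovableAt F z) (h : F =ᶠ[𝓝[≠] z] G) :
    RemovableAt G z := by
  obtain ⟨f, hf, hfz⟩ := hF
  exact ⟨f, hf, h.symm.trans hfz⟩

/-- An analytic function that vanishes at a point is divisible by the corresponding linear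
factor. -/
lemma removableAt_div_of_zero {f : ℂ → ℂ} {z : ℂ} (hf : AnalyticAt ℂ f z) (h0 : f z = 0) :
    RemovableAt (fun w => f w / (w - z)) z := by
  obtain ⟨p, hp⟩ := hf
  refine ⟨dslope f z, ⟨_, hp.has_fpower_series_dslope_fslope⟩, ?_⟩
  filter_upwards [self_mem_nhdsWithin] with w hw
  rw [dslope_of_ne _ hw, slope_def_field, h0, sub_zero]

lemma exists_norm_zpow_mul_mem {Q : ℂ} (hQ : ‖Q‖ < 1) (h0 : Q ≠ 0) {z : ℂ} (hz : z ≠ 0) :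
    ∃ n : ℤ, ‖Q‖ ≤ ‖Q ^ n * z‖ ∧ ‖Q ^ n * z‖ ≤ 1 := by
  have hQ0 : 0 < ‖Q‖ := norm_pos_iff.2 h0
  obtain ⟨n, hn1, hn2⟩ := exists_mem_Ioc_zpow (norm_pos_iff.2 hz) (one_lt_inv₀ hQ0 |>.2 hQ)
  refine ⟨n + 1, ?_, ?_⟩
  · rw [norm_mul, norm_zpow, zpow_add₀ hQ0.ne', zpow_one]
    rw [inv_zpow] at hn1
    have hp := zpow_pos hQ0 n
    have := mul_lt_mul_of_pos_left hn1 hp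
    rw [mul_inv_cancel₀ hp.ne'] at this
    nlinarith
  · rw [norm_mul, norm_zpow]
    rw [inv_zpow] at hn2
    have hp := zpow_pos hQ0 (n + 1)
    have := mul_le_mul_of_nonneg_left hn2 hp.le
    rwa [mul_inv_cancel₀ hp.ne'] at this

lemma periodic_zpow {F : ℂ → ℂ} {Q : ℂ} (h0 : Q ≠ 0) (hF : ∀ z ≠ 0, F (Q * z) = F z) (n : ℤ)
    {z : ℂ} (hz : z ≠ 0) : F (Q ^ n * z) = F z := by
  induction n using Int.induction_on with
  | zero => simp
  | succ i ih =>
    rw [zpow_add₀ h0, zpow_one, mul_comm _ Q, mul_assoc, hF _ (mul_ne_zero (zpow_ne_zero _ h0) hz),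
      ih]
  | pred i ih =>
    rw [← hF _ (mul_ne_zero (zpow_ne_zero _ h0) hz), ← mul_assoc, ← ih]
    congr 2
    rw [zpow_sub₀ h0, zpow_one]
    field_simp

/-- A multiplicatively periodic analytic function on `ℂ \ {0}` is constant. -/
lemma eq_const_of_periodic {G : ℂ → ℂ} {Q : ℂ} (hQ : ‖Q‖ < 1) (h0 : Q ≠ 0)
    (hG : ∀ z ≠ 0, AnalyticAt ℂ G z) (hp : ∀ z ≠ 0, G (Q * z) = G z) :
    ∀ z ≠ 0, G z = G 1 := by
  have hQ0 : 0 < ‖Q‖ := norm_pos_iff.2 h0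
  have hc : IsCompact (Metric.closedBall (0 : ℂ) 1 \ Metric.ball 0 ‖Q‖) :=
    (isCompact_closedBall _ _).diff Metric.isOpen_ball
  have hcont : ContinuousOn G (Metric.closedBall (0 : ℂ) 1 \ Metric.ball 0 ‖Q‖) := by
    intro z hz
    refine (hG z ?_).continuousAt.continuousWithinAt
    rintro rfl
    exact hz.2 (by simpa using h0)
  obtain ⟨B, hB⟩ := hc.exists_bound_of_continuousOn hcont
  have hbd : ∀ z ≠ 0, ‖G z‖ ≤ B := by
    intro z hz
    obtain ⟨n, h1, h2⟩ := exists_norm_zpow_mul_mem hQ h0 hz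
    rw [← periodic_zpow h0 hp n hz]
    exact hB _ ⟨by simpa using h2, by simpa using h1⟩
  have hH : Differentiable ℂ (fun w => G (Complex.exp w)) := fun w =>
    (hG _ (Complex.exp_ne_zero w)).differentiableAt.comp w Complex.differentiableAt_exp
  intro z hz
  have hb : Bornology.IsBounded (Set.range fun w => G (Complex.exp w)) := by
    refine isBounded_iff_forall_norm_le.2 ⟨B, ?_⟩
    rintro _ ⟨w, rfl⟩
    exact hbd _ (Complex.exp_ne_zero w)
  have := hH.apply_eq_apply_of_bounded hb (Complex.log z) 0
  simpa [Complex.exp_log hz] using this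

/-- A multiplicatively periodic function with removable singularities on `ℂ \ {0}` is constant
away from them. -/
theorem exists_const_of_periodic_removable {F : ℂ → ℂ} {Q : ℂ} (hQ : ‖Q‖ < 1) (h0 : Q ≠ 0)
    (hF : ∀ z ≠ 0, RemovableAt F z) (hp : ∀ z ≠ 0, F (Q * z) = F z) :
    ∃ C, ∀ z ≠ 0, F =ᶠ[𝓝[≠] z] fun _ => C := by
  choose! g hg hFg using hF
  let G : ℂ → ℂ := fun z => g z z
  have key : ∀ z (hz : z ≠ 0) (f : ℂ → ℂ), ContinuousAt f z → F =ᶠ[𝓝[≠] z] f → G z = f z := by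
    intro z hz f hf hFf
    have h1 : Tendsto f (𝓝[≠] z) (𝓝 (f z)) := hf.mono_left nhdsWithin_le_nhds
    have h2 : Tendsto (g z) (𝓝[≠] z) (𝓝 (g z z)) :=
      (hg z hz).continuousAt.mono_left nhdsWithin_le_nhds
    exact tendsto_nhds_unique h2 (h1.congr' (hFf.symm.trans (hFg z hz)))
  have hGg : ∀ z ≠ 0, G =ᶠ[𝓝 z] g z := by
    intro z hz
    have h1 : ∀ᶠ w in 𝓝[≠] z, F =ᶠ[𝓝 w] g z := eventually_nhdsNE_eventually_nhds_iff.2 (hFg z hz)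
    have h2 : ∀ᶠ w in 𝓝[≠] z, AnalyticAt ℂ (g z) w :=
      nhdsWithin_le_nhds (hg z hz).eventually_analyticAt
    have h3 : ∀ᶠ w in 𝓝[≠] z, w ≠ 0 := nhdsWithin_le_nhds (isOpen_ne.mem_nhds hz)
    have h4 : ∀ᶠ w in 𝓝[≠] z, G w = g z w := by
      filter_upwards [h1, h2, h3] with w hw1 hw2 hw3
      exact key w hw3 _ hw2.continuousAt (hw1.filter_mono nhdsWithin_le_nhds)
    filter_upwards [eventually_nhdsWithin_iff.1 h4] with w hw
    by_cases hwz : w = z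
    · rw [hwz]
    · exact hw hwz
  have hGa : ∀ z ≠ 0, AnalyticAt ℂ G z := fun z hz => (hg z hz).congr (hGg z hz).symm
  have hGp : ∀ z ≠ 0, G (Q * z) = G z := by
    intro z hz
    have hQz := mul_ne_zero h0 hz
    symm
    refine key z hz (fun w => g (Q * z) (Q * w)) ?_ ?_
    · exact ContinuousAt.comp (f := fun w => Q * w) (hg _ hQz).continuousAt
        (continuous_const.mul continuous_id).continuousAt
    · have ht := tendsto_mul_const_nhdsNE h0 z
      rw [mul_comm z Q] at ht
      have h1 := ht.eventually (hFg _ hQz)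
      have h2 : ∀ᶠ w in 𝓝[≠] z, w ≠ 0 := nhdsWithin_le_nhds (isOpen_ne.mem_nhds hz)
      filter_upwards [h1, h2] with w hw hw0
      rw [← hp w hw0, mul_comm Q w, hw]
  refine ⟨G 1, fun z hz => ?_⟩
  have h1 : ∀ᶠ w in 𝓝[≠] z, G w = g z w := nhdsWithin_le_nhds (hGg z hz)
  have h2 : ∀ᶠ w in 𝓝[≠] z, w ≠ 0 := nhdsWithin_le_nhds (isOpen_ne.mem_nhds hz)
  filter_upwards [hFg z hz, h1, h2] with w hw1 hw2 hw3
  rw [hw1, ← hw2, eq_const_of_periodic hQ h0 hGa hGp w hw3]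

/-- The integral powers of `Q` other than `z` stay away from `z`. -/
lemma exists_zpow_sep {Q z : ℂ} (hQ : ‖Q‖ < 1) (h0 : Q ≠ 0) (hz : z ≠ 0) :
    ∃ δ > 0, ∀ n : ℤ, Q ^ (-n) = z ∨ 2 * δ ≤ ‖Q ^ (-n) - z‖ := by
  have hQ0 : 0 < ‖Q‖ := norm_pos_iff.2 h0
  have hr : 0 < ‖z‖ := norm_pos_iff.2 hz
  obtain ⟨N, hN⟩ := exists_pow_lt_of_lt_one (lt_min (half_pos hr) (inv_pos.2
      (mul_pos two_pos hr))) hQ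
  obtain ⟨hN1, hN2⟩ := lt_min_iff.1 hN
  have hfin : (((fun n : ℤ => Q ^ (-n)) '' Set.Ioo (-(N : ℤ)) N) \ {z}).Finite :=
    ((Set.finite_Ioo _ _).image _).sdiff
  obtain ⟨ε, hε, hball⟩ := Metric.isOpen_iff.1 hfin.isClosed.isOpen_compl z (fun h => h.2 rfl)
  refine ⟨min (ε / 2) (‖z‖ / 4), lt_min (half_pos hε) (by positivity), fun n => ?_⟩
  have hm1 : min (ε / 2) (‖z‖ / 4) ≤ ε / 2 := min_le_left _ _
  have hm2 : min (ε / 2) (‖z‖ / 4) ≤ ‖z‖ / 4 := min_le_right _ _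
  rcases le_or_gt (N : ℤ) n with hn | hn
  · right
    have h1 : (‖Q‖ ^ N)⁻¹ ≤ ‖Q ^ (-n)‖ := by
      rw [norm_zpow, zpow_neg, ← zpow_natCast]
      exact inv_anti₀ (zpow_pos hQ0 _) (zpow_le_zpow_right_of_le_one₀ hQ0 hQ.le hn)
    have h2 : 2 * ‖z‖ < (‖Q‖ ^ N)⁻¹ := (lt_inv_comm₀ (by positivity) (by positivity)).2 hN2
    have := norm_sub_norm_le (Q ^ (-n)) z
    linarith
  rcases le_or_gt n (-(N : ℤ)) with hn' | hn'
  · right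
    have h1 : ‖Q ^ (-n)‖ ≤ ‖Q‖ ^ N := by
      rw [norm_zpow, ← zpow_natCast]
      exact zpow_le_zpow_right_of_le_one₀ hQ0 hQ.le (by lia)
    have := norm_sub_norm_le z (Q ^ (-n))
    rw [norm_sub_rev] at this
    linarith
  · by_cases h : Q ^ (-n) = z
    · exact Or.inl h
    · right
      by_contra! hlt
      exact hball (show Q ^ (-n) ∈ Metric.ball z ε by rw [Metric.mem_ball, dist_eq_norm]; linarith)
        ⟨⟨n, ⟨hn', hn⟩, rfl⟩, h⟩

/-- A generalized Lambert series is locally uniformly summable away from its poles. -/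
lemma lambert_analyticAt {Q z : ℂ} (hQ : ‖Q‖ < 1) (h0 : Q ≠ 0) (hz : z ≠ 0) {c : ℤ → ℂ}
    (hc : Summable fun n => ‖c n * Q ^ (-n)‖) (hp : ∀ n, Q ^ (-n) = z → c n = 0) :
    AnalyticAt ℂ (fun u => ∑' n, c n / (1 - u * Q ^ n)) z ∧
      ∀ᶠ u in 𝓝 z, Summable fun n => c n / (1 - u * Q ^ n) := by
  obtain ⟨δ, hδ, hs⟩ := exists_zpow_sep hQ h0 hz
  have hb : ∀ n, ∀ u ∈ Metric.ball z δ, ‖c n / (1 - u * Q ^ n)‖ ≤ ‖c n * Q ^ (-n)‖ * δ⁻¹ := by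
    intro n u hu
    rcases hs n with h | h
    · rw [hp n h]; simp
    have h1 : c n / (1 - u * Q ^ n) = c n * Q ^ (-n) / (Q ^ (-n) - u) := by
      have h2 : Q ^ n ≠ 0 := zpow_ne_zero _ h0
      have h3 : Q ^ (-n) - u = Q ^ (-n) * (1 - u * Q ^ n) := by
        rw [zpow_neg]; field_simp
      rw [h3, mul_comm (c n), mul_div_mul_left _ _ (zpow_ne_zero _ h0)]
    have h4 : δ ≤ ‖Q ^ (-n) - u‖ := by
      have := norm_sub_le_norm_sub_add_norm_sub (Q ^ (-n)) u z
      rw [Metric.mem_ball, dist_eq_norm] at hu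
      linarith
    rw [h1, norm_div, div_eq_mul_inv]
    exact mul_le_mul_of_nonneg_left (inv_anti₀ hδ h4) (norm_nonneg _)
  have hsum := hc.mul_right δ⁻¹
  have hdiff : ∀ n, ∀ u ∈ Metric.ball z δ, DifferentiableAt ℂ (fun u => c n / (1 - u * Q ^ n)) u :=
      by
    intro n u hu
    by_cases hcn : c n = 0
    · simp [hcn]
    have hne : 1 - u * Q ^ n ≠ 0 := by
      intro h
      have h5 : Q ^ (-n) = u := by
        rw [zpow_neg]; exact (eq_inv_of_mul_eq_one_left (sub_eq_zero.1 h).symm).symm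
      rcases hs n with h' | h'
      · exact hcn (hp n h')
      · rw [h5] at h'
        rw [Metric.mem_ball, dist_eq_norm] at hu
        linarith
    fun_prop (disch := exact hne)
  refine ⟨?_, ?_⟩
  · refine DifferentiableOn.analyticAt (s := Metric.ball z δ) ?_ (Metric.ball_mem_nhds z hδ)
    exact Complex.differentiableOn_tsum_of_summable_norm hsum
      (fun n u hu => (hdiff n u hu).differentiableWithinAt) Metric.isOpen_ball hb
  · filter_upwards [Metric.ball_mem_nhds z hδ] with u hu
    exact Summable.of_norm_bounded hsum fun n => hb n u hu

/-- The Gaussian sum `∑ (-w)ⁿ κ^(3n²)`. -/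
noncomputable def gaussSum3 (κ w : ℂ) : ℂ := ∑' n : ℤ, (-w) ^ n * κ ^ (3 * n ^ 2)

lemma summable_nat_gauss {r x : ℝ} (hr : r < 1) (h0 : 0 < r) (hx : 0 < x) :
    Summable fun n : ℕ => x ^ n * r ^ (3 * n ^ 2) := by
  refine summable_of_ratio_test_tendsto_lt_one (l := 0) one_pos
    (Eventually.of_forall fun n => by positivity) ?_
  have h1 : ∀ n : ℕ, ‖x ^ (n + 1) * r ^ (3 * (n + 1) ^ 2)‖ / ‖x ^ n * r ^ (3 * n ^ 2)‖
      = (x * r ^ 3) * (r ^ 6) ^ n := by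
    intro n
    rw [Real.norm_of_nonneg (by positivity), Real.norm_of_nonneg (by positivity)]
    rw [div_eq_iff (by positivity)]
    ring
  simp_rw [h1]
  simpa using (tendsto_pow_atTop_nhds_zero_of_lt_one (by positivity)
    (pow_lt_one₀ h0.le hr (by norm_num : 6 ≠ 0))).const_mul (x * r ^ 3)

lemma summable_norm_gauss {κ w : ℂ} (hκ : ‖κ‖ < 1) (h0 : κ ≠ 0) (hw : w ≠ 0) :
    Summable fun n : ℤ => ‖w ^ n * κ ^ (3 * n ^ 2)‖ := by
  have hκ0 : 0 < ‖κ‖ := norm_pos_iff.2 h0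
  have hw0 : 0 < ‖w‖ := norm_pos_iff.2 hw
  refine Summable.of_nat_of_neg ?_ ?_
  · refine (summable_nat_gauss hκ hκ0 hw0).congr fun n => ?_
    rw [norm_mul, norm_zpow, norm_zpow]
    norm_cast
  · refine (summable_nat_gauss hκ hκ0 (inv_pos.2 hw0)).congr fun n => ?_
    rw [norm_mul, norm_zpow, norm_zpow, neg_sq, zpow_neg, inv_pow]
    norm_cast

lemma summable_norm_gauss_linear {κ w : ℂ} (hκ : ‖κ‖ < 1) (h0 : κ ≠ 0) (hw : w ≠ 0) (b : ℤ) :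
    Summable fun n : ℤ => ‖(-w) ^ n * κ ^ (3 * n ^ 2 + b * n)‖ := by
  refine (summable_norm_gauss hκ h0 (mul_ne_zero (neg_ne_zero.2 hw) (zpow_ne_zero b h0))).congr
    fun n => ?_
  rw [mul_zpow, ← zpow_mul, zpow_add₀ h0]
  ring_nf

lemma gaussSum3_eq {κ : ℂ} (h0 : κ ≠ 0) (w : ℂ) (b : ℤ) :
    gaussSum3 κ (w * κ ^ b) = ∑' n : ℤ, (-w) ^ n * κ ^ (3 * n ^ 2 + b * n) := by
  refine tsum_congr fun n => ?_
  rw [← neg_mul, mul_zpow, ← zpow_mul, zpow_add₀ h0]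
  ring_nf

lemma gaussSum3_inv {κ : ℂ} (w : ℂ) : gaussSum3 κ w⁻¹ = gaussSum3 κ w := by
  unfold gaussSum3
  rw [← (Equiv.neg ℤ).tsum_eq]
  refine tsum_congr fun n => ?_
  simp only [Equiv.neg_apply, neg_sq]
  rw [← inv_neg, inv_zpow, zpow_neg, inv_inv]

lemma gaussSum3_mul {κ w : ℂ} (h0 : κ ≠ 0) (hw : w ≠ 0) :
    gaussSum3 κ (w * κ ^ (3 : ℤ)) = -w⁻¹ * gaussSum3 κ (w * κ ^ (-3 : ℤ)) := by
  rw [gaussSum3_eq h0, gaussSum3_eq h0, ← tsum_mul_left, ← (Equiv.subRight (1 : ℤ)).tsum_eq]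
  refine tsum_congr fun n => ?_
  simp only [Equiv.subRight_apply]
  rw [zpow_sub₀ (neg_ne_zero.2 hw), zpow_one,
    show 3 * (n - 1) ^ 2 + 3 * (n - 1) = 3 * n ^ 2 + -3 * n by ring]
  field_simp

/-- The Appell-Lerch type sum of level three. -/
noncomputable def appell (κ z w : ℂ) : ℂ :=
  ∑' n : ℤ, (-w) ^ n * κ ^ (3 * n ^ 2 + 3 * n) / (1 - z * (κ ^ 2) ^ n)

lemma summable_appell_coeff {κ w : ℂ} (hκ : ‖κ‖ < 1) (h0 : κ ≠ 0) (hw : w ≠ 0) :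
    Summable fun n : ℤ => ‖(-w) ^ n * κ ^ (3 * n ^ 2 + 3 * n) * (κ ^ 2) ^ (-n)‖ := by
  refine (summable_norm_gauss_linear hκ h0 hw 1).congr fun n => ?_
  rw [mul_assoc, ← zpow_natCast κ 2, ← zpow_mul, ← zpow_add₀ h0]
  congr 3
  push_cast
  ring

lemma norm_sq_lt_one {κ : ℂ} (hκ : ‖κ‖ < 1) : ‖κ ^ 2‖ < 1 := by
  rw [norm_pow]; exact pow_lt_one₀ (norm_nonneg _) hκ two_ne_zero

lemma analyticAt_appell {κ z w : ℂ} (hκ : ‖κ‖ < 1) (h0 : κ ≠ 0) (hw : w ≠ 0) (hz : z ≠ 0)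
    (hp : ∀ n : ℤ, z ≠ (κ ^ 2) ^ n) : AnalyticAt ℂ (fun u => appell κ u w) z :=
  (lambert_analyticAt (norm_sq_lt_one hκ) (pow_ne_zero 2 h0) hz (summable_appell_coeff hκ h0 hw)
    fun n hn => absurd hn.symm (hp (-n))).1

lemma summable_appell {κ z w : ℂ} (hκ : ‖κ‖ < 1) (h0 : κ ≠ 0) (hw : w ≠ 0) (hz : z ≠ 0)
    (hp : ∀ n : ℤ, z ≠ (κ ^ 2) ^ n) :
    Summable fun n : ℤ => (-w) ^ n * κ ^ (3 * n ^ 2 + 3 * n) / (1 - z * (κ ^ 2) ^ n) :=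
  (lambert_analyticAt (norm_sq_lt_one hκ) (pow_ne_zero 2 h0) hz (summable_appell_coeff hκ h0 hw)
    fun n hn => absurd hn.symm (hp (-n))).2.self_of_nhds

/-- Near a pole, the Appell sum is a simple pole plus an analytic function. -/
lemma appell_near_pole {κ w : ℂ} (hκ : ‖κ‖ < 1) (h0 : κ ≠ 0) (hw : w ≠ 0) (m : ℤ) :
    ∃ g : ℂ → ℂ, AnalyticAt ℂ g ((κ ^ 2) ^ (-m)) ∧ ∀ᶠ u in 𝓝[≠] ((κ ^ 2) ^ (-m)),
      appell κ u w = (-w) ^ m * κ ^ (3 * m ^ 2 + 3 * m) / (1 - u * (κ ^ 2) ^ m) + g u := by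
  have hQ := norm_sq_lt_one hκ
  have hQ0 := pow_ne_zero 2 h0
  set c : ℤ → ℂ := fun n => (-w) ^ n * κ ^ (3 * n ^ 2 + 3 * n) with hc
  have hsum : Summable fun n => ‖(if n = m then 0 else c n) * (κ ^ 2) ^ (-n)‖ := by
    refine Summable.of_nonneg_of_le (fun _ => norm_nonneg _) (fun n => ?_)
      (summable_appell_coeff hκ h0 hw)
    split_ifs
    · rw [zero_mul, norm_zero]; exact norm_nonneg _
    · exact le_rfl
  have hL := lambert_analyticAt (z := (κ ^ 2) ^ (-m)) hQ hQ0 (zpow_ne_zero _ hQ0) hsum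
    (fun n hn => by
      have : n = m := by
        by_contra hne
        refine zpow_ne_one_of_norm_lt hQ (n := m - n) (by lia) ?_
        rw [show m - n = -n - -m by ring, zpow_sub₀ hQ0, hn, div_self (zpow_ne_zero _ hQ0)]
      simp [this])
  refine ⟨_, hL.1, nhdsWithin_le_nhds ?_⟩
  filter_upwards [hL.2] with u hu
  have he : ∀ n, (if n = m then 0 else c n) / (1 - u * (κ ^ 2) ^ n)
      = if n = m then 0 else c n / (1 - u * (κ ^ 2) ^ n) := by
    intro n; split_ifs <;> simp
  simp_rw [he] at hu ⊢
  have hu' : Summable fun n => c n / (1 - u * (κ ^ 2) ^ n) := by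
    refine (summable_congr_cofinite ?_).1 hu
    filter_upwards [(Set.finite_singleton m).compl_mem_cofinite] with n hn
    rw [if_neg (by simpa using hn)]
  exact hu'.tsum_eq_add_tsum_ite m

lemma removableAt_appell_mul {κ w z : ℂ} (hκ : ‖κ‖ < 1) (h0 : κ ≠ 0) (hw : w ≠ 0) (hz : z ≠ 0) :
    RemovableAt (fun u => appell κ u w * thetaQ (κ ^ 2) u) z := by
  have hQ := norm_sq_lt_one hκ
  have hQ0 := pow_ne_zero 2 h0
  have hθ := analyticAt_thetaQ hQ hz
  by_cases hp : ∀ n : ℤ, z ≠ (κ ^ 2) ^ n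
  · exact ((analyticAt_appell hκ h0 hw hz hp).mul hθ).removableAt
  push Not at hp
  obtain ⟨n, rfl⟩ := hp
  obtain ⟨g, hg, hg'⟩ := appell_near_pole hκ h0 hw (-n)
  rw [neg_neg] at hg hg'
  have hθ0 : thetaQ (κ ^ 2) ((κ ^ 2) ^ n) = 0 :=
    (thetaQ_eq_zero_iff hQ hQ0 hz).2 ⟨n, rfl⟩
  have h1 := (removableAt_div_of_zero hθ hθ0).const_mul
    (-((-w) ^ (-n) * κ ^ (3 * (-n) ^ 2 + 3 * (-n))) * (κ ^ 2) ^ n)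
  refine (h1.add (hg.mul hθ).removableAt).congr ?_
  filter_upwards [hg', self_mem_nhdsWithin] with u hu hne
  rw [hu, add_mul]
  congr 1
  have h2 : u - (κ ^ 2) ^ n ≠ 0 := sub_ne_zero.2 hne
  have h3 : 1 - u * (κ ^ 2) ^ (-n) = -((u - (κ ^ 2) ^ n) * (κ ^ 2) ^ (-n)) := by
    have : (κ ^ 2) ^ n * (κ ^ 2) ^ (-n) = 1 := by rw [← zpow_add₀ hQ0]; simp
    linear_combination -this
  have h4 : (κ ^ 2) ^ (-n) = ((κ ^ 2) ^ n)⁻¹ := zpow_neg _ _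
  have h5 := zpow_ne_zero n hQ0
  rw [h3, h4]
  generalize (κ ^ 2) ^ n = X at *
  field_simp

lemma tendsto_appell_mul_one {κ w : ℂ} (hκ : ‖κ‖ < 1) (h0 : κ ≠ 0) (hw : w ≠ 0) :
    Tendsto (fun u => appell κ u w * thetaQ (κ ^ 2) u) (𝓝[≠] 1) (𝓝 (qPoch (κ ^ 2) (κ ^ 2) ^ 2)) :=
        by
  have hQ := norm_sq_lt_one hκ
  obtain ⟨g, hg, hg'⟩ := appell_near_pole hκ h0 hw 0
  rw [neg_zero, zpow_zero] at hg hg'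
  have h1 : AnalyticAt ℂ (fun u => thetaReg (κ ^ 2) u + g u * thetaQ (κ ^ 2) u) 1 :=
    (analyticAt_thetaReg hQ one_ne_zero).add (hg.mul (analyticAt_thetaQ hQ one_ne_zero))
  have h2 := h1.continuousAt.tendsto
  simp only [thetaReg_one, thetaQ_one hQ, mul_zero, add_zero] at h2
  refine (h2.mono_left nhdsWithin_le_nhds).congr' ?_
  filter_upwards [hg', self_mem_nhdsWithin] with u hu hne
  have h3 : 1 - u ≠ 0 := sub_ne_zero.2 (Ne.symm hne)
  rw [hu, thetaQ_eq hQ]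
  simp only [zpow_zero, mul_one]
  norm_num
  field_simp

lemma appell_shift {κ z w : ℂ} (hκ : ‖κ‖ < 1) (h0 : κ ≠ 0) (hw : w ≠ 0) (hz : z ≠ 0)
    (hp : ∀ n : ℤ, z ≠ (κ ^ 2) ^ n) :
    appell κ (κ ^ 2 * z) w = -w⁻¹ * (z ^ 3 * appell κ z w + z ^ 2 * gaussSum3 κ (w * κ ^ (1 : ℤ))
      + z * gaussSum3 κ (w * κ ^ (-1 : ℤ)) + gaussSum3 κ (w * κ ^ (-3 : ℤ))) := by
  have hs := fun b => (summable_norm_gauss_linear hκ h0 hw b).of_norm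
  have hQ0 := pow_ne_zero 2 h0
  rw [gaussSum3_eq h0, gaussSum3_eq h0, gaussSum3_eq h0]
  unfold appell
  rw [← tsum_mul_left, ← tsum_mul_left, ← tsum_mul_left,
    ← ((summable_appell hκ h0 hw hz hp).mul_left _).tsum_add ((hs 1).mul_left _),
    ← (((summable_appell hκ h0 hw hz hp).mul_left _).add ((hs 1).mul_left _)).tsum_add
      ((hs (-1)).mul_left _),
    ← ((((summable_appell hκ h0 hw hz hp).mul_left _).add ((hs 1).mul_left _)).add
      ((hs (-1)).mul_left _)).tsum_add (hs (-3)), ← tsum_mul_left,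
    ← (Equiv.subRight (1 : ℤ)).tsum_eq]
  refine tsum_congr fun n => ?_
  simp only [Equiv.subRight_apply]
  have hne : 1 - z * (κ ^ 2) ^ n ≠ 0 := by
    intro h
    apply hp (-n)
    rw [zpow_neg]
    exact eq_inv_of_mul_eq_one_left (sub_eq_zero.1 h).symm
  have e1 : κ ^ 2 * z * (κ ^ 2) ^ (n - 1) = z * (κ ^ 2) ^ n := by
    rw [zpow_sub₀ hQ0, zpow_one]; field_simp
  have e2 : 3 * (n - 1) ^ 2 + 3 * (n - 1) = 3 * n ^ 2 + -3 * n := by ring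
  have hX : (κ ^ 2) ^ n = κ ^ (2 * n) := by
    rw [← zpow_natCast κ 2, ← zpow_mul]; norm_cast
  have e3 : κ ^ (3 * n ^ 2 + 3 * n) = κ ^ (3 * n ^ 2 + -3 * n) * ((κ ^ 2) ^ n) ^ 3 := by
    rw [hX, ← zpow_natCast _ 3, ← zpow_mul, ← zpow_add₀ h0]; congr 1; push_cast; ring
  have e4 : κ ^ (3 * n ^ 2 + 1 * n) = κ ^ (3 * n ^ 2 + -3 * n) * ((κ ^ 2) ^ n) ^ 2 := by
    rw [hX, ← zpow_natCast _ 2, ← zpow_mul, ← zpow_add₀ h0]; congr 1; push_cast; ring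
  have e5 : κ ^ (3 * n ^ 2 + -1 * n) = κ ^ (3 * n ^ 2 + -3 * n) * (κ ^ 2) ^ n := by
    rw [hX, ← zpow_add₀ h0]; congr 1; ring
  rw [e1, e2, e3, e4, e5, zpow_sub₀ (neg_ne_zero.2 hw), zpow_one]
  generalize (κ ^ 2) ^ n = X at *
  field_simp
  ring

/-- The analytic form of Euler's pentagonal number theorem. -/
lemma qPoch_self_eq_gaussSum3 {κ : ℂ} (hκ : ‖κ‖ ≤ 1 / 3) (h0 : κ ≠ 0) :
    qPoch (κ ^ 2) (κ ^ 2) = gaussSum3 κ (1 * κ ^ (1 : ℤ)) := by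
  have hκ1 : ‖κ‖ < 1 := by linarith
  have hx : ‖κ ^ 2‖ ≤ 1 / 9 := norm_sq_le hκ
  set x := κ ^ 2 with hxd
  have hx1 : ‖x‖ < 1 := by linarith
  have hpb : ∀ k n : ℕ, ‖∏ i ∈ Finset.range (n + 1), (1 - x ^ (k + i + 1))‖ ≤ 2 * 2 ^ n := by
    intro k n
    rw [norm_prod, show (2 : ℝ) * 2 ^ n = ∏ i ∈ Finset.range (n + 1), (2 : ℝ) by
      rw [Finset.prod_const, Finset.card_range]; ring]
    refine Finset.prod_le_prod (fun _ _ => norm_nonneg _) fun i _ => ?_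
    refine (norm_sub_le _ _).trans ?_
    rw [norm_one, norm_pow]
    have := pow_le_one₀ (norm_nonneg x) hx1.le (n := k + i + 1)
    linarith
  have htb : ∀ k n : ℕ, ‖x ^ ((k + 1) * n) * ∏ i ∈ Finset.range (n + 1), (1 - x ^ (k + i + 1))‖
      ≤ 2 * (2 / 9) ^ n := by
    intro k n
    rw [norm_mul, norm_pow]
    have h1 : ‖x‖ ^ ((k + 1) * n) ≤ (1 / 9) ^ n :=
      (pow_le_pow_of_le_one (norm_nonneg _) hx1.le (Nat.le_mul_of_pos_left n k.succ_pos)).trans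
        (pow_le_pow_left₀ (norm_nonneg _) hx n)
    calc _ ≤ (1 / 9 : ℝ) ^ n * (2 * 2 ^ n) :=
          mul_le_mul h1 (hpb k n) (norm_nonneg _) (by positivity)
      _ = _ := by rw [show (2 / 9 : ℝ) = 1 / 9 * 2 by norm_num, mul_pow]; ring
  have hgeo : HasSum (fun n : ℕ => 2 * (2 / 9 : ℝ) ^ n) (2 * (1 - 2 / 9)⁻¹) :=
    (hasSum_geometric_of_lt_one (by norm_num) (by norm_num)).mul_left 2
  have hf := (summable_norm_gauss_linear hκ1 h0 one_ne_zero 1).of_norm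
  have hterm : ∀ k : ℕ, (-1) ^ k * (x ^ pentagonal (-k) - x ^ pentagonal (k + 1))
      = (-1 : ℂ) ^ (k : ℤ) * κ ^ (3 * (k : ℤ) ^ 2 + 1 * k)
        + (-1) ^ (-((k : ℤ) + 1)) * κ ^ (3 * (-((k : ℤ) + 1)) ^ 2 + 1 * (-((k : ℤ) + 1))) := by
    intro k
    have e1 : x ^ pentagonal (-k) = κ ^ (3 * (k : ℤ) ^ 2 + 1 * k) := by
      rw [hxd, ← pow_mul, ← zpow_natCast]
      congr 1
      push_cast
      rw [two_mul_natCast_pentagonal_neg]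
      ring
    have e2 : x ^ pentagonal (k + 1)
        = κ ^ (3 * (-((k : ℤ) + 1)) ^ 2 + 1 * (-((k : ℤ) + 1))) := by
      rw [hxd, ← pow_mul, ← zpow_natCast]
      congr 1
      push_cast
      rw [two_mul_natCast_pentagonal]
      ring
    rw [e1, e2, zpow_neg, ← inv_zpow, inv_neg, inv_one,
      zpow_add₀ (neg_ne_zero.2 (one_ne_zero (α := ℂ))), zpow_natCast, zpow_one]
    ring
  have hs := hf.hasSum.nat_add_neg_add_one
  have hprod : qPoch x x = ∏' n : ℕ, (1 - x ^ (n + 1)) := by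
    unfold qPoch
    simp_rw [pow_succ']
  rw [hprod, gaussSum3_eq h0, ← hs.tsum_eq, Pentagonal.tprod_one_sub_pow]
  · exact tsum_congr hterm
  · exact tendsto_pow_atTop_nhds_zero_of_norm_lt_one hx1
  · exact fun k => Summable.of_norm_bounded hgeo.summable (htb k)
  · intro k
    refine (multipliable_qPoch hx1 (x ^ (k + 1))).congr fun n => ?_
    ring
  · exact hs.summable.congr fun k => (hterm k).symm
  · refine squeeze_zero_norm (a := fun k => (1 / 9 : ℝ) ^ k * (2 * (1 - 2 / 9)⁻¹)) (fun k => ?_) ?_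
    · rw [norm_mul, norm_mul, norm_pow, norm_neg, norm_one, one_pow, one_mul, norm_pow]
      refine mul_le_mul ?_ (tsum_of_norm_bounded hgeo (htb k)) (norm_nonneg _) (by positivity)
      refine (pow_le_pow_of_le_one (norm_nonneg _) hx1.le (?_ : k ≤ _)).trans
        (pow_le_pow_left₀ (norm_nonneg _) hx k)
      rw [Nat.le_div_iff_mul_le two_pos]
      nlinarith
    · simpa using (tendsto_pow_atTop_nhds_zero_of_lt_one (by norm_num : (0 : ℝ) ≤ 1 / 9)
        (by norm_num)).mul_const (2 * (1 - 2 / 9 : ℝ)⁻¹)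

lemma inv_ne_zpow {Q z : ℂ} (hp : ∀ n : ℤ, z ≠ Q ^ n) (n : ℤ) : z⁻¹ ≠ Q ^ n := by
  intro h
  refine hp (-n) ?_
  rw [zpow_neg, ← h, inv_inv]

lemma thetaQ_mul_eq_zero {Q x : ℂ} (hQ : ‖Q‖ < 1) (h0 : Q ≠ 0) (hx : x ≠ 0)
    (h : thetaQ Q x = 0) : thetaQ Q (Q * x) = 0 := by
  rw [thetaQ_mul hQ h0 hx, h, neg_zero, zero_div]

lemma tendsto_mul_const_nhdsNE' {a z b : ℂ} (ha : a ≠ 0) (h : z * a = b) :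
    Tendsto (fun w => w * a) (𝓝[≠] z) (𝓝[≠] b) := h ▸ tendsto_mul_const_nhdsNE ha z

lemma continuousAt_comp_mul_const {f : ℂ → ℂ} {z a : ℂ} (hf : AnalyticAt ℂ f (z * a)) :
    ContinuousAt (fun u => f (u * a)) z :=
  ContinuousAt.comp (f := fun u => u * a) hf.continuousAt
    (continuous_id.mul continuous_const).continuousAt

section AppellAddition

variable {κ ζ : ℂ}

/-- The elliptic function whose constancy gives the addition formula for `appell`. -/
noncomputable def appellAux (κ ζ c z : ℂ) : ℂ :=
  (ζ ^ 3 * appell κ (z * ζ) (ζ ^ 3) + appell κ (z * ζ⁻¹) (ζ ^ 3)⁻¹ - c * appell κ z 1)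
    * thetaQ (κ ^ 2) (z * ζ) * thetaQ (κ ^ 2) z * thetaQ (κ ^ 2) (z * ζ⁻¹)

lemma appellAux_mul (hκ : ‖κ‖ < 1) (h0 : κ ≠ 0) (hζ : ζ ≠ 0) {c z : ℂ} (hz : z ≠ 0)
    (hc : c * gaussSum3 κ (1 * κ ^ (1 : ℤ)) = ζ ^ 2 * gaussSum3 κ (ζ ^ 3 * κ ^ (1 : ℤ))
      + ζ * gaussSum3 κ ((ζ ^ 3)⁻¹ * κ ^ (1 : ℤ))) :
    appellAux κ ζ c (κ ^ 2 * z) = appellAux κ ζ c z := by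
  have hQ := norm_sq_lt_one hκ
  have hQ0 := pow_ne_zero 2 h0
  have hi := inv_ne_zero hζ
  have hzζ := mul_ne_zero hz hζ
  have hzi := mul_ne_zero hz hi
  unfold appellAux
  rw [mul_assoc (κ ^ 2) z ζ, mul_assoc (κ ^ 2) z ζ⁻¹]
  by_cases h1 : thetaQ (κ ^ 2) (z * ζ) = 0
  · rw [h1, thetaQ_mul_eq_zero hQ hQ0 hzζ h1]; simp
  by_cases h2 : thetaQ (κ ^ 2) z = 0
  · rw [h2, thetaQ_mul_eq_zero hQ hQ0 hz h2]; simp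
  by_cases h3 : thetaQ (κ ^ 2) (z * ζ⁻¹) = 0
  · rw [h3, thetaQ_mul_eq_zero hQ hQ0 hzi h3]; simp
  have ne : ∀ x, x ≠ 0 → thetaQ (κ ^ 2) x ≠ 0 → ∀ n : ℤ, x ≠ (κ ^ 2) ^ n := fun x hx h n hn =>
    h ((thetaQ_eq_zero_iff hQ hQ0 hx).2 ⟨n, hn⟩)
  have h3ζ := pow_ne_zero 3 hζ
  rw [appell_shift hκ h0 h3ζ hzζ (ne _ hzζ h1), appell_shift hκ h0 one_ne_zero hz (ne _ hz h2),
    appell_shift hκ h0 (inv_ne_zero h3ζ) hzi (ne _ hzi h3),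
    thetaQ_mul hQ hQ0 hzζ, thetaQ_mul hQ hQ0 hz, thetaQ_mul hQ hQ0 hzi]
  have i1 : ∀ w : ℂ, gaussSum3 κ (w * κ ^ (-1 : ℤ)) = gaussSum3 κ (w⁻¹ * κ ^ (1 : ℤ)) := by
    intro w
    rw [← gaussSum3_inv, mul_inv, ← zpow_neg, neg_neg]
  have i3 : ∀ w : ℂ, w ≠ 0 →
      gaussSum3 κ (w * κ ^ (-3 : ℤ)) = -w * gaussSum3 κ (w⁻¹ * κ ^ (-3 : ℤ)) := by
    intro w hw
    rw [← gaussSum3_inv, mul_inv, ← zpow_neg, neg_neg, gaussSum3_mul h0 (inv_ne_zero hw), inv_inv]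
  have j1 := i1 (ζ ^ 3)
  have j2 := i1 (ζ ^ 3)⁻¹
  have j3 := i1 1
  have j4 := i3 _ h3ζ
  have j5 := i3 1 one_ne_zero
  rw [inv_one] at j3 j5
  rw [inv_inv] at j2
  have j6 : gaussSum3 κ (1 * κ ^ (-3 : ℤ)) = 0 := by linear_combination j5 / 2
  rw [j1, j2, j3, j4, j6]
  clear j1 j2 j3 j4 j5 j6 i1 i3 ne
  generalize gaussSum3 κ (ζ ^ 3 * κ ^ (1 : ℤ)) = G₁ at *
  generalize gaussSum3 κ ((ζ ^ 3)⁻¹ * κ ^ (1 : ℤ)) = G₂ at *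
  generalize gaussSum3 κ ((ζ ^ 3)⁻¹ * κ ^ (-3 : ℤ)) = G₄ at *
  generalize gaussSum3 κ (1 * κ ^ (1 : ℤ)) = G₃ at *
  generalize thetaQ (κ ^ 2) (z * ζ) = T₁ at *
  generalize thetaQ (κ ^ 2) z = T₂ at *
  generalize thetaQ (κ ^ 2) (z * ζ⁻¹) = T₃ at *
  generalize appell κ (z * ζ) (ζ ^ 3) = A₁ at *
  generalize appell κ (z * ζ⁻¹) (ζ ^ 3)⁻¹ = A₂ at *
  generalize appell κ z 1 = A₃ at *
  field_simp
  linear_combination (-z ^ 2 - z) * hc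

lemma removableAt_appellAux (hκ : ‖κ‖ < 1) (h0 : κ ≠ 0) (hζ : ζ ≠ 0) (c : ℂ) {z : ℂ}
    (hz : z ≠ 0) : RemovableAt (appellAux κ ζ c) z := by
  have hQ := norm_sq_lt_one hκ
  have h3ζ := pow_ne_zero 3 hζ
  have hi := inv_ne_zero hζ
  have hθ : ∀ x, x ≠ 0 → RemovableAt (thetaQ (κ ^ 2)) x := fun x hx =>
    (analyticAt_thetaQ hQ hx).removableAt
  have r1 := (removableAt_appell_mul hκ h0 h3ζ (mul_ne_zero hz hζ)).comp_mul_const hζ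
  have r2 := (removableAt_appell_mul hκ h0 (inv_ne_zero h3ζ) (mul_ne_zero hz hi)).comp_mul_const hi
  have r3 := removableAt_appell_mul hκ h0 one_ne_zero hz
  have t1 := (hθ _ (mul_ne_zero hz hζ)).comp_mul_const hζ
  have t2 := hθ _ hz
  have t3 := (hθ _ (mul_ne_zero hz hi)).comp_mul_const hi
  refine ((((r1.mul t2).mul t3).const_mul (ζ ^ 3)).add (((r2.mul t1).mul t2).add
    (((r3.mul t1).mul t3).const_mul (-c)))).congr (Eventually.of_forall fun u => ?_)
  simp only [appellAux]
  ring

/-- The addition formula for the level three Appell sums. -/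
theorem appell_add (hκ : ‖κ‖ ≤ 1 / 3) (h0 : κ ≠ 0) (hζ : ζ ≠ 0)
    (h1 : ∀ n : ℤ, ζ ≠ (κ ^ 2) ^ n) (h2 : ∀ n : ℤ, ζ ^ 2 ≠ (κ ^ 2) ^ n) :
    (ζ * gaussSum3 κ (ζ ^ 3 * κ ^ (1 : ℤ)) + gaussSum3 κ ((ζ ^ 3)⁻¹ * κ ^ (1 : ℤ))) *
        thetaQ (κ ^ 2) ζ = qPoch (κ ^ 2) (κ ^ 2) * thetaQ (κ ^ 2) (ζ ^ 2) ∧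
    ∀ z, z ≠ 0 → (∀ n : ℤ, z ≠ (κ ^ 2) ^ n) → (∀ n : ℤ, z * ζ ≠ (κ ^ 2) ^ n) →
      (∀ n : ℤ, z * ζ⁻¹ ≠ (κ ^ 2) ^ n) →
      ζ ^ 3 * appell κ (z * ζ) (ζ ^ 3) + appell κ (z * ζ⁻¹) (ζ ^ 3)⁻¹ =
        ζ * (thetaQ (κ ^ 2) (ζ ^ 2) / thetaQ (κ ^ 2) ζ) * appell κ z 1 +
        qPoch (κ ^ 2) (κ ^ 2) ^ 2 * thetaQ (κ ^ 2) ζ * thetaQ (κ ^ 2) (ζ ^ 2) /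
          (thetaQ (κ ^ 2) (z * ζ) * thetaQ (κ ^ 2) z * thetaQ (κ ^ 2) (z * ζ⁻¹)) := by
  have hκ1 : ‖κ‖ < 1 := by linarith
  have hQ := norm_sq_lt_one hκ1
  have hQ0 := pow_ne_zero 2 h0
  have h3ζ := pow_ne_zero 3 hζ
  have hi := inv_ne_zero hζ
  have hj := qPoch_self_eq_gaussSum3 hκ h0
  have hJ := qPoch_self_ne_zero hQ
  set J := qPoch (κ ^ 2) (κ ^ 2) with hJd
  set S := ζ * gaussSum3 κ (ζ ^ 3 * κ ^ (1 : ℤ)) + gaussSum3 κ ((ζ ^ 3)⁻¹ * κ ^ (1 : ℤ)) with hS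
  set c := ζ * S / J with hc
  obtain ⟨C, hC⟩ := exists_const_of_periodic_removable hQ hQ0
    (fun z hz => removableAt_appellAux hκ1 h0 hζ c hz)
    (fun z hz => appellAux_mul hκ1 h0 hζ hz (c := c) (by rw [← hj, hc, hS]; field_simp))
  have hθ : ∀ a z : ℂ, z * a ≠ 0 → ContinuousAt (fun u => thetaQ (κ ^ 2) (u * a)) z := fun a z h =>
    continuousAt_comp_mul_const (analyticAt_thetaQ hQ h)
  have hA : ∀ a w z : ℂ, w ≠ 0 → z * a ≠ 0 → (∀ n : ℤ, z * a ≠ (κ ^ 2) ^ n) →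
      ContinuousAt (fun u => appell κ (u * a) w) z := fun a w z hw h h' =>
    continuousAt_comp_mul_const (analyticAt_appell hκ1 h0 hw h h')
  have hi1 := inv_ne_zpow h1
  have hi2 := inv_ne_zpow h2
  have hθi : ∀ x : ℂ, x ≠ 0 → thetaQ (κ ^ 2) x⁻¹ = -thetaQ (κ ^ 2) x / x :=
    fun x hx => thetaQ_inv hQ hx
  have hθζ : thetaQ (κ ^ 2) ζ ≠ 0 := thetaQ_ne_zero hQ hQ0 hζ h1
  have hθζ2 : thetaQ (κ ^ 2) (ζ ^ 2) ≠ 0 := thetaQ_ne_zero hQ hQ0 (pow_ne_zero 2 hζ) h2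
  have hlim1 : Tendsto (appellAux κ ζ c) (𝓝[≠] 1)
      (𝓝 (-c * J ^ 2 * thetaQ (κ ^ 2) ζ * thetaQ (κ ^ 2) ζ⁻¹)) := by
    have hζ1 : ∀ n : ℤ, 1 * ζ ≠ (κ ^ 2) ^ n := by simpa using h1
    have hi1' : ∀ n : ℤ, 1 * ζ⁻¹ ≠ (κ ^ 2) ^ n := by simpa using hi1
    have lim : ∀ {f : ℂ → ℂ}, ContinuousAt f 1 → Tendsto f (𝓝[≠] 1) (𝓝 (f 1)) := fun h =>
      h.tendsto.mono_left nhdsWithin_le_nhds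
    have a1 := lim (hA ζ (ζ ^ 3) 1 h3ζ (by simpa using hζ) hζ1)
    have a2 := lim (hA ζ⁻¹ (ζ ^ 3)⁻¹ 1 (inv_ne_zero h3ζ) (by simpa using hζ) hi1')
    have a3 := tendsto_appell_mul_one hκ1 h0 one_ne_zero
    have t1 := lim (hθ ζ 1 (by simpa using hζ))
    have t2 := lim (analyticAt_thetaQ hQ one_ne_zero).continuousAt
    have t3 := lim (hθ ζ⁻¹ 1 (by simpa using hζ))
    have h := (((((a1.const_mul (ζ ^ 3)).add a2).mul t2).sub (a3.const_mul c)).mul t1).mul t3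
    simp only [thetaQ_one hQ, mul_zero, zero_sub, one_mul] at h
    refine (h.congr fun u => ?_).trans_eq ?_
    · simp only [appellAux]; ring
    · congr 1; ring
  have hlim2 : Tendsto (appellAux κ ζ c) (𝓝[≠] ζ⁻¹)
      (𝓝 (ζ ^ 3 * J ^ 2 * thetaQ (κ ^ 2) ζ⁻¹ * thetaQ (κ ^ 2) (ζ ^ 2)⁻¹)) := by
    have lim : ∀ {f : ℂ → ℂ}, ContinuousAt f ζ⁻¹ → Tendsto f (𝓝[≠] ζ⁻¹) (𝓝 (f ζ⁻¹)) := fun h =>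
      h.tendsto.mono_left nhdsWithin_le_nhds
    have e1 : ζ⁻¹ * ζ = 1 := inv_mul_cancel₀ hζ
    have e2 : ζ⁻¹ * ζ⁻¹ = (ζ ^ 2)⁻¹ := by rw [← mul_inv, sq]
    have hii := mul_ne_zero hi hi
    have a1 := (tendsto_appell_mul_one hκ1 h0 h3ζ).comp (tendsto_mul_const_nhdsNE' hζ e1)
    have a2 := lim (hA ζ⁻¹ (ζ ^ 3)⁻¹ ζ⁻¹ (inv_ne_zero h3ζ) hii (by rw [e2]; exact hi2))
    have a3 := lim (analyticAt_appell hκ1 h0 one_ne_zero hi hi1).continuousAt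
    have t1 := lim (hθ ζ ζ⁻¹ (by rw [e1]; exact one_ne_zero))
    have t2 := lim (analyticAt_thetaQ hQ hi).continuousAt
    have t3 := lim (hθ ζ⁻¹ ζ⁻¹ hii)
    have h := (((a1.const_mul (ζ ^ 3)).add ((a2.sub (a3.const_mul c)).mul t1)).mul t2).mul t3
    simp only [e1, e2, thetaQ_one hQ, mul_zero, add_zero] at h
    refine (h.congr fun u => ?_).trans_eq ?_
    · simp only [appellAux, Function.comp_apply]; ring
    · congr 1
  have hC1 : C = -c * J ^ 2 * thetaQ (κ ^ 2) ζ * thetaQ (κ ^ 2) ζ⁻¹ :=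
    tendsto_nhds_unique (tendsto_const_nhds.congr' (hC 1 one_ne_zero).symm) hlim1
  have hC2 : C = ζ ^ 3 * J ^ 2 * thetaQ (κ ^ 2) ζ⁻¹ * thetaQ (κ ^ 2) (ζ ^ 2)⁻¹ :=
    tendsto_nhds_unique (tendsto_const_nhds.congr' (hC _ hi).symm) hlim2
  have hcθ : c * thetaQ (κ ^ 2) ζ = ζ * thetaQ (κ ^ 2) (ζ ^ 2) := by
    have h := hC1.symm.trans hC2
    rw [hθi _ hζ, hθi _ (pow_ne_zero 2 hζ)] at h
    field_simp at h
    linear_combination h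
  constructor
  · rw [hc] at hcθ
    field_simp at hcθ
    linear_combination hcθ
  · intro z hz hz1 hz2 hz3
    have hcont : ContinuousAt (appellAux κ ζ c) z := by
      have hz1' : z * 1 ≠ 0 := by simpa using hz
      have e1 := hA ζ (ζ ^ 3) z h3ζ (mul_ne_zero hz hζ) hz2
      have e2 := hA ζ⁻¹ (ζ ^ 3)⁻¹ z (inv_ne_zero h3ζ) (mul_ne_zero hz hi) hz3
      have e3 := hA 1 1 z one_ne_zero hz1' (by simpa using hz1)
      have e4 := hθ ζ z (mul_ne_zero hz hζ)
      have e5 := hθ 1 z hz1'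
      have e6 := hθ ζ⁻¹ z (mul_ne_zero hz hi)
      simp only [mul_one] at e3 e5
      exact (((((continuousAt_const.mul e1).add e2).sub (continuousAt_const.mul e3)).mul e4).mul
        e5).mul e6
    have hCz : appellAux κ ζ c z = C :=
      tendsto_nhds_unique (hcont.tendsto.mono_left nhdsWithin_le_nhds)
        (tendsto_const_nhds.congr' (hC z hz).symm)
    have n1 := thetaQ_ne_zero hQ hQ0 hz hz1
    have n2 := thetaQ_ne_zero hQ hQ0 (mul_ne_zero hz hζ) hz2
    have n3 := thetaQ_ne_zero hQ hQ0 (mul_ne_zero hz hi) hz3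
    rw [hC2, hθi _ hζ, hθi _ (pow_ne_zero 2 hζ)] at hCz
    have hc' : ζ * (thetaQ (κ ^ 2) (ζ ^ 2) / thetaQ (κ ^ 2) ζ) = c := by
      field_simp
      linear_combination -hcθ
    rw [hc', ← sub_eq_iff_eq_add', eq_div_iff (mul_ne_zero (mul_ne_zero n2 n1) n3)]
    unfold appellAux at hCz
    have : ζ ^ 3 * J ^ 2 * (-thetaQ (κ ^ 2) ζ / ζ) * (-thetaQ (κ ^ 2) (ζ ^ 2) / ζ ^ 2)
        = J ^ 2 * thetaQ (κ ^ 2) ζ * thetaQ (κ ^ 2) (ζ ^ 2) := by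
      field_simp
    linear_combination hCz + this

end AppellAddition

lemma tsum_int_residues {f : ℤ → ℂ} (hf : Summable f) (s : ℤ) :
    ∑' n, f n = ∑ j : Fin 11, ∑' m : ℤ, f (11 * m + (s + j)) := by
  let e : Fin 11 × ℤ ≃ ℤ :=
    ((Equiv.prodComm _ _).trans (Int.divModEquiv 11).symm).trans (Equiv.addRight s)
  have he : ∀ p : Fin 11 × ℤ, e p = 11 * p.2 + (s + p.1) := by
    intro p
    simp [e, Int.divModEquiv, mul_comm, add_assoc, add_comm]
  have hs : Summable fun p : Fin 11 × ℤ => f (11 * p.2 + (s + p.1)) :=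
    (e.summable_iff.2 hf).congr fun p => by rw [Function.comp_apply, he]
  rw [← e.tsum_eq]
  simp_rw [he]
  rw [hs.tsum_prod, tsum_fintype]

lemma sum_fin_eleven_eq_pairs (g : ℤ → ℂ) :
    ∑ j : Fin 11, g (-5 + ((j : ℕ) : ℤ)) = g 0 + ∑ j ∈ Finset.Icc (1 : ℤ) 5, (g j + g (-j)) := by
  rw [show Finset.Icc (1 : ℤ) 5 = {1, 2, 3, 4, 5} by decide]
  simp [Fin.sum_univ_succ]
  ring

/-- The theta value `θ(q^(22k); q^242)`. -/
noncomputable def theta11 (q : ℂ) (k : ℤ) : ℂ := thetaQ ((q ^ 121) ^ 2) ((q ^ 22) ^ k)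

lemma norm_pow_le_third {q : ℂ} (hq : ‖q‖ ≤ 1 / 3) {n : ℕ} (hn : n ≠ 0) : ‖q ^ n‖ ≤ 1 / 3 := by
  rw [norm_pow]
  exact (pow_le_of_le_one (norm_nonneg _) (by linarith) hn).trans hq

lemma zpow_ne_base {q : ℂ} (hq : ‖q‖ < 1) (h0 : q ≠ 0) {k : ℤ} (hk : ¬ (11 : ℤ) ∣ k) (n : ℤ) :
    (q ^ 22) ^ k ≠ ((q ^ 121) ^ 2) ^ n := by
  intro h
  rw [← pow_mul, ← zpow_natCast, ← zpow_natCast, ← zpow_mul, ← zpow_mul] at h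
  have h1 : q ^ (22 * k - 242 * n) = 1 := by
    rw [zpow_sub₀ h0, div_eq_one_iff_eq (zpow_ne_zero _ h0)]
    exact_mod_cast h
  have h2 : 22 * k - 242 * n ≠ 0 := fun h => hk ⟨n, by lia⟩
  exact zpow_ne_one_of_norm_lt hq h2 h1

lemma theta11_ne_zero {q : ℂ} (hq : ‖q‖ < 1) (h0 : q ≠ 0) {k : ℤ} (hk : ¬ (11 : ℤ) ∣ k) :
    theta11 q k ≠ 0 :=
  thetaQ_ne_zero (norm_sq_lt_one (norm_pow_lt_one hq (by norm_num)))
    (pow_ne_zero _ (pow_ne_zero _ h0)) (zpow_ne_zero _ (pow_ne_zero _ h0))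
    (zpow_ne_base hq h0 hk)

lemma not_dvd_of_mem_Icc {j : ℤ} (hj : j ∈ Finset.Icc (1 : ℤ) 5) :
    ¬ (11 : ℤ) ∣ j ∧ ¬ (11 : ℤ) ∣ 2 * j := by
  rw [Finset.mem_Icc] at hj
  constructor <;> lia

lemma appell_add_theta11 {q : ℂ} (hq : ‖q‖ ≤ 1 / 3) (h0 : q ≠ 0) {j : ℤ}
    (hj : j ∈ Finset.Icc (1 : ℤ) 5) :
    ((q ^ 22) ^ j * gaussSum3 (q ^ 121) (((q ^ 22) ^ j) ^ 3 * (q ^ 121) ^ (1 : ℤ)) +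
      gaussSum3 (q ^ 121) ((((q ^ 22) ^ j) ^ 3)⁻¹ * (q ^ 121) ^ (1 : ℤ))) * theta11 q j =
      qPoch ((q ^ 121) ^ 2) ((q ^ 121) ^ 2) * theta11 q (2 * j) ∧
    ∀ z, z ≠ 0 → (∀ n : ℤ, z ≠ ((q ^ 121) ^ 2) ^ n) →
      (∀ n : ℤ, z * (q ^ 22) ^ j ≠ ((q ^ 121) ^ 2) ^ n) →
      (∀ n : ℤ, z * ((q ^ 22) ^ j)⁻¹ ≠ ((q ^ 121) ^ 2) ^ n) →
      ((q ^ 22) ^ j) ^ 3 * appell (q ^ 121) (z * (q ^ 22) ^ j) (((q ^ 22) ^ j) ^ 3) +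
        appell (q ^ 121) (z * ((q ^ 22) ^ j)⁻¹) (((q ^ 22) ^ j) ^ 3)⁻¹ =
        (q ^ 22) ^ j * (theta11 q (2 * j) / theta11 q j) * appell (q ^ 121) z 1 +
        qPoch ((q ^ 121) ^ 2) ((q ^ 121) ^ 2) ^ 2 * theta11 q j * theta11 q (2 * j) /
          (thetaQ ((q ^ 121) ^ 2) (z * (q ^ 22) ^ j) * thetaQ ((q ^ 121) ^ 2) z *
            thetaQ ((q ^ 121) ^ 2) (z * ((q ^ 22) ^ j)⁻¹)) := by
  have hq1 : ‖q‖ < 1 := by linarith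
  obtain ⟨d1, d2⟩ := not_dvd_of_mem_Icc hj
  have e : ((q ^ 22) ^ j) ^ 2 = (q ^ 22) ^ (2 * j) := by
    rw [← zpow_natCast _ 2, ← zpow_mul]; congr 1; push_cast; ring
  have := appell_add (κ := q ^ 121) (ζ := (q ^ 22) ^ j) (norm_pow_le_third hq (by norm_num))
    (pow_ne_zero _ h0) (zpow_ne_zero _ (pow_ne_zero _ h0)) (zpow_ne_base hq1 h0 d1)
    (by rw [e]; exact zpow_ne_base hq1 h0 d2)
  rwa [e] at this

/-- The eleven-dissection of the pentagonal number series. -/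
theorem pentagonalSeries_dissection {q : ℂ} (hq : ‖q‖ ≤ 1 / 3) (h0 : q ≠ 0) :
    pentagonalSeries q = q ^ 10 * qPoch ((q ^ 121) ^ 2) ((q ^ 121) ^ 2) *
      (1 + ∑ j ∈ Finset.Icc (1 : ℤ) 5,
        (-1) ^ j * q ^ (3 * j ^ 2 - 11 * j) * (theta11 q (2 * j) / theta11 q j)) := by
  have hq1 : ‖q‖ < 1 := by linarith
  have hκ0 : q ^ 121 ≠ 0 := pow_ne_zero _ h0
  have hs : Summable fun n : ℤ => (-1) ^ n * q ^ (n * (3 * n + 1)) := by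
    refine (summable_norm_gauss_linear hq1 h0 one_ne_zero 1).of_norm.congr fun n => ?_
    congr 2; ring
  have hdis : ∀ j : ℤ, ∑' m : ℤ, (-1) ^ (11 * m + (-2 + j)) *
      q ^ ((11 * m + (-2 + j)) * (3 * (11 * m + (-2 + j)) + 1)) =
      (-1) ^ j * q ^ (3 * j ^ 2 - 11 * j + 10) *
        gaussSum3 (q ^ 121) ((((q ^ 22) ^ j) ^ 3)⁻¹ * (q ^ 121) ^ (1 : ℤ)) := by
    intro j
    rw [← gaussSum3_inv, mul_inv, inv_inv, ← zpow_neg, gaussSum3_eq hκ0, ← tsum_mul_left]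
    refine tsum_congr fun m => ?_
    have e1 : (-1 : ℂ) ^ (11 * m + (-2 + j)) = (-1) ^ j * (-1) ^ m := by
      rw [show 11 * m + (-2 + j) = j + m + 2 * (5 * m - 1) by ring,
        zpow_add₀ (by norm_num), zpow_add₀ (by norm_num), zpow_mul]
      norm_num
    have e2 : (-((q ^ 22) ^ j) ^ 3) ^ m = (-1) ^ m * q ^ (66 * j * m) := by
      rw [neg_eq_neg_one_mul, mul_zpow, ← zpow_natCast _ 22, ← zpow_natCast _ 3, ← zpow_mul,
        ← zpow_mul, ← zpow_mul]
      congr 2; push_cast; ring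
    have e3 : (q ^ 121) ^ (3 * m ^ 2 + -1 * m) = q ^ (121 * (3 * m ^ 2 + -1 * m)) := by
      rw [← zpow_natCast _ 121, ← zpow_mul]; norm_cast
    rw [e1, e2, e3, show (11 * m + (-2 + j)) * (3 * (11 * m + (-2 + j)) + 1) =
      (3 * j ^ 2 - 11 * j + 10) + 66 * j * m + 121 * (3 * m ^ 2 + -1 * m) by ring,
      zpow_add₀ h0, zpow_add₀ h0]
    ring
  rw [pentagonalSeries, tsum_int_residues hs (-2 + -5)]
  have h1 := sum_fin_eleven_eq_pairs fun j => (-1) ^ j * q ^ (3 * j ^ 2 - 11 * j + 10) *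
    gaussSum3 (q ^ 121) ((((q ^ 22) ^ j) ^ 3)⁻¹ * (q ^ 121) ^ (1 : ℤ))
  simp_rw [← hdis] at h1
  simp_rw [add_assoc (-2 : ℤ) (-5)]
  rw [h1, mul_add, mul_one, Finset.mul_sum]
  congr 1
  · rw [hdis, qPoch_self_eq_gaussSum3 (norm_pow_le_third hq (by norm_num)) hκ0]
    norm_num
  · refine Finset.sum_congr rfl fun j hj => ?_
    obtain ⟨d1, d2⟩ := not_dvd_of_mem_Icc hj
    have h2 := (appell_add_theta11 hq h0 hj).1
    have h3 := theta11_ne_zero hq1 h0 d1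
    rw [hdis, hdis]
    have e1 : (((q ^ 22) ^ (-j)) ^ 3)⁻¹ = ((q ^ 22) ^ j) ^ 3 := by
      rw [zpow_neg, inv_pow, inv_inv]
    have e2 : q ^ (3 * (-j) ^ 2 - 11 * -j + 10) = q ^ (3 * j ^ 2 - 11 * j) * q ^ 10 *
        (q ^ 22) ^ j := by
      rw [← zpow_natCast q 22, ← zpow_natCast q 10, ← zpow_mul, ← zpow_add₀ h0, ← zpow_add₀ h0]
      congr 1; push_cast; ring
    have e3 : q ^ (3 * j ^ 2 - 11 * j + 10) = q ^ (3 * j ^ 2 - 11 * j) * q ^ 10 := by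
      rw [← zpow_natCast q 10, ← zpow_add₀ h0]; norm_cast
    have e4 : (-1 : ℂ) ^ (-j) = (-1) ^ j := by rw [zpow_neg, ← inv_zpow]; norm_num
    rw [e1, e2, e3, e4]
    have h4 := (eq_div_iff h3).2 h2
    rw [mul_div_assoc] at h4
    linear_combination (-1) ^ j * q ^ (3 * j ^ 2 - 11 * j) * q ^ 10 * h4

/-- The Lambert sum whose eleven-dissection is computed below. -/
noncomputable def rankLambertSum (a : ℤ) (q y : ℂ) : ℂ :=
  ∑' n : ℤ, (-1) ^ n * q ^ (n * (3 * n + 1) + 2 * a * n) / (1 - y * (q ^ 22) ^ n)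

lemma summable_rankLambertSum_coeff {q : ℂ} (hq : ‖q‖ < 1) (h0 : q ≠ 0) (a : ℤ) :
    Summable fun n : ℤ =>
      ‖(-1) ^ n * q ^ (n * (3 * n + 1) + 2 * a * n) * (q ^ 22) ^ (-n)‖ := by
  refine (summable_norm_gauss_linear hq h0 one_ne_zero (2 * a - 21)).congr fun n => ?_
  rw [mul_assoc, ← zpow_natCast q 22, ← zpow_mul, ← zpow_add₀ h0]
  congr 3
  push_cast
  ring

lemma appell_term_dissection {q y : ℂ} (h0 : q ≠ 0) {a r : ℤ} (hr : Even r)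
    (har : 3 * r + a = 16) (j : ℤ) :
    ∑' m : ℤ, (-1) ^ (11 * m + (r + j)) *
      q ^ ((11 * m + (r + j)) * (3 * (11 * m + (r + j)) + 1) + 2 * a * (11 * m + (r + j))) /
        (1 - y * (q ^ 22) ^ (11 * m + (r + j))) =
      (-1) ^ j * q ^ (3 * r * (11 - r) + 3 * j ^ 2 + 33 * j) *
        appell (q ^ 121) (y * (q ^ 22) ^ r * (q ^ 22) ^ j) (((q ^ 22) ^ j) ^ 3) := by
  obtain rfl : a = 16 - 3 * r := by lia
  rw [appell, ← tsum_mul_left]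
  refine tsum_congr fun m => ?_
  have e1 : (-1 : ℂ) ^ (11 * m + (r + j)) = (-1) ^ j * (-1) ^ m := by
    obtain ⟨s, rfl⟩ := hr
    rw [show 11 * m + (s + s + j) = j + m + 2 * (5 * m + s) by ring,
      zpow_add₀ (by norm_num), zpow_add₀ (by norm_num), zpow_mul]
    norm_num
  have e2 : (-((q ^ 22) ^ j) ^ 3) ^ m = (-1) ^ m * q ^ (66 * j * m) := by
    rw [neg_eq_neg_one_mul, mul_zpow, ← zpow_natCast _ 22, ← zpow_natCast _ 3, ← zpow_mul,
      ← zpow_mul, ← zpow_mul]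
    congr 2; push_cast; ring
  have e3 : (q ^ 121) ^ (3 * m ^ 2 + 3 * m) = q ^ (121 * (3 * m ^ 2 + 3 * m)) := by
    rw [← zpow_natCast _ 121, ← zpow_mul]; norm_cast
  have e4 : (q ^ 22) ^ (11 * m + (r + j)) =
      (q ^ 22) ^ r * (q ^ 22) ^ j * ((q ^ 121) ^ 2) ^ m := by
    rw [← pow_mul, ← zpow_natCast q 22, ← zpow_natCast q (121 * 2), ← zpow_mul, ← zpow_mul,
      ← zpow_mul, ← zpow_mul, ← zpow_add₀ h0, ← zpow_add₀ h0]
    congr 1; push_cast; ring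
  rw [e1, e2, e3, e4, show (11 * m + (r + j)) * (3 * (11 * m + (r + j)) + 1) +
    2 * (16 - 3 * r) * (11 * m + (r + j)) =
    (3 * r * (11 - r) + 3 * j ^ 2 + 33 * j) + 66 * j * m + 121 * (3 * m ^ 2 + 3 * m) by ring,
    zpow_add₀ h0, zpow_add₀ h0]
  ring

/-- The eleven-dissection of the Lambert sum. -/
theorem rankLambertSum_dissection {q y : ℂ} (hq : ‖q‖ ≤ 1 / 3) (h0 : q ≠ 0) (hy : y ≠ 0)
    {a r : ℤ} (hr : Even r) (har : 3 * r + a = 16)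
    (hp : ∀ j ∈ Finset.Icc (-5 : ℤ) 5, ∀ n : ℤ, y * (q ^ 22) ^ (r + j) ≠ ((q ^ 121) ^ 2) ^ n)
    (hs : Summable fun n : ℤ =>
      (-1) ^ n * q ^ (n * (3 * n + 1) + 2 * a * n) / (1 - y * (q ^ 22) ^ n)) :
    q ^ 10 * qPoch ((q ^ 121) ^ 2) ((q ^ 121) ^ 2) * rankLambertSum a q y =
      q ^ (3 * r * (11 - r)) * (pentagonalSeries q * appell (q ^ 121) (y * (q ^ 22) ^ r) 1 +
        q ^ 10 * qPoch ((q ^ 121) ^ 2) ((q ^ 121) ^ 2) ^ 3 *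
        ∑ j ∈ Finset.Icc (1 : ℤ) 5, (-1) ^ j * q ^ (3 * j ^ 2 - 33 * j) *
          (theta11 q j * theta11 q (2 * j)) /
          (thetaQ ((q ^ 121) ^ 2) (y * (q ^ 22) ^ (r + j)) *
            thetaQ ((q ^ 121) ^ 2) (y * (q ^ 22) ^ r) *
            thetaQ ((q ^ 121) ^ 2) (y * (q ^ 22) ^ (r - j)))) := by
  have ht0 : q ^ 22 ≠ 0 := pow_ne_zero _ h0
  have h1 := sum_fin_eleven_eq_pairs fun j =>
    (-1) ^ j * q ^ (3 * r * (11 - r) + 3 * j ^ 2 + 33 * j) *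
        appell (q ^ 121) (y * (q ^ 22) ^ r * (q ^ 22) ^ j) (((q ^ 22) ^ j) ^ 3)
  simp_rw [← appell_term_dissection h0 hr har, ← add_assoc r] at h1
  have h2 : rankLambertSum a q y = _ := (tsum_int_residues hs (r + -5)).trans h1
  simp_rw [appell_term_dissection h0 hr har] at h2
  have h3 : ∀ j ∈ Finset.Icc (1 : ℤ) 5,
      (-1) ^ j * q ^ (3 * r * (11 - r) + 3 * j ^ 2 + 33 * j) *
          appell (q ^ 121) (y * (q ^ 22) ^ r * (q ^ 22) ^ j) (((q ^ 22) ^ j) ^ 3) +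
        (-1) ^ (-j) * q ^ (3 * r * (11 - r) + 3 * (-j) ^ 2 + 33 * -j) *
          appell (q ^ 121) (y * (q ^ 22) ^ r * (q ^ 22) ^ (-j)) (((q ^ 22) ^ (-j)) ^ 3) =
      q ^ (3 * r * (11 - r)) * ((-1) ^ j * q ^ (3 * j ^ 2 - 11 * j) *
          (theta11 q (2 * j) / theta11 q j) * appell (q ^ 121) (y * (q ^ 22) ^ r) 1 +
        qPoch ((q ^ 121) ^ 2) ((q ^ 121) ^ 2) ^ 2 * ((-1) ^ j * q ^ (3 * j ^ 2 - 33 * j) *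
          (theta11 q j * theta11 q (2 * j)) /
          (thetaQ ((q ^ 121) ^ 2) (y * (q ^ 22) ^ (r + j)) *
            thetaQ ((q ^ 121) ^ 2) (y * (q ^ 22) ^ r) *
            thetaQ ((q ^ 121) ^ 2) (y * (q ^ 22) ^ (r - j))))) := by
    intro j hj
    have hj' := Finset.mem_Icc.1 hj
    have z1 : y * (q ^ 22) ^ r * (q ^ 22) ^ j = y * (q ^ 22) ^ (r + j) := by
      rw [zpow_add₀ ht0, mul_assoc]
    have z2 : y * (q ^ 22) ^ r * ((q ^ 22) ^ j)⁻¹ = y * (q ^ 22) ^ (r - j) := by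
      rw [zpow_sub₀ ht0, mul_assoc, div_eq_mul_inv]
    have h4 := (appell_add_theta11 hq h0 hj).2 (y * (q ^ 22) ^ r)
      (mul_ne_zero hy (zpow_ne_zero _ ht0)) (by simpa using hp 0 (by simp))
      (by rw [z1]; exact hp j (by rw [Finset.mem_Icc]; lia))
      (by rw [z2]; exact hp (-j) (by rw [Finset.mem_Icc]; lia))
    rw [z1, z2] at h4
    have e4 : (-1 : ℂ) ^ (-j) = (-1) ^ j := by rw [zpow_neg, ← inv_zpow]; norm_num
    have e1 : q ^ (3 * r * (11 - r) + 3 * j ^ 2 + 33 * j) =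
        q ^ (3 * r * (11 - r)) * q ^ (3 * j ^ 2 - 33 * j) * ((q ^ 22) ^ j) ^ 3 := by
      rw [← zpow_natCast q 22, ← zpow_natCast _ 3, ← zpow_mul, ← zpow_mul, ← zpow_add₀ h0,
        ← zpow_add₀ h0]
      congr 1; push_cast; ring
    have e2 : q ^ (3 * r * (11 - r) + 3 * (-j) ^ 2 + 33 * -j) =
        q ^ (3 * r * (11 - r)) * q ^ (3 * j ^ 2 - 33 * j) := by
      rw [← zpow_add₀ h0]; congr 1; ring
    have e3 : q ^ (3 * j ^ 2 - 11 * j) = q ^ (3 * j ^ 2 - 33 * j) * (q ^ 22) ^ j := by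
      rw [← zpow_natCast q 22, ← zpow_mul, ← zpow_add₀ h0]; congr 1; push_cast; ring
    have e5 : (q ^ 22) ^ (-j) = ((q ^ 22) ^ j)⁻¹ := zpow_neg _ _
    rw [e5, z1, z2, e4, e1, e2, e3, inv_pow]
    linear_combination (-1) ^ j * q ^ (3 * r * (11 - r)) * q ^ (3 * j ^ 2 - 33 * j) * h4
  rw [h2, pentagonalSeries_dissection hq h0, Finset.sum_congr rfl h3, ← Finset.mul_sum,
    Finset.sum_add_distrib, ← Finset.sum_mul, ← Finset.mul_sum]
  simp only [zpow_zero, mul_one, one_pow, one_mul, mul_zero, add_zero, ne_eq, OfNat.ofNat_ne_zero,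
    not_false_eq_true, zero_pow]
  ring

/-- The logarithmic derivative `xθ'(x)/θ(x)`. -/
noncomputable def thetaLog (Q x : ℂ) : ℂ := x * deriv (thetaQ Q) x / thetaQ Q x

lemma tendsto_theta_quotient {Q b c : ℂ} (hQ : ‖Q‖ < 1) (hb : b ≠ 0) (hc : c ≠ 0)
    (hb' : thetaQ Q b ≠ 0) (hc' : thetaQ Q c ≠ 0) :
    Tendsto (fun y => qPoch Q Q ^ 2 * (thetaQ Q b * thetaQ Q c) /
        (thetaQ Q (y * c) * thetaQ Q (y * b) * thetaQ Q y) - 1 / (1 - y)) (𝓝[≠] 1)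
      (𝓝 (thetaLog Q c + thetaLog Q b)) := by
  have hR := thetaReg_one_ne_zero hQ
  have hθ : ∀ d : ℂ, d ≠ 0 →
      HasDerivAt (fun y => thetaQ Q (y * d)) (d * deriv (thetaQ Q) d) 1 := by
    intro d hd
    have h1 : HasDerivAt (thetaQ Q) (deriv (thetaQ Q) d) (1 * d) := by
      rw [one_mul]; exact (differentiableAt_thetaQ hQ hd).hasDerivAt
    have h2 : HasDerivAt (fun y : ℂ => y * d) d 1 := by
      simpa using (hasDerivAt_id (1 : ℂ)).mul_const d
    rw [mul_comm]
    exact h1.comp 1 h2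
  have hReg : HasDerivAt (thetaReg Q) 0 1 := by
    rw [← deriv_thetaReg_one hQ]
    exact (differentiableAt_thetaReg hQ one_ne_zero).hasDerivAt
  have hD := ((hθ c hc).mul (hθ b hb)).mul hReg
  have hD0 : thetaQ Q (1 * c) * thetaQ Q (1 * b) * thetaReg Q 1 ≠ 0 := by
    rw [one_mul, one_mul]; exact mul_ne_zero (mul_ne_zero hc' hb') hR
  have hf := (hasDerivAt_iff_tendsto_slope.1
    ((hD.inv hD0).const_mul (thetaReg Q 1 * (thetaQ Q b * thetaQ Q c)))).neg
  refine (hf.congr' ?_).trans_eq ?_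
  · have hreg : ∀ᶠ y in 𝓝[≠] (1 : ℂ), thetaQ Q (y * c) * thetaQ Q (y * b) * thetaReg Q y ≠ 0 :=
      nhdsWithin_le_nhds (hD.continuousAt.eventually_ne hD0)
    filter_upwards [hreg, self_mem_nhdsWithin] with y hy hne
    have h1 : y - 1 ≠ 0 := sub_ne_zero.2 hne
    have h2 : 1 - y ≠ 0 := sub_ne_zero.2 (Ne.symm hne)
    have h3 := right_ne_zero_of_mul hy
    have h4 := right_ne_zero_of_mul (left_ne_zero_of_mul hy)
    have h5 := left_ne_zero_of_mul (left_ne_zero_of_mul hy)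
    rw [slope_def_field, ← thetaReg_one, thetaQ_eq hQ y]
    simp only [Pi.mul_apply, Pi.inv_apply, one_mul]
    rw [← neg_sub 1 y]
    generalize thetaQ Q (y * c) = C at *
    generalize thetaQ Q (y * b) = B at *
    field_simp
  · congr 1
    simp only [Pi.mul_apply, one_mul, thetaLog]
    field_simp
    ring

/-- The eleven-dissection of the Lambert sum occurring in the rank generating function. -/
theorem rankBilateral_dissection {q : ℂ} (hq : ‖q‖ ≤ 1 / 3) (h0 : q ≠ 0)
    {a r : ℤ} (hr : Even r) (har : 3 * r + a = 16) (hr5 : r ∈ Finset.Icc (1 : ℤ) 5) :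
    q ^ 10 * qPoch ((q ^ 121) ^ 2) ((q ^ 121) ^ 2) * rankBilateral a q =
      q ^ (3 * r * (11 - r)) * (pentagonalSeries q * appell (q ^ 121) ((q ^ 22) ^ r) 1 +
        q ^ 10 * qPoch ((q ^ 121) ^ 2) ((q ^ 121) ^ 2) ^ 3 *
        ∑ j ∈ (Finset.Icc (1 : ℤ) 5).erase r, (-1) ^ j * q ^ (3 * j ^ 2 - 33 * j) *
          (theta11 q j * theta11 q (2 * j)) /
          (theta11 q (r + j) * theta11 q r * theta11 q (r - j))) +
      q ^ 10 * qPoch ((q ^ 121) ^ 2) ((q ^ 121) ^ 2) *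
        (thetaLog ((q ^ 121) ^ 2) ((q ^ 22) ^ (2 * r)) +
          thetaLog ((q ^ 121) ^ 2) ((q ^ 22) ^ r)) := by
  have hq1 : ‖q‖ < 1 := by linarith
  have ht0 : q ^ 22 ≠ 0 := pow_ne_zero _ h0
  have ht1 : ‖q ^ 22‖ < 1 := norm_pow_lt_one hq1 (by norm_num)
  have hκ0 : q ^ 121 ≠ 0 := pow_ne_zero _ h0
  have hκ1 : ‖q ^ 121‖ < 1 := norm_pow_lt_one hq1 (by norm_num)
  have hQ := norm_sq_lt_one hκ1
  have hQ0 := pow_ne_zero 2 hκ0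
  have hr' := Finset.mem_Icc.1 hr5
  set Q := (q ^ 121) ^ 2 with hQd
  set J := qPoch Q Q with hJ
  set c : ℤ → ℂ := fun n => (-1) ^ n * q ^ (n * (3 * n + 1) + 2 * a * n) with hc
  obtain ⟨hH, hHs⟩ := lambert_analyticAt (z := 1) (c := fun n => if n = 0 then 0 else c n) ht1 ht0
    one_ne_zero (Summable.of_nonneg_of_le (fun _ => norm_nonneg _) (fun n => by
      split_ifs
      · rw [zero_mul, norm_zero]; exact norm_nonneg _
      · exact le_rfl) (summable_rankLambertSum_coeff hq1 h0 a))
    (fun n hn => by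
      by_cases h : n = 0
      · simp [h]
      · exact absurd hn (zpow_ne_one_of_norm_lt ht1 (neg_ne_zero.2 h)))
  set H : ℂ → ℂ := fun u => ∑' n, (if n = 0 then 0 else c n) / (1 - u * (q ^ 22) ^ n) with hHd
  have hH1 : H 1 = rankBilateral a q := by
    refine tsum_congr fun n => ?_
    by_cases h : n = 0
    · simp [h]
    · rw [if_neg h, if_neg h, one_mul, ← zpow_natCast, ← zpow_mul]
      rfl
  have he : ∀ u n, (if n = 0 then 0 else c n) / (1 - u * (q ^ 22) ^ n)
      = if n = 0 then 0 else c n / (1 - u * (q ^ 22) ^ n) := by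
    intro u n; split_ifs <;> simp
  have hS : ∀ᶠ y in 𝓝 (1 : ℂ), Summable (fun n => c n / (1 - y * (q ^ 22) ^ n)) ∧
      rankLambertSum a q y = 1 / (1 - y) + H y := by
    filter_upwards [hHs] with u hu
    simp_rw [he] at hu
    have hu' : Summable fun n => c n / (1 - u * (q ^ 22) ^ n) := by
      refine (summable_congr_cofinite ?_).1 hu
      filter_upwards [(Set.finite_singleton (0 : ℤ)).compl_mem_cofinite] with n hn
      rw [if_neg (by simpa using hn)]
    refine ⟨hu', ?_⟩
    have := hu'.tsum_eq_add_tsum_ite 0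
    simp only [hHd, he]
    rw [rankLambertSum, this]
    simp [hc]
  have hcont : ∀ k : ℤ, ¬ (11 : ℤ) ∣ k → ContinuousAt (fun y => thetaQ Q (y * (q ^ 22) ^ k)) 1 :=
    fun k _ => continuousAt_comp_mul_const
      (analyticAt_thetaQ hQ (mul_ne_zero one_ne_zero (zpow_ne_zero _ ht0)))
  have hval : ∀ k : ℤ, ¬ (11 : ℤ) ∣ k → thetaQ Q (1 * (q ^ 22) ^ k) ≠ 0 := fun k hk => by
    rw [one_mul]; exact theta11_ne_zero hq1 h0 hk
  have hev : ∀ k : ℤ, ¬ (11 : ℤ) ∣ k → ∀ᶠ y in 𝓝 (1 : ℂ), thetaQ Q (y * (q ^ 22) ^ k) ≠ 0 :=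
    fun k hk => (hcont k hk).eventually_ne (hval k hk)
  have hev0 : ∀ᶠ y in 𝓝[≠] (1 : ℂ), thetaQ Q (y * (q ^ 22) ^ (0 : ℤ)) ≠ 0 := by
    have h1 : ∀ᶠ y in 𝓝[≠] (1 : ℂ), thetaReg Q y ≠ 0 := nhdsWithin_le_nhds
      ((differentiableAt_thetaReg hQ one_ne_zero).continuousAt.eventually_ne
        (thetaReg_one_ne_zero hQ))
    filter_upwards [h1, self_mem_nhdsWithin] with y hy hne
    rw [zpow_zero, mul_one, thetaQ_eq hQ]
    exact mul_ne_zero (sub_ne_zero.2 (Ne.symm hne)) hy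
  have hev' : ∀ᶠ y in 𝓝[≠] (1 : ℂ), ∀ j ∈ Finset.Icc (-5 : ℤ) 5,
      thetaQ Q (y * (q ^ 22) ^ (r + j)) ≠ 0 := by
    refine (Finset.eventually_all _).2 fun j hj => ?_
    rw [Finset.mem_Icc] at hj
    by_cases h : r + j = 0
    · rw [h]; exact hev0
    · exact nhdsWithin_le_nhds (hev _ (by lia))
  have hy0 : ∀ᶠ y in 𝓝[≠] (1 : ℂ), y ≠ 0 := nhdsWithin_le_nhds (isOpen_ne.mem_nhds one_ne_zero)
  set T : ℂ → ℤ → ℂ := fun y j => (-1) ^ j * q ^ (3 * j ^ 2 - 33 * j) *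
          (theta11 q j * theta11 q (2 * j)) /
          (thetaQ Q (y * (q ^ 22) ^ (r + j)) * thetaQ Q (y * (q ^ 22) ^ r) *
            thetaQ Q (y * (q ^ 22) ^ (r - j))) with hT
  have hident : ∀ᶠ y in 𝓝[≠] (1 : ℂ), q ^ 10 * J * H y =
      q ^ (3 * r * (11 - r)) * (pentagonalSeries q * appell (q ^ 121) (y * (q ^ 22) ^ r) 1 +
        q ^ 10 * J ^ 3 * ∑ j ∈ (Finset.Icc (1 : ℤ) 5).erase r, T y j) +
      q ^ 10 * J * (J ^ 2 * (thetaQ Q ((q ^ 22) ^ r) * thetaQ Q ((q ^ 22) ^ (2 * r))) /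
        (thetaQ Q (y * (q ^ 22) ^ (2 * r)) * thetaQ Q (y * (q ^ 22) ^ r) * thetaQ Q y)
          - 1 / (1 - y)) := by
    filter_upwards [hev', hy0, nhdsWithin_le_nhds hS] with y h1 h2 ⟨h3, h4⟩
    have h5 := rankLambertSum_dissection hq h0 h2 hr har (fun j hj n hn => h1 j hj
      ((thetaQ_eq_zero_iff hQ hQ0 (mul_ne_zero h2 (zpow_ne_zero _ ht0))).2 ⟨n, hn⟩)) h3
    rw [h4, ← Finset.add_sum_erase _ _ hr5] at h5
    have e1 : (-1 : ℂ) ^ r = 1 := hr.neg_one_zpow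
    have e2 : q ^ (3 * r * (11 - r)) * q ^ (3 * r ^ 2 - 33 * r) = 1 := by
      rw [← zpow_add₀ h0, show 3 * r * (11 - r) + (3 * r ^ 2 - 33 * r) = 0 by ring, zpow_zero]
    rw [e1, sub_self, zpow_zero, mul_one, ← two_mul r] at h5
    have e3 : theta11 q r = thetaQ Q ((q ^ 22) ^ r) := rfl
    have e4 : theta11 q (2 * r) = thetaQ Q ((q ^ 22) ^ (2 * r)) := rfl
    rw [e3, e4] at h5
    rw [← hQd, ← hJ] at h5
    linear_combination h5 + q ^ 10 * J ^ 3 * (thetaQ Q ((q ^ 22) ^ r) *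
      thetaQ Q ((q ^ 22) ^ (2 * r))) / (thetaQ Q (y * (q ^ 22) ^ (2 * r)) *
        thetaQ Q (y * (q ^ 22) ^ r) * thetaQ Q y) * e2
  have hl : Tendsto (fun y => q ^ 10 * J * H y) (𝓝[≠] 1) (𝓝 (q ^ 10 * J * H 1)) :=
    (hH.continuousAt.tendsto.mono_left nhdsWithin_le_nhds).const_mul _
  have d1 : ¬ (11 : ℤ) ∣ r := by lia
  have d2 : ¬ (11 : ℤ) ∣ 2 * r := by lia
  have hA : Tendsto (fun y => appell (q ^ 121) (y * (q ^ 22) ^ r) 1) (𝓝[≠] 1)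
      (𝓝 (appell (q ^ 121) (1 * (q ^ 22) ^ r) 1)) := by
    have : ContinuousAt (fun y => appell (q ^ 121) (y * (q ^ 22) ^ r) 1) 1 :=
      continuousAt_comp_mul_const (f := fun u => appell (q ^ 121) u 1)
        (analyticAt_appell hκ1 hκ0 one_ne_zero
        (mul_ne_zero one_ne_zero (zpow_ne_zero _ ht0))
        (by rw [one_mul]; exact zpow_ne_base hq1 h0 d1))
    exact this.tendsto.mono_left nhdsWithin_le_nhds
  have hTl : ∀ j ∈ (Finset.Icc (1 : ℤ) 5).erase r, Tendsto (fun y => T y j) (𝓝[≠] 1) (𝓝 (T 1 j)) :=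
      by
    intro j hj
    rw [Finset.mem_erase, Finset.mem_Icc] at hj
    have k1 : ¬ (11 : ℤ) ∣ r + j := by lia
    have k2 : ¬ (11 : ℤ) ∣ r - j := by lia
    have : ContinuousAt (fun y => T y j) 1 :=
      continuousAt_const.div (((hcont _ k1).mul (hcont _ d1)).mul (hcont _ k2))
        (mul_ne_zero (mul_ne_zero (hval _ k1) (hval _ d1)) (hval _ k2))
    exact this.tendsto.mono_left nhdsWithin_le_nhds
  have hR := ((((hA.const_mul (pentagonalSeries q)).add
    ((tendsto_finsetSum _ hTl).const_mul (q ^ 10 * J ^ 3))).const_mul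
      (q ^ (3 * r * (11 - r)))).add ((tendsto_theta_quotient hQ (zpow_ne_zero r ht0)
        (zpow_ne_zero (2 * r) ht0) (theta11_ne_zero hq1 h0 d1)
        (theta11_ne_zero hq1 h0 d2)).const_mul (q ^ 10 * J)))
  have := tendsto_nhds_unique (hl.congr' hident) hR
  rw [hH1] at this
  rw [this]
  simp only [hT, one_mul]
  rfl

/-- Weierstrass' three-term relation for the theta function. -/
theorem thetaQ_three_term {Q u v z : ℂ} (hQ : ‖Q‖ < 1) (h0 : Q ≠ 0) (hu : u ≠ 0) (hv : v ≠ 0)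
    (hz : z ≠ 0) (hz1 : thetaQ Q z ≠ 0) (hvv : thetaQ Q (v ^ 2) ≠ 0)
    (hzv : thetaQ Q (z * v) ≠ 0) (hzv' : thetaQ Q (z / v) ≠ 0) :
    z * (thetaQ Q (u * z) * thetaQ Q (u / z)) * thetaQ Q v ^ 2 =
      z * (thetaQ Q (v * z) * thetaQ Q (v / z)) * thetaQ Q u ^ 2 +
        v * (thetaQ Q (u * v) * thetaQ Q (u / v)) * thetaQ Q z ^ 2 := by
  set N : ℂ → ℂ := fun u => z * (thetaQ Q (u * z) * thetaQ Q (u / z)) * thetaQ Q v ^ 2 -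
    z * (thetaQ Q (v * z) * thetaQ Q (v / z)) * thetaQ Q u ^ 2 with hN
  set P : ℂ → ℂ := fun u => thetaQ Q (u * v) * thetaQ Q (u / v) with hP
  have han : ∀ c u : ℂ, c ≠ 0 → u ≠ 0 → AnalyticAt ℂ (fun w => thetaQ Q (w * c)) u := by
    intro c u hc hu
    exact AnalyticAt.fun_comp (analyticAt_thetaQ hQ (mul_ne_zero hu hc))
      (analyticAt_id.mul analyticAt_const)
  have hanR : ∀ c u : ℂ, c ≠ 0 → u ≠ 0 → AnalyticAt ℂ (fun w => thetaReg Q (w * c)) u := by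
    intro c u hc hu
    exact AnalyticAt.fun_comp (analyticAt_thetaReg hQ (mul_ne_zero hu hc))
      (analyticAt_id.mul analyticAt_const)
  have hNa : ∀ u ≠ 0, AnalyticAt ℂ N u := by
    intro u hu
    have h1 := han z u hz hu
    have h2 := han z⁻¹ u (inv_ne_zero hz) hu
    simp only [hN, div_eq_mul_inv]
    exact ((analyticAt_const.mul (h1.mul h2)).mul analyticAt_const).sub
      (analyticAt_const.mul ((analyticAt_thetaQ hQ hu).pow 2))
  have hPa : ∀ u ≠ 0, AnalyticAt ℂ P u := by
    intro u hu
    have h1 := han v u hv hu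
    have h2 := han v⁻¹ u (inv_ne_zero hv) hu
    simp only [hP, div_eq_mul_inv]
    exact h1.mul h2
  have hshift : ∀ c u : ℂ, c ≠ 0 → u ≠ 0 → thetaQ Q (Q * u * c) * thetaQ Q (Q * u / c) =
      thetaQ Q (u * c) * thetaQ Q (u / c) / u ^ 2 := by
    intro c u hc hu
    rw [mul_assoc, mul_div_assoc, thetaQ_mul hQ h0 (mul_ne_zero hu hc),
      thetaQ_mul hQ h0 (div_ne_zero hu hc)]
    field_simp
  have hper : ∀ u ≠ 0, N (Q * u) / P (Q * u) = N u / P u := by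
    intro u hu
    have h1 : N (Q * u) = N u / u ^ 2 := by
      simp only [hN]
      rw [hshift z u hz hu, thetaQ_mul hQ h0 hu]
      field_simp
    have h2 : P (Q * u) = P u / u ^ 2 := hshift v u hv hu
    rw [h1, h2, div_div_div_cancel_right₀ (pow_ne_zero 2 hu)]
  have hR := thetaReg_one_ne_zero hQ
  have hinv : thetaQ Q (v⁻¹ / z) = thetaQ Q (v * z) * -(v * z)⁻¹ := by
    rw [show v⁻¹ / z = (v * z)⁻¹ by field_simp, thetaQ_inv hQ (mul_ne_zero hv hz)]
    ring
  have hinv' : thetaQ Q (v⁻¹ * z) = thetaQ Q (v / z) * -(z / v) := by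
    rw [show v⁻¹ * z = (v / z)⁻¹ by field_simp, thetaQ_inv hQ (div_ne_zero hv hz)]
    field_simp
  have rem_self : RemovableAt (fun w => N w / P w) v := by
    have hN0 : N v = 0 := by simp [hN]
    have h1 := han v v hv hv
    have h2 := hanR v⁻¹ v (inv_ne_zero hv) hv
    have h3 : AnalyticAt ℂ (fun w => -v / (thetaQ Q (w * v) * thetaReg Q (w * v⁻¹))) v := by
      refine analyticAt_const.div (h1.mul h2) (mul_ne_zero ?_ ?_)
      · rwa [← sq]
      · rwa [mul_inv_cancel₀ hv]
    refine ((removableAt_div_of_zero (hNa v hv) hN0).mul h3.removableAt).congr (Eventually.of_forall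
      fun w => ?_)
    have e : thetaQ Q (w / v) = -((w - v) / v) * thetaReg Q (w * v⁻¹) := by
      rw [thetaQ_eq hQ, ← div_eq_mul_inv]
      congr 1
      field_simp
      ring
    simp only [hP]
    rw [e, div_mul_div_comm, show thetaQ Q (w * v) * (-((w - v) / v) * thetaReg Q (w * v⁻¹)) =
      ((w - v) * (thetaQ Q (w * v) * thetaReg Q (w * v⁻¹))) / (-v) by field_simp]
    rw [div_div_eq_mul_div]
  have rem_inv : RemovableAt (fun w => N w / P w) v⁻¹ := by
    have hvi := inv_ne_zero hv
    have hN0 : N v⁻¹ = 0 := by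
      simp only [hN]
      rw [hinv, hinv', thetaQ_inv hQ hv]
      field_simp
      ring
    have h1 := han v⁻¹ v⁻¹ hvi hvi
    have h2 := hanR v v⁻¹ hv hvi
    have h3 : AnalyticAt ℂ (fun w => -v⁻¹ / (thetaQ Q (w * v⁻¹) * thetaReg Q (w * v))) v⁻¹ := by
      refine analyticAt_const.div (h1.mul h2) (mul_ne_zero ?_ ?_)
      · rw [← mul_inv, ← sq, thetaQ_inv hQ (pow_ne_zero 2 hv)]
        exact div_ne_zero (neg_ne_zero.2 hvv) (pow_ne_zero 2 hv)
      · rwa [inv_mul_cancel₀ hv]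
    refine ((removableAt_div_of_zero (hNa _ hvi) hN0).mul h3.removableAt).congr
      (Eventually.of_forall fun w => ?_)
    have e : thetaQ Q (w * v) = -((w - v⁻¹) * v) * thetaReg Q (w * v) := by
      rw [thetaQ_eq hQ]
      congr 1
      field_simp
      ring
    simp only [hP]
    rw [e, div_mul_div_comm, div_eq_mul_inv w v, show -((w - v⁻¹) * v) * thetaReg Q (w * v) *
      thetaQ Q (w * v⁻¹) =
      ((w - v⁻¹) * (thetaQ Q (w * v⁻¹) * thetaReg Q (w * v))) / (-v⁻¹) by field_simp]
    rw [div_div_eq_mul_div]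
  have rem_shift : ∀ (n : ℤ) (a : ℂ), a ≠ 0 → RemovableAt (fun w => N w / P w) a →
      RemovableAt (fun w => N w / P w) (a * Q ^ n) := by
    intro n a ha h
    have hQn : Q ^ (-n) ≠ 0 := zpow_ne_zero _ h0
    have h' : RemovableAt (fun w => N w / P w) (a * Q ^ n * Q ^ (-n)) := by
      rwa [mul_assoc, ← zpow_add₀ h0, add_neg_cancel, zpow_zero, mul_one]
    refine (h'.comp_mul_const hQn).congr ?_
    have : ∀ᶠ w in 𝓝[≠] (a * Q ^ n), w ≠ 0 :=
      nhdsWithin_le_nhds (isOpen_ne.mem_nhds (mul_ne_zero ha (zpow_ne_zero _ h0)))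
    filter_upwards [this] with w hw
    rw [mul_comm w]
    exact periodic_zpow (F := fun w => N w / P w) h0 hper (-n) hw
  have hrem : ∀ w ≠ 0, RemovableAt (fun w => N w / P w) w := by
    intro w hw
    by_cases hPw : P w = 0
    · rcases mul_eq_zero.1 hPw with h | h
      · obtain ⟨n, hn⟩ := (thetaQ_eq_zero_iff hQ h0 (mul_ne_zero hw hv)).1 h
        have : w = v⁻¹ * Q ^ n := by rw [← hn]; field_simp
        rw [this]
        exact rem_shift n _ (inv_ne_zero hv) rem_inv
      · obtain ⟨n, hn⟩ := (thetaQ_eq_zero_iff hQ h0 (div_ne_zero hw hv)).1 h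
        have : w = v * Q ^ n := by rw [← hn]; field_simp
        rw [this]
        exact rem_shift n _ hv rem_self
    · exact ((hNa w hw).div (hPa w hw) hPw).removableAt
  obtain ⟨C, hC⟩ := exists_const_of_periodic_removable hQ h0 hrem hper
  have hPz : P z ≠ 0 := mul_ne_zero hzv hzv'
  have hCz : C = v * thetaQ Q z ^ 2 := by
    have h1 : Tendsto (fun w => N w / P w) (𝓝[≠] z) (𝓝 (N z / P z)) :=
      ((hNa z hz).div (hPa z hz) hPz).continuousAt.tendsto.mono_left nhdsWithin_le_nhds
    have h2 := tendsto_nhds_unique (h1.congr' (hC z hz)) tendsto_const_nhds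
    rw [← h2, div_eq_iff hPz]
    simp only [hN, hP, div_self hz, thetaQ_one hQ]
    rw [show v / z = (z / v)⁻¹ by field_simp, thetaQ_inv hQ (div_ne_zero hz hv), mul_comm v z]
    field_simp
    ring
  have hC0 : C ≠ 0 := hCz ▸ mul_ne_zero hv (pow_ne_zero 2 hz1)
  have hev : N =ᶠ[𝓝[≠] u] fun w => C * P w := by
    filter_upwards [hC u hu] with w hw
    have hPw : P w ≠ 0 := by
      intro h
      rw [h, div_zero] at hw
      exact hC0 hw.symm
    rwa [div_eq_iff hPw] at hw
  have l1 : Tendsto N (𝓝[≠] u) (𝓝 (N u)) :=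
    (hNa u hu).continuousAt.tendsto.mono_left nhdsWithin_le_nhds
  have l2 : Tendsto (fun w => C * P w) (𝓝[≠] u) (𝓝 (C * P u)) :=
    ((hPa u hu).continuousAt.tendsto.mono_left nhdsWithin_le_nhds).const_mul C
  have := tendsto_nhds_unique (l1.congr' hev) l2
  rw [hCz] at this
  simp only [hN, hP] at this
  linear_combination this

lemma hasDerivAt_thetaQ_one {Q : ℂ} (hQ : ‖Q‖ < 1) :
    HasDerivAt (thetaQ Q) (-qPoch Q Q ^ 2) 1 := by
  have h1 : HasDerivAt (fun x : ℂ => 1 - x) (-1) 1 := (hasDerivAt_id (1 : ℂ)).const_sub 1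
  have h2 := h1.mul (differentiableAt_thetaReg hQ one_ne_zero).hasDerivAt
  have h3 : thetaQ Q = (fun x : ℂ => 1 - x) * thetaReg Q := funext fun x => thetaQ_eq hQ x
  rw [h3]
  refine h2.congr_deriv ?_
  rw [thetaReg_one]
  ring

/-- The addition formula for the logarithmic derivative of the theta function. -/
theorem thetaLog_add_formula {Q u v : ℂ} (hQ : ‖Q‖ < 1) (h0 : Q ≠ 0) (hu : u ≠ 0) (hv : v ≠ 0)
    (hv1 : thetaQ Q v ≠ 0) (hvv : thetaQ Q (v ^ 2) ≠ 0) (huv : thetaQ Q (u * v) ≠ 0)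
    (huv' : thetaQ Q (u / v) ≠ 0) :
    thetaLog Q (u * v) - thetaLog Q (u / v) - 2 * thetaLog Q v + 1 =
      qPoch Q Q ^ 2 * (thetaQ Q u ^ 2 * thetaQ Q (v ^ 2) /
        (thetaQ Q v ^ 2 * thetaQ Q (u * v) * thetaQ Q (u / v))) := by
  have hd : ∀ x : ℂ, x ≠ 0 → HasDerivAt (thetaQ Q) (deriv (thetaQ Q) x) x := fun x hx =>
    (differentiableAt_thetaQ hQ hx).hasDerivAt
  have hmul : ∀ c : ℂ, c ≠ 0 →
      HasDerivAt (fun z => thetaQ Q (c * z)) (deriv (thetaQ Q) (c * v) * c) v := by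
    intro c hc
    have h2 : HasDerivAt (fun z : ℂ => c * z) c v := by
      simpa using (hasDerivAt_id v).const_mul c
    exact (hd (c * v) (mul_ne_zero hc hv)).comp v h2
  have hdiv : ∀ c : ℂ, HasDerivAt (fun z : ℂ => c / z) (-(c / v ^ 2)) v := by
    intro c
    have := (hasDerivAt_inv hv).const_mul c
    simp only [← div_eq_mul_inv] at this
    refine this.congr_deriv ?_
    rw [mul_neg, div_eq_mul_inv]
  have hA := (((hasDerivAt_id v).mul ((hmul u hu).mul
    ((hd (u / v) (div_ne_zero hu hv)).comp v (hdiv u)))).mul_const (thetaQ Q v ^ 2))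
  have hone : HasDerivAt (thetaQ Q) (-qPoch Q Q ^ 2) (v / v) := by
    rw [div_self hv]; exact hasDerivAt_thetaQ_one hQ
  have hB := (((hasDerivAt_id v).mul ((hmul v hv).mul (hone.comp v (hdiv v)))).mul_const
    (thetaQ Q u ^ 2)).add (((hd v hv).pow 2).const_mul (v * (thetaQ Q (u * v) * thetaQ Q (u / v))))
  have hvv' : thetaQ Q (v * v) ≠ 0 := by rwa [← sq]
  have e1 : ∀ᶠ z in 𝓝 v, thetaQ Q z ≠ 0 := (hd v hv).continuousAt.eventually_ne hv1
  have e2 : ∀ᶠ z in 𝓝 v, thetaQ Q (v * z) ≠ 0 := (hmul v hv).continuousAt.eventually_ne hvv'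
  have e3 : ∀ᶠ z in 𝓝 v, thetaReg Q (z / v) ≠ 0 := by
    have h1 : ContinuousAt (thetaReg Q) (v / v) := by
      rw [div_self hv]; exact (differentiableAt_thetaReg hQ one_ne_zero).continuousAt
    have h2 : ContinuousAt (fun z : ℂ => z / v) v := continuousAt_id.div_const v
    refine (h1.comp (f := fun z : ℂ => z / v) h2).eventually_ne ?_
    rw [Function.comp_apply, div_self hv]
    exact thetaReg_one_ne_zero hQ
  have e4 : ∀ᶠ z in 𝓝 v, z ≠ 0 := isOpen_ne.mem_nhds hv
  have hev := hA.congr_of_eventuallyEq (f₁ := _) (by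
    filter_upwards [e1, e2, e3, e4] with z h1 h2 h3 h4
    show z * (thetaQ Q (v * z) * thetaQ Q (v / z)) * thetaQ Q u ^ 2 +
      v * (thetaQ Q (u * v) * thetaQ Q (u / v)) * thetaQ Q z ^ 2 =
      z * (thetaQ Q (u * z) * thetaQ Q (u / z)) * thetaQ Q v ^ 2
    by_cases hzv : z = v
    · rw [hzv, div_self hv, thetaQ_one hQ]; ring
    · refine (thetaQ_three_term hQ h0 hu hv h4 h1 hvv (by rwa [mul_comm]) ?_).symm
      rw [thetaQ_eq hQ]
      refine mul_ne_zero (sub_ne_zero.2 fun h => hzv ?_) h3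
      rw [eq_div_iff hv, one_mul] at h
      exact h.symm)
  have key := hB.unique hev
  simp only [Pi.mul_apply, Function.comp_apply, id, div_self hv, thetaQ_one hQ] at key
  rw [← sq] at key
  simp only [thetaLog, Nat.cast_ofNat] at key ⊢
  generalize deriv (thetaQ Q) (u * v) = d1 at *
  generalize deriv (thetaQ Q) (u / v) = d2 at *
  generalize thetaQ Q (u * v) = c1 at *
  generalize thetaQ Q (u / v) = c2 at *
  field_simp
  field_simp at key
  linear_combination -key

/-- The multiplicative form `vθ(uv)θ(u/v)/(θ(u)θ(v))²` of the difference `℘(v) - ℘(u)`. -/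
noncomputable def weierDiff (Q u v : ℂ) : ℂ :=
  v * (thetaQ Q (u * v) * thetaQ Q (u / v)) / (thetaQ Q u ^ 2 * thetaQ Q v ^ 2)

lemma weierDiff_swap {Q u v : ℂ} (hQ : ‖Q‖ < 1) (hu : u ≠ 0) (hv : v ≠ 0) :
    weierDiff Q v u = -weierDiff Q u v := by
  rw [weierDiff, weierDiff, show v / u = (u / v)⁻¹ by field_simp,
    thetaQ_inv hQ (div_ne_zero hu hv), mul_comm v u]
  field_simp

lemma weierDiff_add {Q u v z : ℂ} (hQ : ‖Q‖ < 1) (h0 : Q ≠ 0) (hu : u ≠ 0) (hv : v ≠ 0)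
    (hz : z ≠ 0) (hu1 : thetaQ Q u ≠ 0) (hv1 : thetaQ Q v ≠ 0) (hz1 : thetaQ Q z ≠ 0)
    (hvv : thetaQ Q (v ^ 2) ≠ 0) (hzv : thetaQ Q (z * v) ≠ 0) (hzv' : thetaQ Q (z / v) ≠ 0) :
    weierDiff Q u v + weierDiff Q v z = weierDiff Q u z := by
  have h := thetaQ_three_term hQ h0 hu hv hz hz1 hvv hzv hzv'
  simp only [weierDiff]
  generalize thetaQ Q (u / v) = c1 at *
  generalize thetaQ Q (u / z) = c2 at *
  generalize thetaQ Q (v / z) = c3 at *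
  generalize thetaQ Q (u * z) = c4 at *
  generalize thetaQ Q (v * z) = c5 at *
  generalize thetaQ Q (u * v) = c6 at *
  field_simp
  linear_combination -h

lemma thetaQ_half_periods {κ : ℂ} (hκ : ‖κ‖ < 1) (h0 : κ ≠ 0) :
    thetaQ (κ ^ 2) (-1) * thetaQ (κ ^ 2) κ * thetaQ (κ ^ 2) (-κ) = 2 := by
  have hQ := norm_sq_lt_one hκ
  have hR := thetaReg_one_ne_zero hQ
  have hc : ∀ (d : ℂ), d ≠ 0 → Tendsto (fun z => thetaQ (κ ^ 2) (d * z)) (𝓝[≠] 1)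
      (𝓝 (thetaQ (κ ^ 2) d)) := by
    intro d hd
    have h1 : ContinuousAt (thetaQ (κ ^ 2)) (d * 1) := by
      rw [mul_one]; exact (differentiableAt_thetaQ hQ hd).continuousAt
    have h2 : ContinuousAt (fun z => thetaQ (κ ^ 2) (d * z)) 1 :=
      h1.comp (f := fun z : ℂ => d * z) (continuousAt_const.mul continuousAt_id)
    simpa using h2.tendsto.mono_left nhdsWithin_le_nhds
  have hreg : ContinuousAt (thetaReg (κ ^ 2)) 1 :=
    (differentiableAt_thetaReg hQ one_ne_zero).continuousAt
  have hreg2 : Tendsto (fun z : ℂ => thetaReg (κ ^ 2) (z ^ 2)) (𝓝[≠] 1)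
      (𝓝 (thetaReg (κ ^ 2) 1)) := by
    have h1 : ContinuousAt (thetaReg (κ ^ 2)) ((1 : ℂ) ^ 2) := by rwa [one_pow]
    have h2 : ContinuousAt (fun z : ℂ => thetaReg (κ ^ 2) (z ^ 2)) 1 :=
      h1.comp (f := fun z : ℂ => z ^ 2) (continuousAt_id.pow 2)
    simpa using h2.tendsto.mono_left nhdsWithin_le_nhds
  have hl := (((hreg.tendsto.mono_left nhdsWithin_le_nhds).mul
    (hc (-1) (neg_ne_zero.2 one_ne_zero))).mul (hc κ h0)).mul (hc (-κ) (neg_ne_zero.2 h0))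
  have hr : Tendsto (fun z : ℂ => (1 + z) * thetaReg (κ ^ 2) (z ^ 2)) (𝓝[≠] 1)
      (𝓝 ((1 + 1) * thetaReg (κ ^ 2) 1)) := by
    refine Tendsto.mul ?_ hreg2
    exact (continuousAt_const.add continuousAt_id).tendsto.mono_left nhdsWithin_le_nhds
  have h := tendsto_nhds_unique (hl.congr' ?_) hr
  · refine mul_right_cancel₀ hR ?_
    linear_combination h
  · have : ∀ᶠ z : ℂ in 𝓝[≠] 1, z ≠ 0 := nhdsWithin_le_nhds (isOpen_ne.mem_nhds one_ne_zero)
    filter_upwards [this, self_mem_nhdsWithin] with z hz hz1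
    have h1 : 1 - z ≠ 0 := sub_ne_zero.2 (Ne.symm hz1)
    have hd := thetaQ_duplication hκ h0 hz
    rw [thetaQ_eq hQ z, thetaQ_eq hQ (z ^ 2)] at hd
    rw [neg_one_mul, neg_mul]
    refine mul_left_cancel₀ h1 ?_
    linear_combination hd

/-- The three values at the half periods satisfy the Weierstrass cubic equation. -/
theorem exists_weierDiff_cubic {κ y : ℂ} (hκ : ‖κ‖ < 1) (h0 : κ ≠ 0) (hy : y ≠ 0)
    (hyy : thetaQ (κ ^ 2) (y ^ 2) ≠ 0) :
    ∃ w₁ w₂ w₃ : ℂ, ((w₁ - w₂) * (w₁ - w₃) * (w₂ - w₃)) ^ 2 = κ ^ 2 / 16 ∧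
      ∀ z ≠ 0, thetaQ (κ ^ 2) z ≠ 0 →
        (weierDiff (κ ^ 2) z y - w₁) * (weierDiff (κ ^ 2) z y - w₂) *
          (weierDiff (κ ^ 2) z y - w₃) =
          -(z ^ 2 * thetaQ (κ ^ 2) (z ^ 2) ^ 2) / (4 * thetaQ (κ ^ 2) z ^ 8) := by
  have hQ := norm_sq_lt_one hκ
  have hQ0 : κ ^ 2 ≠ 0 := pow_ne_zero 2 h0
  have h2 := thetaQ_half_periods hκ h0
  have h2' : thetaQ (κ ^ 2) (-1) * thetaQ (κ ^ 2) κ * thetaQ (κ ^ 2) (-κ) ≠ 0 := by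
    rw [h2]; norm_num
  have hC := right_ne_zero_of_mul h2'
  have hB := right_ne_zero_of_mul (left_ne_zero_of_mul h2')
  have hA := left_ne_zero_of_mul (left_ne_zero_of_mul h2')
  have d1 := thetaQ_duplication hκ h0 hy
  rw [← d1] at hyy
  have y4 := right_ne_zero_of_mul hyy
  have y3 := right_ne_zero_of_mul (left_ne_zero_of_mul hyy)
  have y2 := right_ne_zero_of_mul (left_ne_zero_of_mul (left_ne_zero_of_mul hyy))
  have y1 := left_ne_zero_of_mul (left_ne_zero_of_mul (left_ne_zero_of_mul hyy))
  rw [d1] at hyy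
  have hyi := inv_ne_zero hy
  have d2 := thetaQ_duplication hκ h0 hyi
  have hyyi : thetaQ (κ ^ 2) (y⁻¹ ^ 2) ≠ 0 := by
    rw [inv_pow, thetaQ_inv hQ (pow_ne_zero 2 hy)]
    exact div_ne_zero (neg_ne_zero.2 hyy) (pow_ne_zero 2 hy)
  rw [← d2] at hyyi
  have i4 := right_ne_zero_of_mul hyyi
  have i3 := right_ne_zero_of_mul (left_ne_zero_of_mul hyyi)
  have i2 := right_ne_zero_of_mul (left_ne_zero_of_mul (left_ne_zero_of_mul hyyi))
  have k1 : (-1 : ℂ) ≠ 0 := neg_ne_zero.2 one_ne_zero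
  have k3 : -κ ≠ 0 := neg_ne_zero.2 h0
  have add_half : ∀ h : ℂ, h = -1 ∨ h = κ ∨ h = -κ → ∀ u ≠ 0, thetaQ (κ ^ 2) u ≠ 0 →
      weierDiff (κ ^ 2) u y + weierDiff (κ ^ 2) y h = weierDiff (κ ^ 2) u h := by
    rintro h (rfl | rfl | rfl) u hu hu1
    · exact weierDiff_add hQ hQ0 hu hy k1 hu1 y1 hA hyy (by rwa [neg_one_mul])
        (by rwa [neg_div, one_div])
    · exact weierDiff_add hQ hQ0 hu hy h0 hu1 y1 hB hyy y3 (by rwa [div_eq_mul_inv])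
    · exact weierDiff_add hQ hQ0 hu hy k3 hu1 y1 hC hyy (by rwa [neg_mul])
        (by rwa [neg_div, div_eq_mul_inv])
  refine ⟨-weierDiff (κ ^ 2) y (-1), -weierDiff (κ ^ 2) y κ, -weierDiff (κ ^ 2) y (-κ), ?_, ?_⟩
  · have e12 := add_half κ (by simp) (-1) k1 hA
    have e13 := add_half (-κ) (by simp) (-1) k1 hA
    have e23 := add_half (-κ) (by simp) κ h0 hB
    rw [← neg_eq_iff_eq_neg.2 (weierDiff_swap hQ k1 hy)] at e12 e13
    rw [← neg_eq_iff_eq_neg.2 (weierDiff_swap hQ h0 hy)] at e23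
    have v12 : weierDiff (κ ^ 2) (-1) κ =
        thetaQ (κ ^ 2) (-κ) ^ 2 / (thetaQ (κ ^ 2) (-1) ^ 2 * thetaQ (κ ^ 2) κ ^ 2) := by
      rw [weierDiff, show -1 / κ = (-κ)⁻¹ by rw [neg_div, one_div, inv_neg], thetaQ_inv hQ k3,
        neg_one_mul]
      field_simp
    have v13 : weierDiff (κ ^ 2) (-1) (-κ) =
        thetaQ (κ ^ 2) κ ^ 2 / (thetaQ (κ ^ 2) (-1) ^ 2 * thetaQ (κ ^ 2) (-κ) ^ 2) := by
      rw [weierDiff, show -1 / -κ = κ⁻¹ by rw [neg_div_neg_eq, one_div], thetaQ_inv hQ h0,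
        neg_one_mul, neg_neg]
      field_simp
    have v23 : weierDiff (κ ^ 2) κ (-κ) =
        -κ * thetaQ (κ ^ 2) (-1) ^ 2 / (thetaQ (κ ^ 2) κ ^ 2 * thetaQ (κ ^ 2) (-κ) ^ 2) := by
      rw [weierDiff, show κ * -κ = κ ^ 2 * -1 by ring, thetaQ_mul hQ hQ0 k1,
        show κ / -κ = -1 by field_simp]
      ring
    rw [show -weierDiff (κ ^ 2) y (-1) - -weierDiff (κ ^ 2) y κ = weierDiff (κ ^ 2) (-1) κ by
        rw [← e12]; ring,
      show -weierDiff (κ ^ 2) y (-1) - -weierDiff (κ ^ 2) y (-κ) = weierDiff (κ ^ 2) (-1) (-κ) by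
        rw [← e13]; ring,
      show -weierDiff (κ ^ 2) y κ - -weierDiff (κ ^ 2) y (-κ) = weierDiff (κ ^ 2) κ (-κ) by
        rw [← e23]; ring, v12, v13, v23]
    have : ∀ A B C : ℂ, A ≠ 0 → B ≠ 0 → C ≠ 0 → A * B * C = 2 →
        (C ^ 2 / (A ^ 2 * B ^ 2) * (B ^ 2 / (A ^ 2 * C ^ 2)) *
          (-κ * A ^ 2 / (B ^ 2 * C ^ 2))) ^ 2 = κ ^ 2 / 16 := by
      intro A B C hA hB hC h
      rw [show C ^ 2 / (A ^ 2 * B ^ 2) * (B ^ 2 / (A ^ 2 * C ^ 2)) *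
          (-κ * A ^ 2 / (B ^ 2 * C ^ 2)) = -κ / (A * B * C) ^ 2 by field_simp, h]
      ring
    exact this _ _ _ hA hB hC h2
  · intro z hz hz1
    rw [sub_neg_eq_add, sub_neg_eq_add, sub_neg_eq_add, add_half _ (by simp) z hz hz1,
      add_half _ (by simp) z hz hz1, add_half _ (by simp) z hz hz1]
    have d := thetaQ_duplication hκ h0 hz
    have s1 : thetaQ (κ ^ 2) (z / κ) = -thetaQ (κ ^ 2) (κ * z) * (z / κ) := by
      have := thetaQ_mul hQ hQ0 (div_ne_zero hz h0)
      rw [show κ ^ 2 * (z / κ) = κ * z by field_simp] at this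
      rw [this]
      field_simp
    have s2 : thetaQ (κ ^ 2) (z / -κ) = thetaQ (κ ^ 2) (-(κ * z)) * (z / κ) := by
      have := thetaQ_mul hQ hQ0 (div_ne_zero hz k3)
      rw [show κ ^ 2 * (z / -κ) = -(κ * z) by field_simp] at this
      rw [this]
      field_simp
    simp only [weierDiff]
    rw [s1, s2, ← d, show z / -1 = -z by ring, show z * -1 = -z by ring,
      show z * -κ = -(κ * z) by ring, mul_comm z κ]
    have : ∀ A B C a b c d : ℂ, A ≠ 0 → B ≠ 0 → C ≠ 0 → A * B * C = 2 → a ≠ 0 →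
        -1 * (b * b) / (a ^ 2 * A ^ 2) * (κ * (c * (-c * (z / κ))) / (a ^ 2 * B ^ 2)) *
          (-κ * (d * (d * (z / κ))) / (a ^ 2 * C ^ 2)) =
        -(z ^ 2 * (a * b * c * d) ^ 2) / (4 * a ^ 8) := by
      intro A B C a b c d hA hB hC h ha
      rw [show (4 : ℂ) = (A * B * C) ^ 2 by rw [h]; norm_num]
      field_simp
    exact this _ _ _ _ _ _ _ hA hB hC h2 hz1

/-- The theta values of `theta11`, normalised so that they depend on the index only up to sign and
reflection modulo `11`. -/
noncomputable def thetaNorm (q : ℂ) (k : ℤ) : ℂ := q ^ ((k - 1) * (k - 10)) * theta11 q k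

lemma theta11_eq_thetaNorm {q : ℂ} (h0 : q ≠ 0) (k : ℤ) :
    theta11 q k = q ^ (-((k - 1) * (k - 10))) * thetaNorm q k := by
  rw [thetaNorm, ← mul_assoc, ← zpow_add₀ h0, neg_add_cancel, zpow_zero, one_mul]

lemma thetaNorm_ne_zero {q : ℂ} (hq : ‖q‖ < 1) (h0 : q ≠ 0) {k : ℤ} (hk : ¬ (11 : ℤ) ∣ k) :
    thetaNorm q k ≠ 0 :=
  mul_ne_zero (zpow_ne_zero _ h0) (theta11_ne_zero hq h0 hk)

lemma zpow_twentytwo (q : ℂ) (k : ℤ) : (q ^ 22) ^ k = q ^ (22 * k) := by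
  rw [← zpow_natCast, ← zpow_mul]
  rfl

lemma thetaNorm_neg {q : ℂ} (hq : ‖q‖ < 1) (h0 : q ≠ 0) (k : ℤ) :
    thetaNorm q (-k) = -thetaNorm q k := by
  have hQ := norm_sq_lt_one (norm_pow_lt_one hq (n := 121) (by norm_num))
  have ht : q ^ 22 ≠ 0 := pow_ne_zero _ h0
  rw [thetaNorm, thetaNorm, theta11, zpow_neg, thetaQ_inv hQ (zpow_ne_zero _ ht)]
  have e : q ^ ((-k - 1) * (-k - 10)) = q ^ ((k - 1) * (k - 10)) * q ^ (22 * k) := by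
    rw [← zpow_add₀ h0]; ring_nf
  have := zpow_ne_zero (22 * k) h0
  rw [e, theta11, zpow_twentytwo]
  field_simp

lemma thetaNorm_eleven_sub {q : ℂ} (h0 : q ≠ 0) (k : ℤ) :
    thetaNorm q (11 - k) = thetaNorm q k := by
  have ht : q ^ 22 ≠ 0 := pow_ne_zero _ h0
  have hQ0 : (q ^ 121) ^ 2 ≠ 0 := pow_ne_zero _ (pow_ne_zero _ h0)
  have e : (q ^ 22) ^ (11 - k) = (q ^ 121) ^ 2 / (q ^ 22) ^ k := by
    rw [zpow_sub₀ ht]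
    congr 1
    rw [← pow_mul]
    exact (pow_mul q 22 11).symm
  rw [thetaNorm, thetaNorm, theta11, e, thetaQ_div hQ0, theta11]
  congr 2
  ring

/-- The Weierstrass relation for the normalised theta values. -/
lemma thetaNorm_three_term {q : ℂ} (hq : ‖q‖ < 1) (h0 : q ≠ 0) {i j k : ℤ} (hk : ¬ (11 : ℤ) ∣ k)
    (hj : ¬ (11 : ℤ) ∣ 2 * j) (hkj : ¬ (11 : ℤ) ∣ k + j) (hkj' : ¬ (11 : ℤ) ∣ k - j) :
    thetaNorm q (i + k) * thetaNorm q (i - k) * thetaNorm q j ^ 2 =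
      thetaNorm q (j + k) * thetaNorm q (j - k) * thetaNorm q i ^ 2 +
        thetaNorm q (i + j) * thetaNorm q (i - j) * thetaNorm q k ^ 2 := by
  have hκ := norm_pow_lt_one hq (n := 121) (by norm_num)
  have hQ := norm_sq_lt_one hκ
  have hQ0 : (q ^ 121) ^ 2 ≠ 0 := pow_ne_zero _ (pow_ne_zero _ h0)
  have ht : q ^ 22 ≠ 0 := pow_ne_zero _ h0
  have hz := fun n : ℤ => zpow_ne_zero n ht
  have h := thetaQ_three_term hQ hQ0 (hz i) (hz j) (hz k) (theta11_ne_zero hq h0 hk)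
    (by
      have := theta11_ne_zero hq h0 hj
      rwa [theta11, mul_comm, zpow_mul] at this)
    (by rw [← zpow_add₀ ht]; exact theta11_ne_zero hq h0 hkj)
    (by rw [← zpow_sub₀ ht]; exact theta11_ne_zero hq h0 hkj')
  simp only [← zpow_add₀ ht, ← zpow_sub₀ ht, ← theta11.eq_def] at h
  simp only [theta11_eq_thetaNorm h0, zpow_twentytwo] at h
  have key : ∀ a b c : ℤ, q ^ (22 * b) * (q ^ (-((a + b - 1) * (a + b - 10))) *
      thetaNorm q (a + b) * (q ^ (-((a - b - 1) * (a - b - 10))) * thetaNorm q (a - b))) *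
      (q ^ (-((c - 1) * (c - 10))) * thetaNorm q c) ^ 2 =
      q ^ (-2 * (a ^ 2 + b ^ 2 + c ^ 2) + 22 * (a + b + c) - 40) *
        (thetaNorm q (a + b) * thetaNorm q (a - b) * thetaNorm q c ^ 2) := by
    intro a b c
    have : q ^ (-2 * (a ^ 2 + b ^ 2 + c ^ 2) + 22 * (a + b + c) - 40) =
        q ^ (22 * b) * q ^ (-((a + b - 1) * (a + b - 10))) * q ^ (-((a - b - 1) * (a - b - 10))) *
        (q ^ (-((c - 1) * (c - 10))) * q ^ (-((c - 1) * (c - 10)))) := by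
      simp only [← zpow_add₀ h0]
      congr 1
      ring
    rw [this]
    ring
  rw [key, key, key] at h
  rw [show i ^ 2 + k ^ 2 + j ^ 2 = i ^ 2 + j ^ 2 + k ^ 2 by ring,
    show j ^ 2 + k ^ 2 + i ^ 2 = i ^ 2 + j ^ 2 + k ^ 2 by ring,
    show i + k + j = i + j + k by ring, show j + k + i = i + j + k by ring, ← mul_add] at h
  exact mul_left_cancel₀ (zpow_ne_zero _ h0) h

lemma weierDiff_eq_thetaNorm {q : ℂ} (h0 : q ≠ 0) (i j : ℤ) :
    weierDiff ((q ^ 121) ^ 2) ((q ^ 22) ^ i) ((q ^ 22) ^ j) =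
      q ^ 20 * (thetaNorm q (i + j) * thetaNorm q (i - j) /
        (thetaNorm q i ^ 2 * thetaNorm q j ^ 2)) := by
  have ht : q ^ 22 ≠ 0 := pow_ne_zero _ h0
  rw [weierDiff, ← zpow_add₀ ht, ← zpow_sub₀ ht]
  simp only [← theta11.eq_def]
  simp only [theta11_eq_thetaNorm h0, zpow_twentytwo]
  have : q ^ 20 * ((q ^ (-((i - 1) * (i - 10)))) ^ 2 * (q ^ (-((j - 1) * (j - 10)))) ^ 2) =
      q ^ (22 * j) * q ^ (-((i + j - 1) * (i + j - 10))) *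
        q ^ (-((i - j - 1) * (i - j - 10))) := by
    simp only [← zpow_natCast, ← zpow_mul, ← zpow_add₀ h0]
    congr 1
    push_cast
    ring
  have n1 := zpow_ne_zero (-((i - 1) * (i - 10))) h0
  have n2 := zpow_ne_zero (-((j - 1) * (j - 10))) h0
  rw [mul_pow, mul_pow]
  generalize q ^ (-((i - 1) * (i - 10))) = b1 at *
  generalize q ^ (-((j - 1) * (j - 10))) = b2 at *
  rw [show ∀ P A B C D c1 c2 : ℂ, P * (c1 * A * (c2 * B)) / (b1 ^ 2 * C * (b2 ^ 2 * D)) =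
    (P * c1 * c2) / (b1 ^ 2 * b2 ^ 2) * (A * B / (C * D)) by
      intro P A B C D c1 c2; rw [div_mul_div_comm]; ring, ← this]
  field_simp

lemma thetaLog_eq_thetaNorm {q : ℂ} (hq : ‖q‖ < 1) (h0 : q ≠ 0) {c b : ℤ}
    (hb : ¬ (11 : ℤ) ∣ 2 * b) (hcb : ¬ (11 : ℤ) ∣ c + b) (hcb' : ¬ (11 : ℤ) ∣ c - b) :
    thetaLog ((q ^ 121) ^ 2) ((q ^ 22) ^ (c + b)) - thetaLog ((q ^ 121) ^ 2) ((q ^ 22) ^ (c - b)) -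
        2 * thetaLog ((q ^ 121) ^ 2) ((q ^ 22) ^ b) + 1 =
      qPoch ((q ^ 121) ^ 2) ((q ^ 121) ^ 2) ^ 2 * q ^ 10 *
        (thetaNorm q c ^ 2 * thetaNorm q (2 * b) /
          (thetaNorm q b ^ 2 * thetaNorm q (c + b) * thetaNorm q (c - b))) := by
  have hκ := norm_pow_lt_one hq (n := 121) (by norm_num)
  have hQ := norm_sq_lt_one hκ
  have hQ0 : (q ^ 121) ^ 2 ≠ 0 := pow_ne_zero _ (pow_ne_zero _ h0)
  have ht : q ^ 22 ≠ 0 := pow_ne_zero _ h0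
  have hz := fun n : ℤ => zpow_ne_zero n ht
  have hsq : ((q ^ 22) ^ b) ^ 2 = (q ^ 22) ^ (2 * b) := by
    rw [mul_comm, zpow_mul]; rfl
  have hb1 : ¬ (11 : ℤ) ∣ b := fun h => hb (h.mul_left 2)
  have h := thetaLog_add_formula hQ hQ0 (hz c) (hz b) (theta11_ne_zero hq h0 hb1)
    (by rw [hsq]; exact theta11_ne_zero hq h0 hb)
    (by rw [← zpow_add₀ ht]; exact theta11_ne_zero hq h0 hcb)
    (by rw [← zpow_sub₀ ht]; exact theta11_ne_zero hq h0 hcb')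
  rw [hsq, ← zpow_add₀ ht, ← zpow_sub₀ ht] at h
  rw [h, mul_assoc (qPoch _ _ ^ 2)]
  congr 1
  simp only [← theta11.eq_def]
  simp only [theta11_eq_thetaNorm h0]
  have : q ^ 10 * ((q ^ (-((b - 1) * (b - 10)))) ^ 2 * q ^ (-((c + b - 1) * (c + b - 10))) *
        q ^ (-((c - b - 1) * (c - b - 10)))) =
      (q ^ (-((c - 1) * (c - 10)))) ^ 2 * q ^ (-((2 * b - 1) * (2 * b - 10))) := by
    simp only [← zpow_natCast, ← zpow_mul, ← zpow_add₀ h0]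
    congr 1
    push_cast
    ring
  have n1 := zpow_ne_zero (-((b - 1) * (b - 10))) h0
  have n2 := zpow_ne_zero (-((c + b - 1) * (c + b - 10))) h0
  have n3 := zpow_ne_zero (-((c - b - 1) * (c - b - 10))) h0
  generalize q ^ (-((b - 1) * (b - 10))) = b1 at *
  generalize q ^ (-((c + b - 1) * (c + b - 10))) = b2 at *
  generalize q ^ (-((c - b - 1) * (c - b - 10))) = b3 at *
  generalize q ^ (-((c - 1) * (c - 10))) = b4 at *
  generalize q ^ (-((2 * b - 1) * (2 * b - 10))) = b5 at *
  rw [show ∀ A B C D E : ℂ, (b4 * A) ^ 2 * (b5 * B) / ((b1 * C) ^ 2 * (b2 * D) * (b3 * E)) =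
    (b4 ^ 2 * b5) / (b1 ^ 2 * b2 * b3) * (A ^ 2 * B / (C ^ 2 * D * E)) by
      intro A B C D E; rw [div_mul_div_comm]; ring, ← this]
  field_simp

lemma thetaLog_inv {Q x : ℂ} (hQ : ‖Q‖ < 1) (hx : x ≠ 0) (hθ : thetaQ Q x ≠ 0) :
    thetaLog Q x⁻¹ = 1 - thetaLog Q x := by
  have h1 : HasDerivAt (fun z => thetaQ Q z⁻¹) (deriv (thetaQ Q) x⁻¹ * (-(x ^ 2)⁻¹)) x :=
    (differentiableAt_thetaQ hQ (inv_ne_zero hx)).hasDerivAt.comp x (hasDerivAt_inv hx)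
  have h2 : HasDerivAt (fun z => -thetaQ Q z / z)
      ((-deriv (thetaQ Q) x * x - -thetaQ Q x * 1) / x ^ 2) x :=
    (differentiableAt_thetaQ hQ hx).hasDerivAt.neg.div (hasDerivAt_id x) hx
  have h := h1.unique (h2.congr_of_eventuallyEq
    ((eventually_ne_nhds hx).mono fun z hz => thetaQ_inv hQ hz))
  have h3 : deriv (thetaQ Q) x⁻¹ = x * deriv (thetaQ Q) x - thetaQ Q x := by
    field_simp at h
    rw [one_div] at h
    linear_combination -h
  rw [thetaLog, thetaLog, h3, thetaQ_inv hQ hx]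
  field_simp
  ring

lemma thetaLog_div {Q x : ℂ} (hQ : ‖Q‖ < 1) (h0 : Q ≠ 0) (hx : x ≠ 0) :
    thetaLog Q (Q / x) = -thetaLog Q x := by
  have h1 : HasDerivAt (fun z => thetaQ Q (Q / z)) (deriv (thetaQ Q) (Q / x) * (Q *
      (-(x ^ 2)⁻¹))) x :=
    (differentiableAt_thetaQ hQ (div_ne_zero h0 hx)).hasDerivAt.comp x
      ((hasDerivAt_inv hx).const_mul Q)
  have h2 : (fun z => thetaQ Q (Q / z)) = thetaQ Q := funext fun z => thetaQ_div h0
  rw [h2] at h1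
  rw [thetaLog, thetaLog, h1.deriv, thetaQ_div h0]
  field_simp

lemma thetaLog_neg {q : ℂ} (hq : ‖q‖ < 1) (h0 : q ≠ 0) {k : ℤ} (hk : ¬ (11 : ℤ) ∣ k) :
    thetaLog ((q ^ 121) ^ 2) ((q ^ 22) ^ (-k)) = 1 - thetaLog ((q ^ 121) ^ 2) ((q ^ 22) ^ k) := by
  rw [zpow_neg]
  exact thetaLog_inv (norm_sq_lt_one (norm_pow_lt_one hq (by norm_num)))
    (zpow_ne_zero _ (pow_ne_zero _ h0)) (theta11_ne_zero hq h0 hk)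

lemma thetaLog_eleven_sub {q : ℂ} (hq : ‖q‖ < 1) (h0 : q ≠ 0) (k : ℤ) :
    thetaLog ((q ^ 121) ^ 2) ((q ^ 22) ^ (11 - k)) = -thetaLog ((q ^ 121) ^ 2) ((q ^ 22) ^ k) := by
  have ht : q ^ 22 ≠ 0 := pow_ne_zero _ h0
  have e : (q ^ 22) ^ (11 - k) = (q ^ 121) ^ 2 / (q ^ 22) ^ k := by
    rw [zpow_sub₀ ht]
    congr 1
    rw [← pow_mul]
    exact (pow_mul q 22 11).symm
  rw [e]
  exact thetaLog_div (norm_sq_lt_one (norm_pow_lt_one hq (by norm_num)))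
    (pow_ne_zero _ (pow_ne_zero _ h0)) (zpow_ne_zero _ ht)

lemma thetaQuot_sum {ρ x y a1 a2 a3 a4 a5 : ℂ}
    (hc : y ^ 2 + (x ^ 2 + 1) * y + x = 0)
    (hR : ρ ^ 11 * ((1 + x * y) * (1 - x) * x ^ 4 * y) = -1)
    (h1 : a1 = a3 * ρ * x) (h2 : a2 = a3 * ρ ^ 2 * x)
    (h4 : a4 = -(a3 * (1 - x) * x ^ 2 * y * ρ ^ 6)) (h5 : a5 = a3 * (1 - x) * x ^ 3 * y ^ 2 * ρ ^ 9)
    (n1 : a1 ≠ 0) (n2 : a2 ≠ 0) (n3 : a3 ≠ 0) (n4 : a4 ≠ 0) (n5 : a5 ≠ 0) :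
    (1 - a2 / a1 + a4 / a2 - a5 / a3 + a3 / a4 - a1 / a5) * (1 - x) =
      1 - x +
      ρ * (-1 + x) +
      ρ ^ 3 * (x * (-1 + x + y * (-1 + x))) +
      ρ ^ 4 * (x * y * (-1 + 2 * x - x ^ 2)) +
      ρ ^ 5 * (x ^ 2 * (1 - x + y * (x - x ^ 2))) +
      ρ ^ 9 * (x ^ 3 * (x - 2 * x ^ 2 + x ^ 3 + y * (1 - 2 * x + 2 * x ^ 2 - 2 * x ^ 3 +
          x ^ 4))) := by
  have e0 : a2 / a1 * (1 - x) = ρ * (1 - x) := by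
    rw [div_mul_eq_mul_div, div_eq_iff (by simp [n1])]
    subst h1 h2 h4 h5
    ring
  have e1 : a4 / a2 * (1 - x) = ρ ^ 4 * (x * y * (-1 + 2 * x - x ^ 2)) := by
    rw [div_mul_eq_mul_div, div_eq_iff (by simp [n2])]
    subst h1 h2 h4 h5
    ring
  have e2 : a5 / a3 * (1 - x) = ρ ^ 9 * (x ^ 3 * (-x + 2 * x ^ 2 - x ^ 3 + y * (-1 + 2 * x - 2 *
      x ^ 2 + 2 * x ^ 3 - x ^ 4))) := by
    rw [div_mul_eq_mul_div, div_eq_iff (by simp [n3])]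
    subst h1 h2 h4 h5
    linear_combination (a3 * ρ ^ 9) * (x ^ 3 * (1 - 2 * x + x ^ 2)) * hc
  have e3 : a3 / a4 * (1 - x) = ρ ^ 5 * (x ^ 2 * (1 - x + y * (x - x ^ 2))) := by
    rw [div_mul_eq_mul_div, div_eq_iff (by simp [n4])]
    subst h1 h2 h4 h5
    linear_combination (a3) * (1 - x) * (1) * hR
  have e4 : a1 / a5 * (1 - x) = ρ ^ 3 * (x * (1 - x + y * (1 - x))) := by
    rw [div_mul_eq_mul_div, div_eq_iff (by simp [n5])]
    subst h1 h2 h4 h5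
    linear_combination -(a3 * ρ ^ 1 * ρ ^ 11) * (x ^ 4 * y * (1 - 2 * x + x ^ 2)) * hc + (a3 * ρ ^
      1) * (x * (1 - x)) * (1) * hR
  linear_combination (-1) * e0 + (1) * e1 + (-1) * e2 + (1) * e3 + (-1) * e4

lemma thetaNumerZero_eq {ρ x y a1 a2 a3 a4 a5 : ℂ}
    (hc : y ^ 2 + (x ^ 2 + 1) * y + x = 0)
    (hR : ρ ^ 11 * ((1 + x * y) * (1 - x) * x ^ 4 * y) = -1)
    (h1 : a1 = a3 * ρ * x) (h2 : a2 = a3 * ρ ^ 2 * x)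
    (h4 : a4 = -(a3 * (1 - x) * x ^ 2 * y * ρ ^ 6)) (h5 : a5 = a3 * (1 - x) * x ^ 3 * y ^ 2 * ρ ^ 9)
    (n1 : a1 ≠ 0) (n2 : a2 ≠ 0) (n3 : a3 ≠ 0) (n4 : a4 ≠ 0) (n5 : a5 ≠ 0) :
    (6 * (a1 ^ 3 / (a4 * a5 ^ 3)) - 8 * (a2 * a3 / (a4 ^ 2 * a5)) + 10 * (a4 ^ 3 / (a2 ^ 3 * a5)) +
        22 * (1 / (a3)) - 22 * (a3 / (a1 * a2)) + 22 * (a3 * a4 / (a2 ^ 2 * a5)) - 22 * (a1 *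
        a5 / (a2 * a3 * a4))) * a1 * (1 - x) =
      ρ * (x * (22 - 22 * x)) +
      ρ ^ 3 * (x ^ 2 * y * (22 - 22 * x)) +
      ρ ^ 4 * (x * (-2 - 10 * x + 12 * x ^ 2 + y * (-12 + 18 * x - 22 * x ^ 2 + 16 * x ^ 3))) +
      ρ ^ 5 * (x ^ 2 * (22 - 44 * x + 22 * x ^ 2 + y * (22 * x - 44 * x ^ 2 + 22 * x ^ 3))) +
      ρ ^ 9 * (x ^ 3 * (-22 * x ^ 2 + 44 * x ^ 3 - 22 * x ^ 4 + y * (22 - 66 * x + 66 * x ^ 2 -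
          44 * x ^
        3 + 44 * x ^ 4 - 22 * x ^ 5))) := by
  have e0 : a1 ^ 3 / (a4 * a5 ^ 3) * a1 * (1 - x) = ρ ^ 4 * (x * (1 - 3 * x + 2 * x ^ 2 + y * (1 -
      2 * x + x ^ 3))) := by
    rw [div_mul_eq_mul_div, div_mul_eq_mul_div, div_eq_iff (by simp [n4, n5])]
    subst h1 h2 h4 h5
    linear_combination -(a3 ^ 4 * ρ ^ 4 * ρ ^ 33) * (x ^ 12 * y ^ 3 * (x ^ 3 - 4 * x ^ 4 + 6 * x ^
      5 - 4 * x ^ 6 + x ^ 7 + y * (-x ^ 2 + 4 * x ^ 3 - 4 * x ^ 4 - 4 * x ^ 5 + 11 * x ^ 6 - 8 * x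
      ^ 7 + 2 * x ^ 8) + y ^ 2 * (x - 5 * x ^ 2 + 9 * x ^ 3 - 6 * x ^ 4 - x ^ 6 + 5 * x ^ 7 - 4 *
      x ^ 8 + x ^ 9) + y ^ 3 * (-1 + 6 * x - 14 * x ^ 2 + 15 * x ^ 3 - 5 * x ^ 4 - 4 * x ^ 5 + 4 *
      x ^ 6 - x ^ 7))) * hc + (a3 ^ 4 * ρ ^ 4) * (x ^ 4 * (1 - x)) * (1 + (-(ρ ^ 11 * ((1 + x * y)
      * (1 - x) * x ^ 4 * y))) ^ 1 + (-(ρ ^ 11 * ((1 + x * y) * (1 - x) * x ^ 4 * y))) ^ 2) * hR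
  have e1 : a2 * a3 / (a4 ^ 2 * a5) * a1 * (1 - x) = ρ ^ 4 * (x * (1 - x + y * (1 - x ^ 2))) := by
    rw [div_mul_eq_mul_div, div_mul_eq_mul_div, div_eq_iff (by simp [n4, n5])]
    subst h1 h2 h4 h5
    linear_combination -(a3 ^ 3 * ρ ^ 3 * ρ ^ 22) * (x ^ 8 * y ^ 2 * (-x + 3 * x ^ 2 - 3 * x ^ 3 +
      x ^ 4 + y * (1 - 3 * x + 2 * x ^ 2 + 2 * x ^ 3 - 3 * x ^ 4 + x ^ 5))) * hc + (a3 ^ 3 * ρ ^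
      3) * (x ^ 2 * (1 - x)) * (1 + (-(ρ ^ 11 * ((1 + x * y) * (1 - x) * x ^ 4 * y))) ^ 1) * hR
  have e2 : a4 ^ 3 / (a2 ^ 3 * a5) * a1 * (1 - x) = ρ ^ 4 * (x * y * (-1 + 3 * x - 3 * x ^ 2 +
      x ^ 3)) := by
    rw [div_mul_eq_mul_div, div_mul_eq_mul_div, div_eq_iff (by simp [n2, n5])]
    subst h1 h2 h4 h5
    ring
  have e3 : 1 / (a3) * a1 * (1 - x) = ρ ^ 1 * (x * (1 - x)) := by
    rw [div_mul_eq_mul_div, div_mul_eq_mul_div, div_eq_iff (by simp [n3])]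
    subst h1 h2 h4 h5
    ring
  have e4 : a3 / (a1 * a2) * a1 * (1 - x) = ρ ^ 9 * (x ^ 3 * (x ^ 2 - 2 * x ^ 3 + x ^ 4 + y * (-1 +
      3 * x - 3 * x ^ 2 + 2 * x ^ 3 - 2 * x ^ 4 + x ^ 5))) := by
    rw [div_mul_eq_mul_div, div_mul_eq_mul_div, div_eq_iff (by simp [n1, n2])]
    subst h1 h2 h4 h5
    linear_combination -(a3 ^ 2 * ρ ^ 1 * ρ ^ 11) * (x ^ 6 * (1 - 2 * x + x ^ 2)) * hc + (a3 ^ 2 *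
      ρ ^ 1) * (x * (1 - x)) * (1) * hR
  have e5 : a3 * a4 / (a2 ^ 2 * a5) * a1 * (1 - x) = ρ ^ 5 * (x ^ 2 * (1 - 2 * x + x ^ 2 + y * (x -
      2 * x ^ 2 + x ^ 3))) := by
    rw [div_mul_eq_mul_div, div_mul_eq_mul_div, div_eq_iff (by simp [n2, n5])]
    subst h1 h2 h4 h5
    linear_combination (a3 ^ 3 * ρ ^ 7) * (x ^ 3 * y * (-1 + 2 * x - x ^ 2)) * (1) * hR
  have e6 : a1 * a5 / (a2 * a3 * a4) * a1 * (1 - x) = ρ ^ 3 * (x ^ 2 * y * (-1 + x)) := by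
    rw [div_mul_eq_mul_div, div_mul_eq_mul_div, div_eq_iff (by simp [n2, n3, n4])]
    subst h1 h2 h4 h5
    ring
  linear_combination (6) * e0 + (-8) * e1 + (10) * e2 + (22) * e3 + (-22) * e4 + (22) * e5 + (-22)
    * e6

lemma thetaNumerFive_eq {ρ x y a1 a2 a3 a4 a5 : ℂ}
    (hc : y ^ 2 + (x ^ 2 + 1) * y + x = 0)
    (hR : ρ ^ 11 * ((1 + x * y) * (1 - x) * x ^ 4 * y) = -1)
    (h1 : a1 = a3 * ρ * x) (h2 : a2 = a3 * ρ ^ 2 * x)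
    (h4 : a4 = -(a3 * (1 - x) * x ^ 2 * y * ρ ^ 6)) (h5 : a5 = a3 * (1 - x) * x ^ 3 * y ^ 2 * ρ ^ 9)
    (n1 : a1 ≠ 0) (n2 : a2 ≠ 0) (n3 : a3 ≠ 0) (n4 : a4 ≠ 0) (n5 : a5 ≠ 0) :
    (3 * (a2 ^ 3 / (a1 ^ 3 * a3)) - 5 * (a3 ^ 3 / (a1 * a4 ^ 3)) - 4 * (a4 * a5 / (a1 * a3 ^ 2)) +
        11 * (a1 * a2 / (a3 * a4 * a5)) - 11 * (1 / (a5)) + 11 * (a3 * a5 / (a1 * a4 ^ 2)) - 11 *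
        (a5 / (a2 * a4))) * a1 * (1 - x) =
      (11 - 11 * x + 11 * x ^ 2 + y * 11) +
      ρ ^ 2 * (x * y * (11 - 11 * x)) +
      ρ ^ 3 * (x * (-11 + 11 * x + y * (-11 + 11 * x))) +
      ρ ^ 4 * (x * (-2 + x + x ^ 2 + y * (-1 - 4 * x + 5 * x ^ 3))) +
      ρ ^ 8 * (x ^ 3 * (11 * x ^ 2 - 11 * x ^ 3 + y * (-11 + 22 * x - 11 * x ^ 2 + 11 * x ^ 3 -
          11 * x ^
        4))) := by
  have e0 : a2 ^ 3 / (a1 ^ 3 * a3) * a1 * (1 - x) = ρ ^ 4 * (x * (1 - x)) := by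
    rw [div_mul_eq_mul_div, div_mul_eq_mul_div, div_eq_iff (by simp [n1, n3])]
    subst h1 h2 h4 h5
    ring
  have e1 : a3 ^ 3 / (a1 * a4 ^ 3) * a1 * (1 - x) = ρ ^ 4 * (x * (1 - x ^ 2 + y * (1 - x ^ 3))) :=
      by
    rw [div_mul_eq_mul_div, div_mul_eq_mul_div, div_eq_iff (by simp [n1, n4])]
    subst h1 h2 h4 h5
    linear_combination -(a3 ^ 4 * ρ ^ 1 * ρ ^ 22) * (x ^ 8 * y ^ 2 * (-1 + 3 * x - 3 * x ^ 2 + x ^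
      3)) * hc + (a3 ^ 4 * ρ ^ 1) * (x * (1 - x)) * (1 + (-(ρ ^ 11 * ((1 + x * y) * (1 - x) * x ^
      4 * y))) ^ 1) * hR
  have e2 : a4 * a5 / (a1 * a3 ^ 2) * a1 * (1 - x) = ρ ^ 4 * (x * (-x + x ^ 2 + y * (-1 + x))) := by
    rw [div_mul_eq_mul_div, div_mul_eq_mul_div, div_eq_iff (by simp [n1, n3])]
    subst h1 h2 h4 h5
    linear_combination (a3 ^ 3 * ρ ^ 5 * ρ ^ 11) * (x ^ 6 * y * (-1 + 2 * x - x ^ 2)) * hc + -(a3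
      ^ 3 * ρ ^ 5) * (x ^ 2 * (-x + x ^ 2 + y * (-1 + x))) * (1) * hR
  have e3 : a1 * a2 / (a3 * a4 * a5) * a1 * (1 - x) = (1 - x + x ^ 2 + y * 1) := by
    rw [div_mul_eq_mul_div, div_mul_eq_mul_div, div_eq_iff (by simp [n3, n4, n5])]
    subst h1 h2 h4 h5
    linear_combination -(a3 ^ 3 * ρ ^ 4 * ρ ^ 11) * (x ^ 5 * y * (x - 2 * x ^ 2 + x ^ 3 + y * (-1
      + 2 * x - x ^ 2))) * hc + (a3 ^ 3 * ρ ^ 4) * (x ^ 3 * (1 - x)) * (1) * hR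
  have e4 : 1 / (a5) * a1 * (1 - x) = ρ ^ 3 * (x * (1 - x + y * (1 - x))) := by
    rw [div_mul_eq_mul_div, div_mul_eq_mul_div, div_eq_iff (by simp [n5])]
    subst h1 h2 h4 h5
    linear_combination -(a3 * ρ ^ 1 * ρ ^ 11) * (x ^ 4 * y * (1 - 2 * x + x ^ 2)) * hc + (a3 * ρ ^
      1) * (x * (1 - x)) * (1) * hR
  have e5 : a3 * a5 / (a1 * a4 ^ 2) * a1 * (1 - x) = ρ ^ 8 * (x ^ 3 * (x ^ 2 - x ^ 3 + y * (-1 +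
      2 * x - x ^ 2 + x ^ 3 - x ^ 4))) := by
    rw [div_mul_eq_mul_div, div_mul_eq_mul_div, div_eq_iff (by simp [n1, n4])]
    subst h1 h2 h4 h5
    linear_combination -(a3 ^ 3 * ρ ^ 10 * ρ ^ 11) * (x ^ 9 * y ^ 2 * (1 - 3 * x + 3 * x ^ 2 - x ^
      3)) * hc + (a3 ^ 3 * ρ ^ 10) * (x ^ 4 * y ^ 2 * (1 - 2 * x + x ^ 2)) * (1) * hR
  have e6 : a5 / (a2 * a4) * a1 * (1 - x) = ρ ^ 2 * (x * y * (-1 + x)) := by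
    rw [div_mul_eq_mul_div, div_mul_eq_mul_div, div_eq_iff (by simp [n2, n4])]
    subst h1 h2 h4 h5
    ring
  linear_combination (3) * e0 + (-5) * e1 + (-4) * e2 + (11) * e3 + (-11) * e4 + (11) * e5 + (-11)
    * e6

/-- The components of the dissection attached to the rank residue `0`, cleared of the
denominator `1 - x`. -/
def compZero (x y : ℂ) : ℕ → ℂ
  | 0 => x * (-4 + 26 * x - 56 * x ^ 2 + 62 * x ^ 3 - 20 * x ^ 4 - 4 * x ^ 5 + y * (-4 + 22 * x -
      34 * x ^ 2 + 24 * x ^ 3 + 18 * x ^ 4))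
  | 1 => x ^ 2 * (-22 + 56 * x + 12 * x ^ 2 - 28 * x ^ 3 + 12 * x ^ 4 + y * (-22 + 34 * x + 46 *
      x ^ 2 - 4 * x ^ 3 - 12 * x ^ 4))
  | 2 => x ^ 2 * (6 - 28 * x + 56 * x ^ 2 - 44 * x ^ 3 + y * (6 - 22 * x + 34 * x ^ 2 - 4 * x ^ 3 -
      14 * x ^ 4 + 6 * x ^ 5))
  | 3 => x ^ 3 * (16 - 66 * x + 48 * x ^ 2 + 36 * x ^ 3 - 6 * x ^ 4 + y * (16 - 50 * x - 2 *
      x ^ 2 + 50 * x ^ 3 + 20 * x ^ 4 - 6 * x ^ 5))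
  | 4 => x ^ 3 * (-10 + 44 * x - 30 * x ^ 2 - 72 * x ^ 3 + 56 * x ^ 4 + 22 * x ^ 5 + y * (-10 +
      34 * x + 4 * x ^ 2 - 78 * x ^ 3 - 18 * x ^ 4 + 56 * x ^ 5 + 22 * x ^ 6))
  | 5 => x ^ 4 * (-18 + 66 * x - 54 * x ^ 2 - 2 * x ^ 3 + 26 * x ^ 4 + y * (-18 + 48 * x - 6 *
      x ^ 2 - 26 * x ^ 3 - 6 * x ^ 4 + 26 * x ^ 5))
  | 6 => x ^ 4 * (14 - 44 * x - 2 * x ^ 2 + 48 * x ^ 3 + 14 * x ^ 4 - 22 * x ^ 5 + y * (14 - 30 *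
      x - 32 * x ^ 2 + 30 * x ^ 3 + 34 * x ^ 4 + 14 * x ^ 5 - 22 * x ^ 6))
  | 7 => x ^ 4 * (-2 + 24 * x - 48 * x ^ 2 + 20 * x ^ 3 - 26 * x ^ 4 + 8 * x ^ 5 + 24 * x ^ 6 + y *
      (-2 + 22 * x - 26 * x ^ 2 - 8 * x ^ 3 - 16 * x ^ 4 - 2 * x ^ 5 + 8 * x ^ 6 + 24 * x ^ 7))
  | 8 => x ^ 6 * (44 - 132 * x + 44 * x ^ 2 + 66 * x ^ 3 - 22 * x ^ 5 + y * (44 - 88 * x - 44 *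
      x ^ 2 + 66 * x ^ 3 + 44 * x ^ 4 - 22 * x ^ 6))
  | 9 => x ^ 5 * (2 - 22 * x + 70 * x ^ 2 - 36 * x ^ 3 - 50 * x ^ 4 + 2 * x ^ 5 + 14 * x ^ 6 + 20 *
      x ^ 7 + y * (2 - 20 * x + 50 * x ^ 2 + 16 * x ^ 3 - 48 * x ^ 4 - 56 * x ^ 5 + 22 * x ^ 6 +
      14 * x ^ 7 + 20 * x ^ 8))
  | 10 => x ^ 6 * (8 - 44 * x + 82 * x ^ 2 - 34 * x ^ 3 - 46 * x ^ 4 + 8 * x ^ 5 + 34 * x ^ 6 - 8 *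
      x ^ 7 + y * (8 - 36 * x + 46 * x ^ 2 + 20 * x ^ 3 - 60 * x ^ 4 - 4 * x ^ 5 + 34 * x ^ 7 - 8 *
      x ^ 8))
  | _ => 0

/-- The components of the dissection attached to the rank residue `5`, cleared of the
denominator `1 - x`. -/
def compFive (x y : ℂ) : ℕ → ℂ
  | 0 => x * (-4 + 26 * x - 45 * x ^ 2 + 7 * x ^ 3 + 2 * x ^ 4 - 4 * x ^ 5 + y * (-4 + 22 * x -
      23 * x ^ 2 - 20 * x ^ 3 - 4 * x ^ 4))
  | 1 => x ^ 2 * (-11 + 45 * x - 54 * x ^ 2 + 16 * x ^ 3 + x ^ 4 + y * (-11 + 34 * x - 20 * x ^ 2 -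
      15 * x ^ 3 - x ^ 4))
  | 2 => x ^ 2 * (6 - 28 * x + 34 * x ^ 2 - 11 * x ^ 3 - 11 * x ^ 4 + y * (6 - 22 * x + 12 *
      x ^ 2 + 7 * x ^ 3 - 14 * x ^ 4 - 5 * x ^ 5))
  | 3 => x ^ 3 * (16 - 55 * x + 15 * x ^ 2 + 25 * x ^ 3 + 5 * x ^ 4 + y * (16 - 39 * x - 24 *
      x ^ 2 + 17 * x ^ 3 + 20 * x ^ 4 + 5 * x ^ 5))
  | 4 => x ^ 3 * (-10 + 33 * x - 8 * x ^ 2 - 28 * x ^ 3 + x ^ 4 + y * (-10 + 23 * x + 15 * x ^ 2 -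
      23 * x ^ 3 - 18 * x ^ 4 + x ^ 5))
  | 5 => x ^ 4 * (-18 + 55 * x - 21 * x ^ 2 - 13 * x ^ 3 - 7 * x ^ 4 + y * (-18 + 37 * x + 16 *
      x ^ 2 - 15 * x ^ 3 - 17 * x ^ 4 - 7 * x ^ 5))
  | 6 => x ^ 4 * (3 - 33 * x + 75 * x ^ 2 - 29 * x ^ 3 - 19 * x ^ 4 + y * (3 - 30 * x + 45 *
      x ^ 2 + 19 * x ^ 3 - 21 * x ^ 4 - 19 * x ^ 5))
  | 7 => x ^ 4 * (-2 + 13 * x - 48 * x ^ 2 + 64 * x ^ 3 + 7 * x ^ 4 - 25 * x ^ 5 - 9 * x ^ 6 + y *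
      (-2 + 11 * x - 37 * x ^ 2 + 25 * x ^ 3 + 39 * x ^ 4 - 2 * x ^ 5 - 25 * x ^ 6 - 9 * x ^ 7))
  | 8 => x ^ 5 * (-11 + 33 * x - 22 * x ^ 2 + 11 * x ^ 3 - 11 * x ^ 5 + y * (-11 + 22 * x - 11 *
      x ^ 6))
  | 9 => x ^ 5 * (2 - 22 * x + 48 * x ^ 2 - 14 * x ^ 3 - 17 * x ^ 4 + 2 * x ^ 5 + 3 * x ^ 6 - 2 *
      x ^ 7 + y * (2 - 20 * x + 28 * x ^ 2 + 16 * x ^ 3 - 15 * x ^ 4 - 12 * x ^ 5 + 3 * x ^ 7 - 2 *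
      x ^ 8))
  | 10 => x ^ 6 * (8 - 44 * x + 49 * x ^ 2 + 21 * x ^ 3 - 24 * x ^ 4 - 14 * x ^ 5 + x ^ 6 + 3 *
      x ^ 7 + y * (8 - 36 * x + 13 * x ^ 2 + 42 * x ^ 3 + 6 * x ^ 4 - 26 * x ^ 5 - 11 * x ^ 6 +
      x ^ 7 + 3 * x ^ 8))
  | _ => 0

lemma compZero_mul {ρ x y : ℂ} (hc : y ^ 2 + (x ^ 2 + 1) * y + x = 0)
    (hK : ρ ^ 11 * (x ^ 5 * (1 - x) ^ 2) = 1 - x + 2 * x ^ 2 - 2 * x ^ 3 - x ^ 5 + y * (1 - x -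
        x ^ 3)) :
    x ^ 5 * (1 - x) ^ 2 * ((1 - x +
      ρ * (-1 + x) +
      ρ ^ 3 * (x * (-1 + x + y * (-1 + x))) +
      ρ ^ 4 * (x * y * (-1 + 2 * x - x ^ 2)) +
      ρ ^ 5 * (x ^ 2 * (1 - x + y * (x - x ^ 2))) +
      ρ ^ 9 * (x ^ 3 * (x - 2 * x ^ 2 + x ^ 3 + y * (1 - 2 * x + 2 * x ^ 2 - 2 * x ^ 3 + x ^ 4)))) *
      ∑ g ∈ Finset.range 11, ρ ^ g * compZero x y g) =
    x ^ 5 * (1 - x) ^ 2 * (ρ ^ 4 * (x ^ 3 * (-1 + 8 * x ^ 2 - 5 * x ^ 3 - x ^ 4 + y * (-1 - x + 7 *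
        x ^ 2 + x ^ 3 - 4 * x ^ 4 - x ^ 5))) *
      (ρ * (x * (22 - 22 * x)) +
      ρ ^ 3 * (x ^ 2 * y * (22 - 22 * x)) +
      ρ ^ 4 * (x * (-2 - 10 * x + 12 * x ^ 2 + y * (-12 + 18 * x - 22 * x ^ 2 + 16 * x ^ 3))) +
      ρ ^ 5 * (x ^ 2 * (22 - 44 * x + 22 * x ^ 2 + y * (22 * x - 44 * x ^ 2 + 22 * x ^ 3))) +
      ρ ^ 9 * (x ^ 3 * (-22 * x ^ 2 + 44 * x ^ 3 - 22 * x ^ 4 + y * (22 - 66 * x + 66 * x ^ 2 -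
          44 * x ^
        3 + 44 * x ^ 4 - 22 * x ^ 5))))) := by
  obtain ⟨E0, dE0⟩ : ∃ z, z = 1 - x := ⟨_, rfl⟩
  obtain ⟨E1, dE1⟩ : ∃ z, z = -1 + x := ⟨_, rfl⟩
  obtain ⟨E3, dE3⟩ : ∃ z, z = x * (-1 + x + y * (-1 + x)) := ⟨_, rfl⟩
  obtain ⟨E4, dE4⟩ : ∃ z, z = x * y * (-1 + 2 * x - x ^ 2) := ⟨_, rfl⟩
  obtain ⟨E5, dE5⟩ : ∃ z, z = x ^ 2 * (1 - x + y * (x - x ^ 2)) := ⟨_, rfl⟩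
  obtain ⟨E9, dE9⟩ : ∃ z, z = x ^ 3 * (x - 2 * x ^ 2 + x ^ 3 + y * (1 - 2 * x + 2 * x ^ 2 - 2 * x
    ^ 3 + x ^ 4)) := ⟨_, rfl⟩
  obtain ⟨T1, dT1⟩ : ∃ z, z = x * (22 - 22 * x) := ⟨_, rfl⟩
  obtain ⟨T3, dT3⟩ : ∃ z, z = x ^ 2 * y * (22 - 22 * x) := ⟨_, rfl⟩
  obtain ⟨T4, dT4⟩ : ∃ z, z = x * (-2 - 10 * x + 12 * x ^ 2 + y * (-12 + 18 * x - 22 * x ^ 2 + 16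
    * x ^ 3)) := ⟨_, rfl⟩
  obtain ⟨T5, dT5⟩ : ∃ z, z = x ^ 2 * (22 - 44 * x + 22 * x ^ 2 + y * (22 * x - 44 * x ^ 2 + 22 *
    x ^ 3)) := ⟨_, rfl⟩
  obtain ⟨T9, dT9⟩ : ∃ z, z = x ^ 3 * (-22 * x ^ 2 + 44 * x ^ 3 - 22 * x ^ 4 + y * (22 - 66 * x +
    66 * x ^ 2 - 44 * x ^ 3 + 44 * x ^ 4 - 22 * x ^ 5)) := ⟨_, rfl⟩
  obtain ⟨δ, dδ⟩ : ∃ z, z = x ^ 3 * (-1 + 8 * x ^ 2 - 5 * x ^ 3 - x ^ 4 + y * (-1 - x + 7 * x ^ 2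
    + x ^ 3 - 4 * x ^ 4 - x ^ 5)) := ⟨_, rfl⟩
  obtain ⟨h, dh⟩ : ∃ z, z = 1 - x + 2 * x ^ 2 - 2 * x ^ 3 - x ^ 5 + y * (1 - x - x ^ 3) := ⟨_,
    rfl⟩
  obtain ⟨k, dk⟩ : ∃ z, z = x ^ 5 * (1 - x) ^ 2 := ⟨_, rfl⟩
  obtain ⟨C, dC⟩ : ∃ z, z = compZero x y := ⟨_, rfl⟩
  have hk : ρ ^ 11 * k = h := by rw [dk, dh]; exact hK
  suffices H : k * ((E0 + ρ * E1 + ρ ^ 3 * E3 + ρ ^ 4 * E4 + ρ ^ 5 * E5 + ρ ^ 9 * E9) * ∑ g ∈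
      Finset.range 11, ρ ^ g * C g) = k * (ρ ^ 4 * δ * (ρ * T1 + ρ ^ 3 * T3 + ρ ^ 4 * T4 + ρ ^ 5 *
      T5 + ρ ^ 9 * T9)) by
    simpa only [dE0, dE1, dE3, dE4, dE5, dE9, dT1, dT3, dT4, dT5, dT9, dδ, dh, dk, dC] using H
  have c0 : k * (E0 * C 0) + h * (E1 * C 10 + E3 * C 8 + E4 * C 7 + E5 * C 6 + E9 * C 2) = 0 := by
    simp only [dE0, dE1, dE3, dE4, dE5, dE9, dh, dk, dC, compZero]
    linear_combination (x ^ 5 * (8 - 64 * x + 178 * x ^ 2 - 296 * x ^ 3 + 494 * x ^ 4 - 690 * x ^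
      5 + 654 * x ^ 6 - 536 * x ^ 7 + 342 * x ^ 8 - 88 * x ^ 9 + 12 * x ^ 10 - 2 * x ^ 11 - 20 * x
      ^ 12 + 8 * x ^ 13 + y * (8 - 68 * x + 192 * x ^ 2 - 246 * x ^ 3 + 258 * x ^ 4 - 358 * x ^ 5
      + 272 * x ^ 6 - 70 * x ^ 7 + 80 * x ^ 8 - 50 * x ^ 9 - 36 * x ^ 10 + 18 * x ^ 12))) * hc
  have c1 : k * (E0 * C 1 + E1 * C 0) + h * (E3 * C 9 + E4 * C 8 + E5 * C 7 + E9 * C 3) = 0 := by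
    simp only [dE0, dE1, dE3, dE4, dE5, dE9, dh, dk, dC, compZero]
    linear_combination (x ^ 6 * (10 - 68 * x + 238 * x ^ 2 - 658 * x ^ 3 + 1156 * x ^ 4 - 1044 * x
      ^ 5 + 450 * x ^ 6 - 130 * x ^ 7 - 38 * x ^ 8 + 160 * x ^ 9 - 92 * x ^ 10 + 36 * x ^ 11 - 20
      * x ^ 12 + y * (14 - 120 * x + 366 * x ^ 2 - 542 * x ^ 3 + 422 * x ^ 4 - 168 * x ^ 5 + 36 *
      x ^ 6 + 38 * x ^ 7 - 136 * x ^ 8 + 106 * x ^ 9 - 6 * x ^ 10 + 2 * x ^ 11 - 12 * x ^ 12))) *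
      hc
  have c2 : k * (E0 * C 2 + E1 * C 1) + h * (E3 * C 10 + E4 * C 9 + E5 * C 8 + E9 * C 4) = h * (δ
      * T9) := by
    simp only [dE0, dE1, dE3, dE4, dE5, dE9, dT9, dδ, dh, dk, dC, compZero]
    linear_combination (x ^ 6 * (10 - 12 * x - 180 * x ^ 2 + 748 * x ^ 3 - 1532 * x ^ 4 + 2040 * x
      ^ 5 - 1824 * x ^ 6 + 1264 * x ^ 7 - 938 * x ^ 8 + 598 * x ^ 9 - 236 * x ^ 10 + 118 * x ^ 11
      - 64 * x ^ 12 + 8 * x ^ 13 + y * (10 + 16 * x - 312 * x ^ 2 + 806 * x ^ 3 - 872 * x ^ 4 +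
      654 * x ^ 5 - 668 * x ^ 6 + 488 * x ^ 7 - 162 * x ^ 8 + 124 * x ^ 9 - 106 * x ^ 10 + 30 * x
      ^ 11 - 14 * x ^ 12 + 6 * x ^ 13))) * hc
  have c3 : k * (E0 * C 3 + E1 * C 2 + E3 * C 0) + h * (E4 * C 10 + E5 * C 9 + E9 * C 5) = 0 := by
    simp only [dE0, dE1, dE3, dE4, dE5, dE9, dh, dk, dC, compZero]
    linear_combination (x ^ 7 * (-20 + 114 * x - 308 * x ^ 2 + 690 * x ^ 3 - 1154 * x ^ 4 + 1052 *
      x ^ 5 - 442 * x ^ 6 + 120 * x ^ 7 + 10 * x ^ 8 - 132 * x ^ 9 + 82 * x ^ 10 - 32 * x ^ 11 +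
      20 * x ^ 12 + y * (-26 + 164 * x - 424 * x ^ 2 + 608 * x ^ 3 - 494 * x ^ 4 + 192 * x ^ 5 -
      116 * x ^ 6 + 120 * x ^ 7 + 78 * x ^ 8 - 54 * x ^ 9 - 80 * x ^ 10 + 2 * x ^ 11 + 18 * x ^ 12
      + 12 * x ^ 13))) * hc
  have c4 : k * (E0 * C 4 + E1 * C 3 + E3 * C 1 + E4 * C 0) + h * (E5 * C 10 + E9 * C 6) = 0 := by
    simp only [dE0, dE1, dE3, dE4, dE5, dE9, dh, dk, dC, compZero]
    linear_combination (x ^ 7 * (18 - 80 * x + 130 * x ^ 2 - 270 * x ^ 3 + 678 * x ^ 4 - 820 * x ^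
      5 + 344 * x ^ 6 - 62 * x ^ 7 + 222 * x ^ 8 - 208 * x ^ 9 + 92 * x ^ 10 - 100 * x ^ 11 + 64 *
      x ^ 12 - 8 * x ^ 13 + y * (14 - 72 * x + 122 * x ^ 2 - 116 * x ^ 3 + 162 * x ^ 4 - 116 * x ^
      5 - 130 * x ^ 6 + 178 * x ^ 7 - 138 * x ^ 8 + 280 * x ^ 9 - 246 * x ^ 10 + 106 * x ^ 11 -
      100 * x ^ 12 + 64 * x ^ 13 - 8 * x ^ 14))) * hc
  have c5 : k * (E0 * C 5 + E1 * C 4 + E3 * C 2 + E4 * C 1 + E5 * C 0) + h * (E9 * C 7) = k * (δ *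
      T1) := by
    simp only [dE0, dE1, dE3, dE4, dE5, dE9, dT1, dδ, dh, dk, dC, compZero]
    linear_combination (x ^ 7 * (-2 + 44 * x - 188 * x ^ 2 + 336 * x ^ 3 - 380 * x ^ 4 + 458 * x ^
      5 - 552 * x ^ 6 + 498 * x ^ 7 - 294 * x ^ 8 + 46 * x ^ 9 + 48 * x ^ 10 - 30 * x ^ 11 + 40 *
      x ^ 12 - 24 * x ^ 13 + y * (-2 + 28 * x - 100 * x ^ 2 + 168 * x ^ 3 - 216 * x ^ 4 + 260 * x
      ^ 5 - 210 * x ^ 6 + 156 * x ^ 7 - 160 * x ^ 8 + 104 * x ^ 9 - 98 * x ^ 10 + 108 * x ^ 11 -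
      54 * x ^ 12 + 40 * x ^ 13 - 24 * x ^ 14))) * hc
  have c6 : k * (E0 * C 6 + E1 * C 5 + E3 * C 3 + E4 * C 2 + E5 * C 1) + h * (E9 * C 8) = 0 := by
    simp only [dE0, dE1, dE3, dE4, dE5, dE9, dh, dk, dC, compZero]
    linear_combination (x ^ 8 * (-6 + 74 * x - 302 * x ^ 2 + 640 * x ^ 3 - 950 * x ^ 4 + 1112 * x
      ^ 5 - 826 * x ^ 6 + 280 * x ^ 7 - 132 * x ^ 8 + 176 * x ^ 9 - 44 * x ^ 10 - 44 * x ^ 12 + 22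
      * x ^ 13 + y * (44 * x - 220 * x ^ 2 + 396 * x ^ 3 - 374 * x ^ 4 + 330 * x ^ 5 - 220 * x ^ 6
      - 44 * x ^ 7 + 88 * x ^ 8 - 66 * x ^ 9 + 154 * x ^ 10 - 88 * x ^ 11 + 22 * x ^ 12 - 44 * x ^
      13 + 22 * x ^ 14))) * hc
  have c7 : k * (E0 * C 7 + E1 * C 6 + E3 * C 4 + E4 * C 3 + E5 * C 2) + h * (E9 * C 9) = k * (δ *
      T3) := by
    simp only [dE0, dE1, dE3, dE4, dE5, dE9, dT3, dδ, dh, dk, dC, compZero]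
    linear_combination (x ^ 8 * (2 - 32 * x + 198 * x ^ 2 - 502 * x ^ 3 + 602 * x ^ 4 - 400 * x ^
      5 + 212 * x ^ 6 - 86 * x ^ 7 + 30 * x ^ 8 - 2 * x ^ 9 - 126 * x ^ 10 + 132 * x ^ 11 - 34 * x
      ^ 12 + 26 * x ^ 13 - 20 * x ^ 14 + y * (2 - 26 * x + 118 * x ^ 2 - 224 * x ^ 3 + 214 * x ^ 4
      - 204 * x ^ 5 + 232 * x ^ 6 - 148 * x ^ 7 + 178 * x ^ 8 - 268 * x ^ 9 + 176 * x ^ 10 - 160 *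
      x ^ 11 + 158 * x ^ 12 - 54 * x ^ 13 + 26 * x ^ 14 - 20 * x ^ 15))) * hc
  have c8 : k * (E0 * C 8 + E1 * C 7 + E3 * C 5 + E4 * C 4 + E5 * C 3) + h * (E9 * C 10) = k * (δ
      * T4) := by
    simp only [dE0, dE1, dE3, dE4, dE5, dE9, dT4, dδ, dh, dk, dC, compZero]
    linear_combination (x ^ 9 * (6 - 86 * x + 356 * x ^ 2 - 688 * x ^ 3 + 830 * x ^ 4 - 850 * x ^
      5 + 704 * x ^ 6 - 314 * x ^ 7 + 130 * x ^ 8 - 220 * x ^ 9 + 178 * x ^ 10 - 88 * x ^ 11 + 84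
      * x ^ 12 - 50 * x ^ 13 + 8 * x ^ 14 + y * (8 - 60 * x + 186 * x ^ 2 - 302 * x ^ 3 + 284 * x
      ^ 4 - 178 * x ^ 5 + 26 * x ^ 6 + 200 * x ^ 7 - 322 * x ^ 8 + 314 * x ^ 9 - 330 * x ^ 10 +
      262 * x ^ 11 - 138 * x ^ 12 + 92 * x ^ 13 - 50 * x ^ 14 + 8 * x ^ 15))) * hc
  have c9 : k * (E0 * C 9 + E1 * C 8 + E3 * C 6 + E4 * C 5 + E5 * C 4 + E9 * C 0) = k * (δ * T5)
      := by
    simp only [dE0, dE1, dE3, dE4, dE5, dE9, dT5, dδ, dk, dC, compZero]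
    linear_combination (x ^ 9 * (-4 + 42 * x - 186 * x ^ 2 + 550 * x ^ 3 - 1138 * x ^ 4 + 1468 * x
      ^ 5 - 1016 * x ^ 6 + 264 * x ^ 7 + 20 * x ^ 8 + 20 * x ^ 9 - 20 * x ^ 10)) * hc
  have c10 : k * (E0 * C 10 + E1 * C 9 + E3 * C 7 + E4 * C 6 + E5 * C 5 + E9 * C 1) = 0 := by
    simp only [dE0, dE1, dE3, dE4, dE5, dE9, dk, dC, compZero]
    linear_combination (x ^ 10 * (-34 + 180 * x - 336 * x ^ 2 + 268 * x ^ 3 - 68 * x ^ 4 - 72 * x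
      ^ 5 + 170 * x ^ 6 - 186 * x ^ 7 + 108 * x ^ 8 - 38 * x ^ 9 + 8 * x ^ 10)) * hc
  simp only [Finset.sum_range_succ, Finset.sum_range_zero]
  linear_combination ρ ^ 0 * c0 + ρ ^ 1 * c1 + ρ ^ 2 * c2 + ρ ^ 3 * c3 + ρ ^ 4 * c4 + ρ ^ 5 * c5 +
    ρ ^ 6 * c6 + ρ ^ 7 * c7 + ρ ^ 8 * c8 + ρ ^ 9 * c9 + ρ ^ 10 * c10 + (ρ ^ 0 * (E1 * C 10) + ρ ^
    0 * (E3 * C 8) + ρ ^ 1 * (E3 * C 9) + ρ ^ 2 * (E3 * C 10) + ρ ^ 0 * (E4 * C 7) + ρ ^ 1 * (E4 *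
    C 8) + ρ ^ 2 * (E4 * C 9) + ρ ^ 3 * (E4 * C 10) + ρ ^ 0 * (E5 * C 6) + ρ ^ 1 * (E5 * C 7) + ρ
    ^ 2 * (E5 * C 8) + ρ ^ 3 * (E5 * C 9) + ρ ^ 4 * (E5 * C 10) + ρ ^ 0 * (E9 * C 2) + ρ ^ 1 * (E9
    * C 3) + ρ ^ 2 * (E9 * C 4) + ρ ^ 3 * (E9 * C 5) + ρ ^ 4 * (E9 * C 6) + ρ ^ 5 * (E9 * C 7) + ρ
    ^ 6 * (E9 * C 8) + ρ ^ 7 * (E9 * C 9) + ρ ^ 8 * (E9 * C 10)) * hk - (ρ ^ 2 * (δ * T9)) * hk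

lemma compFive_mul {ρ x y : ℂ} (hc : y ^ 2 + (x ^ 2 + 1) * y + x = 0)
    (hK : ρ ^ 11 * (x ^ 5 * (1 - x) ^ 2) = 1 - x + 2 * x ^ 2 - 2 * x ^ 3 - x ^ 5 + y * (1 - x -
        x ^ 3)) :
    x ^ 5 * (1 - x) ^ 2 * ((1 - x +
      ρ * (-1 + x) +
      ρ ^ 3 * (x * (-1 + x + y * (-1 + x))) +
      ρ ^ 4 * (x * y * (-1 + 2 * x - x ^ 2)) +
      ρ ^ 5 * (x ^ 2 * (1 - x + y * (x - x ^ 2))) +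
      ρ ^ 9 * (x ^ 3 * (x - 2 * x ^ 2 + x ^ 3 + y * (1 - 2 * x + 2 * x ^ 2 - 2 * x ^ 3 + x ^ 4)))) *
      ∑ g ∈ Finset.range 11, ρ ^ g * compFive x y g) =
    x ^ 5 * (1 - x) ^ 2 * (ρ ^ 4 * (x ^ 3 * (-1 + 8 * x ^ 2 - 5 * x ^ 3 - x ^ 4 + y * (-1 - x + 7 *
        x ^ 2 + x ^ 3 - 4 * x ^ 4 - x ^ 5))) *
      ((11 - 11 * x + 11 * x ^ 2 + y * 11) +
      ρ ^ 2 * (x * y * (11 - 11 * x)) +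
      ρ ^ 3 * (x * (-11 + 11 * x + y * (-11 + 11 * x))) +
      ρ ^ 4 * (x * (-2 + x + x ^ 2 + y * (-1 - 4 * x + 5 * x ^ 3))) +
      ρ ^ 8 * (x ^ 3 * (11 * x ^ 2 - 11 * x ^ 3 + y * (-11 + 22 * x - 11 * x ^ 2 + 11 * x ^ 3 -
          11 * x ^
        4))))) := by
  obtain ⟨E0, dE0⟩ : ∃ z, z = 1 - x := ⟨_, rfl⟩
  obtain ⟨E1, dE1⟩ : ∃ z, z = -1 + x := ⟨_, rfl⟩
  obtain ⟨E3, dE3⟩ : ∃ z, z = x * (-1 + x + y * (-1 + x)) := ⟨_, rfl⟩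
  obtain ⟨E4, dE4⟩ : ∃ z, z = x * y * (-1 + 2 * x - x ^ 2) := ⟨_, rfl⟩
  obtain ⟨E5, dE5⟩ : ∃ z, z = x ^ 2 * (1 - x + y * (x - x ^ 2)) := ⟨_, rfl⟩
  obtain ⟨E9, dE9⟩ : ∃ z, z = x ^ 3 * (x - 2 * x ^ 2 + x ^ 3 + y * (1 - 2 * x + 2 * x ^ 2 - 2 * x
    ^ 3 + x ^ 4)) := ⟨_, rfl⟩
  obtain ⟨T0, dT0⟩ : ∃ z, z = 11 - 11 * x + 11 * x ^ 2 + y * 11 := ⟨_, rfl⟩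
  obtain ⟨T2, dT2⟩ : ∃ z, z = x * y * (11 - 11 * x) := ⟨_, rfl⟩
  obtain ⟨T3, dT3⟩ : ∃ z, z = x * (-11 + 11 * x + y * (-11 + 11 * x)) := ⟨_, rfl⟩
  obtain ⟨T4, dT4⟩ : ∃ z, z = x * (-2 + x + x ^ 2 + y * (-1 - 4 * x + 5 * x ^ 3)) := ⟨_, rfl⟩
  obtain ⟨T8, dT8⟩ : ∃ z, z = x ^ 3 * (11 * x ^ 2 - 11 * x ^ 3 + y * (-11 + 22 * x - 11 * x ^ 2 +
    11 * x ^ 3 - 11 * x ^ 4)) := ⟨_, rfl⟩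
  obtain ⟨δ, dδ⟩ : ∃ z, z = x ^ 3 * (-1 + 8 * x ^ 2 - 5 * x ^ 3 - x ^ 4 + y * (-1 - x + 7 * x ^ 2
    + x ^ 3 - 4 * x ^ 4 - x ^ 5)) := ⟨_, rfl⟩
  obtain ⟨h, dh⟩ : ∃ z, z = 1 - x + 2 * x ^ 2 - 2 * x ^ 3 - x ^ 5 + y * (1 - x - x ^ 3) := ⟨_,
    rfl⟩
  obtain ⟨k, dk⟩ : ∃ z, z = x ^ 5 * (1 - x) ^ 2 := ⟨_, rfl⟩
  obtain ⟨C, dC⟩ : ∃ z, z = compFive x y := ⟨_, rfl⟩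
  have hk : ρ ^ 11 * k = h := by rw [dk, dh]; exact hK
  suffices H : k * ((E0 + ρ * E1 + ρ ^ 3 * E3 + ρ ^ 4 * E4 + ρ ^ 5 * E5 + ρ ^ 9 * E9) * ∑ g ∈
      Finset.range 11, ρ ^ g * C g) = k * (ρ ^ 4 * δ * (T0 + ρ ^ 2 * T2 + ρ ^ 3 * T3 + ρ ^ 4 * T4
      + ρ ^ 8 * T8)) by
    simpa only [dE0, dE1, dE3, dE4, dE5, dE9, dT0, dT2, dT3, dT4, dT8, dδ, dh, dk, dC] using H
  have c0 : k * (E0 * C 0) + h * (E1 * C 10 + E3 * C 8 + E4 * C 7 + E5 * C 6 + E9 * C 2) = 0 := by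
    simp only [dE0, dE1, dE3, dE4, dE5, dE9, dh, dk, dC, compFive]
    linear_combination (x ^ 5 * (8 - 42 * x + 123 * x ^ 2 - 318 * x ^ 3 + 615 * x ^ 4 - 800 * x ^
      5 + 665 * x ^ 6 - 305 * x ^ 7 + 89 * x ^ 8 - 44 * x ^ 9 - 21 * x ^ 10 + 31 * x ^ 11 + 2 * x
      ^ 12 - 3 * x ^ 13 + y * (8 - 46 * x + 137 * x ^ 2 - 301 * x ^ 3 + 401 * x ^ 4 - 248 * x ^ 5
      + 96 * x ^ 6 - 92 * x ^ 7 - 8 * x ^ 8 + 71 * x ^ 9 - 3 * x ^ 10 - 11 * x ^ 11 - 4 * x ^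
      12))) * hc
  have c1 : k * (E0 * C 1 + E1 * C 0) + h * (E3 * C 9 + E4 * C 8 + E5 * C 7 + E9 * C 3) = h * (δ *
      T8) := by
    simp only [dE0, dE1, dE3, dE4, dE5, dE9, dT8, dδ, dh, dk, dC, compFive]
    linear_combination (x ^ 6 * (10 - 57 * x + 183 * x ^ 2 - 526 * x ^ 3 + 980 * x ^ 4 - 1055 * x
      ^ 5 + 758 * x ^ 6 - 471 * x ^ 7 + 248 * x ^ 8 - 82 * x ^ 9 + 18 * x ^ 10 - 8 * x ^ 11 + 2 *
      x ^ 12 + y * (14 - 98 * x + 278 * x ^ 2 - 454 * x ^ 3 + 466 * x ^ 4 - 311 * x ^ 5 + 201 * x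
      ^ 6 - 127 * x ^ 7 + 7 * x ^ 8 + 18 * x ^ 9 + 16 * x ^ 10 - 9 * x ^ 11 - x ^ 12))) * hc
  have c2 : k * (E0 * C 2 + E1 * C 1) + h * (E3 * C 10 + E4 * C 9 + E5 * C 8 + E9 * C 4) = 0 := by
    simp only [dE0, dE1, dE3, dE4, dE5, dE9, dh, dk, dC, compFive]
    linear_combination (x ^ 6 * (-12 + 54 * x - 81 * x ^ 2 + 143 * x ^ 3 - 355 * x ^ 4 + 390 * x ^
      5 - 108 * x ^ 6 - 23 * x ^ 7 + 19 * x ^ 8 - 84 * x ^ 9 + 61 * x ^ 10 - 3 * x ^ 11 + 2 * x ^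
      12 - 3 * x ^ 13 + y * (-12 + 71 * x - 147 * x ^ 2 + 157 * x ^ 3 - 146 * x ^ 4 + 104 * x ^ 5
      + 3 * x ^ 6 - 7 * x ^ 7 - 30 * x ^ 8 - 8 * x ^ 9 - 7 * x ^ 10 + 30 * x ^ 11 - 3 * x ^ 12 - 5
      * x ^ 13))) * hc
  have c3 : k * (E0 * C 3 + E1 * C 2 + E3 * C 0) + h * (E4 * C 10 + E5 * C 9 + E9 * C 5) = 0 := by
    simp only [dE0, dE1, dE3, dE4, dE5, dE9, dh, dk, dC, compFive]
    linear_combination (x ^ 7 * (-20 + 103 * x - 253 * x ^ 2 + 525 * x ^ 3 - 802 * x ^ 4 + 667 * x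
      ^ 5 - 310 * x ^ 6 + 186 * x ^ 7 - 111 * x ^ 8 + 11 * x ^ 9 - 6 * x ^ 10 + 12 * x ^ 11 - 2 *
      x ^ 12 + y * (-26 + 153 * x - 336 * x ^ 2 + 366 * x ^ 3 - 252 * x ^ 4 + 170 * x ^ 5 - 116 *
      x ^ 6 + 32 * x ^ 7 + 23 * x ^ 8 + x ^ 9 - 14 * x ^ 10 - 9 * x ^ 11 + 7 * x ^ 12 + x ^ 13)))
      * hc
  have c4 : k * (E0 * C 4 + E1 * C 3 + E3 * C 1 + E4 * C 0) + h * (E5 * C 10 + E9 * C 6) = k * (δ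
      * T0) := by
    simp only [dE0, dE1, dE3, dE4, dE5, dE9, dT0, dδ, dh, dk, dC, compFive]
    linear_combination (x ^ 7 * (7 - 47 * x + 163 * x ^ 2 - 413 * x ^ 3 + 722 * x ^ 4 - 787 * x ^
      5 + 531 * x ^ 6 - 304 * x ^ 7 + 200 * x ^ 8 - 54 * x ^ 9 - 29 * x ^ 10 + 10 * x ^ 11 - 2 * x
      ^ 12 + 3 * x ^ 13 + y * (3 - 39 * x + 155 * x ^ 2 - 303 * x ^ 3 + 360 * x ^ 4 - 292 * x ^ 5
      + 178 * x ^ 6 - 119 * x ^ 7 + 71 * x ^ 8 - 6 * x ^ 9 + 18 * x ^ 10 - 37 * x ^ 11 + 10 * x ^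
      12 - 2 * x ^ 13 + 3 * x ^ 14))) * hc
  have c5 : k * (E0 * C 5 + E1 * C 4 + E3 * C 2 + E4 * C 1 + E5 * C 0) + h * (E9 * C 7) = 0 := by
    simp only [dE0, dE1, dE3, dE4, dE5, dE9, dh, dk, dC, compFive]
    linear_combination (x ^ 7 * (-2 + 22 * x - 122 * x ^ 2 + 369 * x ^ 3 - 655 * x ^ 4 + 777 * x ^
      5 - 673 * x ^ 6 + 377 * x ^ 7 - 118 * x ^ 8 + 68 * x ^ 9 - 29 * x ^ 10 - 30 * x ^ 11 + 7 * x
      ^ 12 + 9 * x ^ 13 + y * (-2 + 17 * x - 78 * x ^ 2 + 190 * x ^ 3 - 249 * x ^ 4 + 227 * x ^ 5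
      - 210 * x ^ 6 + 123 * x ^ 7 - 28 * x ^ 8 + 49 * x ^ 9 - 21 * x ^ 10 - 13 * x ^ 11 - 21 * x ^
      12 + 7 * x ^ 13 + 9 * x ^ 14))) * hc
  have c6 : k * (E0 * C 6 + E1 * C 5 + E3 * C 3 + E4 * C 2 + E5 * C 1) + h * (E9 * C 8) = k * (δ *
      T2) := by
    simp only [dE0, dE1, dE3, dE4, dE5, dE9, dT2, dδ, dh, dk, dC, compFive]
    linear_combination (x ^ 8 * (-17 + 96 * x - 203 * x ^ 2 + 255 * x ^ 3 - 312 * x ^ 4 + 375 * x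
      ^ 5 - 320 * x ^ 6 + 170 * x ^ 7 - 33 * x ^ 8 - 22 * x ^ 9 + 22 * x ^ 10 - 22 * x ^ 11 + 11 *
      x ^ 12 + y * (-11 + 55 * x - 110 * x ^ 2 + 143 * x ^ 3 - 165 * x ^ 4 + 143 * x ^ 5 - 99 * x
      ^ 6 + 88 * x ^ 7 - 66 * x ^ 8 + 55 * x ^ 9 - 55 * x ^ 10 + 33 * x ^ 11 - 22 * x ^ 12 + 11 *
      x ^ 13))) * hc
  have c7 : k * (E0 * C 7 + E1 * C 6 + E3 * C 4 + E4 * C 3 + E5 * C 2) + h * (E9 * C 9) = k * (δ *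
      T3) := by
    simp only [dE0, dE1, dE3, dE4, dE5, dE9, dT3, dδ, dh, dk, dC, compFive]
    linear_combination (x ^ 8 * (2 - 43 * x + 176 * x ^ 2 - 293 * x ^ 3 + 305 * x ^ 4 - 367 * x ^
      5 + 388 * x ^ 6 - 207 * x ^ 7 + 63 * x ^ 8 - 35 * x ^ 9 + 6 * x ^ 10 + 10 * x ^ 12 - 7 * x ^
      13 + 2 * x ^ 14 + y * (2 - 26 * x + 96 * x ^ 2 - 158 * x ^ 3 + 159 * x ^ 4 - 149 * x ^ 5 +
      100 * x ^ 6 - 16 * x ^ 7 + 2 * x ^ 8 + 7 * x ^ 9 - 33 * x ^ 10 + 16 * x ^ 11 - 7 * x ^ 12 +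
      12 * x ^ 13 - 7 * x ^ 14 + 2 * x ^ 15))) * hc
  have c8 : k * (E0 * C 8 + E1 * C 7 + E3 * C 5 + E4 * C 4 + E5 * C 3) + h * (E9 * C 10) = k * (δ
      * T4) := by
    simp only [dE0, dE1, dE3, dE4, dE5, dE9, dT4, dδ, dh, dk, dC, compFive]
    linear_combination (x ^ 9 * (17 - 108 * x + 235 * x ^ 2 - 259 * x ^ 3 + 302 * x ^ 4 - 421 * x
      ^ 5 + 297 * x ^ 6 - 61 * x ^ 7 + 31 * x ^ 8 - 11 * x ^ 9 - 42 * x ^ 10 + 11 * x ^ 11 + 7 * x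
      ^ 12 + 5 * x ^ 13 - 3 * x ^ 14 + y * (8 - 60 * x + 153 * x ^ 2 - 181 * x ^ 3 + 152 * x ^ 4 -
      145 * x ^ 5 + 70 * x ^ 6 - 9 * x ^ 7 + 52 * x ^ 8 - 27 * x ^ 9 - 35 * x ^ 11 + 16 * x ^ 12 +
      4 * x ^ 13 + 5 * x ^ 14 - 3 * x ^ 15))) * hc
  have c9 : k * (E0 * C 9 + E1 * C 8 + E3 * C 6 + E4 * C 5 + E5 * C 4 + E9 * C 0) = 0 := by
    simp only [dE0, dE1, dE3, dE4, dE5, dE9, dk, dC, compFive]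
    linear_combination (x ^ 9 * (-4 + 53 * x - 219 * x ^ 2 + 407 * x ^ 3 - 379 * x ^ 4 + 181 * x ^
      5 - 48 * x ^ 6 + 20 * x ^ 8 - 13 * x ^ 9 + 2 * x ^ 10)) * hc
  have c10 : k * (E0 * C 10 + E1 * C 9 + E3 * C 7 + E4 * C 6 + E5 * C 5 + E9 * C 1) = 0 := by
    simp only [dE0, dE1, dE3, dE4, dE5, dE9, dk, dC, compFive]
    linear_combination (x ^ 10 * (-12 + 103 * x - 358 * x ^ 2 + 664 * x ^ 3 - 717 * x ^ 4 + 445 *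
      x ^ 5 - 127 * x ^ 6 - 10 * x ^ 7 + 9 * x ^ 8 + 6 * x ^ 9 - 3 * x ^ 10)) * hc
  simp only [Finset.sum_range_succ, Finset.sum_range_zero]
  linear_combination ρ ^ 0 * c0 + ρ ^ 1 * c1 + ρ ^ 2 * c2 + ρ ^ 3 * c3 + ρ ^ 4 * c4 + ρ ^ 5 * c5 +
    ρ ^ 6 * c6 + ρ ^ 7 * c7 + ρ ^ 8 * c8 + ρ ^ 9 * c9 + ρ ^ 10 * c10 + (ρ ^ 0 * (E1 * C 10) + ρ ^
    0 * (E3 * C 8) + ρ ^ 1 * (E3 * C 9) + ρ ^ 2 * (E3 * C 10) + ρ ^ 0 * (E4 * C 7) + ρ ^ 1 * (E4 *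
    C 8) + ρ ^ 2 * (E4 * C 9) + ρ ^ 3 * (E4 * C 10) + ρ ^ 0 * (E5 * C 6) + ρ ^ 1 * (E5 * C 7) + ρ
    ^ 2 * (E5 * C 8) + ρ ^ 3 * (E5 * C 9) + ρ ^ 4 * (E5 * C 10) + ρ ^ 0 * (E9 * C 2) + ρ ^ 1 * (E9
    * C 3) + ρ ^ 2 * (E9 * C 4) + ρ ^ 3 * (E9 * C 5) + ρ ^ 4 * (E9 * C 6) + ρ ^ 5 * (E9 * C 7) + ρ
    ^ 6 * (E9 * C 8) + ρ ^ 7 * (E9 * C 9) + ρ ^ 8 * (E9 * C 10)) * hk - (ρ ^ 1 * (δ * T8)) * hk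

lemma cubic_coeffs {x y e₁ e₂ e₃ : ℂ} (hc : y ^ 2 + (x ^ 2 + 1) * y + x = 0)
    (hx : x ≠ 0) (hy : y ≠ 0) (hs : 1 - x ≠ 0) (hr : 1 + x * y ≠ 0)
    (c1 : ((1 - x) * x ^ 3 * y) ^ 3 - e₁ * ((1 - x) * x ^ 3 * y) ^ 2 + e₂ * ((1 - x) * x ^ 3 * y) -
        e₃ =
      -((1 + x * y) * (1 - x) * x ^ 4 * y) ^ 2 / 4)
    (c2 : (-((1 - x) * x ^ 4 * y ^ 2)) ^ 3 - e₁ * (-((1 - x) * x ^ 4 * y ^ 2)) ^ 2 + e₂ * (-((1 -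
        x) * x ^ 4 * y ^ 2)) - e₃ =
      -((1 + x * y) ^ 2 * (1 - x) ^ 4 * x ^ 10 * y ^ 4) / 4)
    (c3 : e₃ = x ^ 12 * y ^ 4 * (1 - x) ^ 2 / 4) :
    e₁ = x * y * (-1/4 + 5/4 * x ^ 2 - 3/2 * x ^ 3 + y * (-1/4 - 3/4 * x ^ 3 + 1/2 * x ^ 4 + 1/4 *
      x ^ 5)) ∧ e₂ = x ^ 7 * y ^ 2 * (1 - x) * (-1/2 + y * (-1 + 1/2 * x + 1/2 * x ^ 2)) := by
  have k1 : ((1 - x) * x ^ 3 * y) ^ 2 - e₁ * ((1 - x) * x ^ 3 * y) + e₂ =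
      (1 - x) * x ^ 5 * y * (x ^ 4 * y ^ 2 - (1 + x * y) ^ 2) / 4 := by
    refine mul_left_cancel₀ (mul_ne_zero (mul_ne_zero hs (pow_ne_zero 3 hx)) hy) ?_
    linear_combination c1 + c3
  have k2 : (-((1 - x) * x ^ 4 * y ^ 2)) ^ 2 - e₁ * (-((1 - x) * x ^ 4 * y ^ 2)) + e₂ =
      -((1 - x) * x ^ 6 * y ^ 2 * (x ^ 2 - (1 + x * y) ^ 2 * (1 - x) ^ 2)) / 4 := by
    refine mul_left_cancel₀ (neg_ne_zero.2
      (mul_ne_zero (mul_ne_zero hs (pow_ne_zero 4 hx)) (pow_ne_zero 2 hy))) ?_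
    linear_combination c2 + c3
  have k3 : e₁ = x * y * (-1/4 + 5/4 * x ^ 2 - 3/2 * x ^ 3 + y * (-1/4 - 3/4 * x ^ 3 + 1/2 *
      x ^ 4 + 1/4 * x ^ 5)) := by
    refine mul_left_cancel₀ (mul_ne_zero (mul_ne_zero (mul_ne_zero hs (pow_ne_zero 3 hx)) hy) hr) ?_
    linear_combination k2 - k1 - (x ^ 4 * y * (-1/4 + 1/4 * x + y * (-1/4 * x + 1/4 * x ^ 2))) *
      hc
  refine ⟨k3, ?_⟩
  linear_combination k1 + ((1 - x) * x ^ 3 * y) * k3 + (x ^ 4 * y * (-1/4 + 1/4 * x)) * hc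

lemma cubic_disc {x y e₁ e₂ e₃ : ℂ} (hc : y ^ 2 + (x ^ 2 + 1) * y + x = 0)
    (k1 : e₁ = x * y * (-1/4 + 5/4 * x ^ 2 - 3/2 * x ^ 3 + y * (-1/4 - 3/4 * x ^ 3 + 1/2 * x ^ 4 +
        1/4 * x ^ 5)))
    (k2 : e₂ = x ^ 7 * y ^ 2 * (1 - x) * (-1/2 + y * (-1 + 1/2 * x + 1/2 * x ^ 2)))
    (k3 : e₃ = x ^ 12 * y ^ 4 * (1 - x) ^ 2 / 4) :
    16 * (e₁ ^ 2 * e₂ ^ 2 - 4 * e₂ ^ 3 - 4 * e₁ ^ 3 * e₃ - 27 * e₃ ^ 2 + 18 * e₁ * e₂ * e₃) =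
      x ^ 17 * y ^ 6 * (1 + x * y) ^ 3 * (1 - x) ^ 4 * (-1 + x + 9 * x ^ 2 - 11 * x ^ 3 + y * (-1 +
          9 * x ^ 2 - 3 * x ^ 3 - 5 * x ^ 4 - x ^ 5)) := by
  subst k1 k2 k3
  linear_combination (x ^ 15 * y ^ 6 * (1/4 + 1/2 * x - 29/4 * x ^ 2 + 9 * x ^ 3 + 139/4 * x ^ 4 -
      219/2 * x ^ 5 + 489/4 * x ^ 6 - 62 * x ^ 7 + 12 * x ^ 8 + y * (1/2 + x - 9 * x ^ 2 + 15/2 *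
      x ^ 3 + 73/2 * x ^ 4 - 183/2 * x ^ 5 + 81 * x ^ 6 - 63/2 * x ^ 7 + 13 * x ^ 8 - 23/2 * x ^ 9
      + 4 * x ^ 10) + y ^ 2 * (1/4 + 1/2 * x - 11/4 * x ^ 2 + 9/2 * x ^ 3 + x ^ 4 - 18 * x ^ 5 +
      105/4 * x ^ 6 - 14 * x ^ 7 + 7/4 * x ^ 8 + 2 * x ^ 9 - 9/4 * x ^ 10 + 1/2 * x ^ 11 + 1/4 * x
      ^ 12))) * hc

lemma disc_normal_form {ρ x y : ℂ} (hc : y ^ 2 + (x ^ 2 + 1) * y + x = 0)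
    (hR : ρ ^ 11 * ((1 + x * y) * (1 - x) * x ^ 4 * y) = -1) :
    ρ ^ 44 * (x ^ 17 * y ^ 6 * (1 + x * y) ^ 3 * (1 - x) ^ 4 * (-1 + x + 9 * x ^ 2 - 11 * x ^ 3 +
        y * (-1 + 9 * x ^ 2 - 3 * x ^ 3 - 5 * x ^ 4 - x ^ 5))) * (1 - x) =
      x ^ 3 * (-1 + 8 * x ^ 2 - 5 * x ^ 3 - x ^ 4 + y * (-1 - x + 7 * x ^ 2 + x ^ 3 - 4 * x ^ 4 -
          x ^ 5)) := by
  linear_combination ρ ^ 44 * (x ^ 17 * y ^ 4 * (x - 4 * x ^ 2 - 2 * x ^ 3 + 33 * x ^ 4 - 66 * x ^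
      5 + 58 * x ^ 6 - 22 * x ^ 7 + x ^ 8 + x ^ 9 + y * (-1 + 5 * x + 2 * x ^ 2 - 50 * x ^ 3 + 89
      * x ^ 4 + 4 * x ^ 5 - 168 * x ^ 6 + 190 * x ^ 7 - 78 * x ^ 8 + 3 * x ^ 9 + 4 * x ^ 10) + y ^
      2 * (-3 * x + 15 * x ^ 2 - 126 * x ^ 4 + 279 * x ^ 5 - 186 * x ^ 6 - 108 * x ^ 7 + 222 * x ^
      8 - 102 * x ^ 9 + 3 * x ^ 10 + 6 * x ^ 11) + y ^ 3 * (-3 * x ^ 2 + 15 * x ^ 3 - 2 * x ^ 4 -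
      118 * x ^ 5 + 283 * x ^ 6 - 252 * x ^ 7 + 24 * x ^ 8 + 106 * x ^ 9 - 58 * x ^ 10 + x ^ 11 +
      4 * x ^ 12) + y ^ 4 * (-x ^ 3 + 5 * x ^ 4 - x ^ 5 - 38 * x ^ 6 + 95 * x ^ 7 - 95 * x ^ 8 +
      30 * x ^ 9 + 16 * x ^ 10 - 12 * x ^ 11 + x ^ 13))) * hc - (x ^ 3 * (-1 + 8 * x ^ 2 - 5 * x ^
      3 - x ^ 4 + y * (-1 - x + 7 * x ^ 2 + x ^ 3 - 4 * x ^ 4 - x ^ 5))) * (1 + -(ρ ^ 11 * ((1 + x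
      * y) * (1 - x) * x ^ 4 * y)) + (-(ρ ^ 11 * ((1 + x * y) * (1 - x) * x ^ 4 * y))) ^ 2 + (-(ρ
      ^ 11 * ((1 + x * y) * (1 - x) * x ^ 4 * y))) ^ 3) * hR

lemma thetaNorm_disc {ρ x y a1 a2 a3 a4 a5 : ℂ}
    (hc : y ^ 2 + (x ^ 2 + 1) * y + x = 0)
    (hR : ρ ^ 11 * ((1 + x * y) * (1 - x) * x ^ 4 * y) = -1)
    (h1 : a1 = a3 * ρ * x) (h2 : a2 = a3 * ρ ^ 2 * x)
    (h4 : a4 = -(a3 * (1 - x) * x ^ 2 * y * ρ ^ 6)) (h5 : a5 = a3 * (1 - x) * x ^ 3 * y ^ 2 * ρ ^ 9)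
    (n1 : a1 ≠ 0) (n2 : a2 ≠ 0) (n3 : a3 ≠ 0) (n4 : a4 ≠ 0) (n5 : a5 ≠ 0)
    {v₁ v₂ v₃ : ℂ}
    (w1 : (-a4 * a2 / (a1 ^ 2 * a3 ^ 2) - v₁) * (-a4 * a2 / (a1 ^ 2 * a3 ^ 2) - v₂) *
      (-a4 * a2 / (a1 ^ 2 * a3 ^ 2) - v₃) = -a2 ^ 2 / (4 * a1 ^ 8))
    (w2 : (-a5 * a1 / (a2 ^ 2 * a3 ^ 2) - v₁) * (-a5 * a1 / (a2 ^ 2 * a3 ^ 2) - v₂) *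
      (-a5 * a1 / (a2 ^ 2 * a3 ^ 2) - v₃) = -a4 ^ 2 / (4 * a2 ^ 8))
    (w3 : (0 - v₁) * (0 - v₂) * (0 - v₃) = -a5 ^ 2 / (4 * a3 ^ 8)) :
    16 * ((v₁ - v₂) * (v₁ - v₃) * (v₂ - v₃)) ^ 2 * a1 ^ 12 * (1 - x) =
      ρ ^ 4 * (x ^ 3 * (-1 + 8 * x ^ 2 - 5 * x ^ 3 - x ^ 4 + y * (-1 - x + 7 * x ^ 2 + x ^ 3 - 4 *
          x ^ 4 - x ^ 5))) := by
  have hρ : ρ ≠ 0 := by rintro rfl; simp at h1; exact n1 h1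
  have hx : x ≠ 0 := by rintro rfl; simp at h1; exact n1 h1
  have hy : y ≠ 0 := by rintro rfl; simp at h4; exact n4 h4
  have hs : 1 - x ≠ 0 := by intro h; simp [h] at h4; exact n4 h4
  have hr : 1 + x * y ≠ 0 := by intro h; simp [h] at hR
  have t1 : -a4 * a2 / (a1 ^ 2 * a3 ^ 2) * a1 ^ 2 = ρ ^ 8 * ((1 - x) * x ^ 3 * y) := by
    rw [div_mul_eq_mul_div, div_eq_iff (by simp [n1, n3])]
    subst h1 h2 h4 h5
    ring
  have t2 : -a5 * a1 / (a2 ^ 2 * a3 ^ 2) * a1 ^ 2 = ρ ^ 8 * (-((1 - x) * x ^ 4 * y ^ 2)) := by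
    rw [div_mul_eq_mul_div, div_eq_iff (by simp [n2, n3])]
    subst h1 h2 h4 h5
    ring
  have t3 : -a2 ^ 2 / (4 * a1 ^ 8) * a1 ^ 6 =
      ρ ^ 24 * (-((1 + x * y) * (1 - x) * x ^ 4 * y) ^ 2 / 4) := by
    rw [div_mul_eq_mul_div, div_eq_iff (by simp [n1])]
    subst h1 h2 h4 h5
    linear_combination 4 * ((a3 ^ 8 * ρ ^ 10) * (x ^ 8 * (-1/4)) * (1 + (-(ρ ^ 11 * ((1 + x * y) *
      (1 - x) * x ^ 4 * y))) ^ 1) * hR)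
  have t4 : -a4 ^ 2 / (4 * a2 ^ 8) * a1 ^ 6 =
      ρ ^ 24 * (-((1 + x * y) ^ 2 * (1 - x) ^ 4 * x ^ 10 * y ^ 4) / 4) := by
    rw [div_mul_eq_mul_div, div_eq_iff (by simp [n2])]
    subst h1 h2 h4 h5
    linear_combination 4 * ((a3 ^ 8 * ρ ^ 18) * (x ^ 10 * y ^ 2 * (-1/4 + 1/2 * x - 1/4 * x ^ 2))
      * (1 + (-(ρ ^ 11 * ((1 + x * y) * (1 - x) * x ^ 4 * y))) ^ 1) * hR)
  have t5 : -a5 ^ 2 / (4 * a3 ^ 8) * a1 ^ 6 = ρ ^ 24 * (-(x ^ 12 * y ^ 4 * (1 - x) ^ 2 / 4)) := by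
    rw [div_mul_eq_mul_div, div_eq_iff (by simp [n3])]
    subst h1 h2 h4 h5
    ring
  have sub : ∀ v : ℂ, ∃ w, v * a1 ^ 2 = ρ ^ 8 * w := fun v =>
    ⟨v * a1 ^ 2 / ρ ^ 8, by field_simp⟩
  obtain ⟨u₁, s1⟩ := sub v₁
  obtain ⟨u₂, s2⟩ := sub v₂
  obtain ⟨u₃, s3⟩ := sub v₃
  have scale : ∀ {X F p f : ℂ}, X * a1 ^ 2 = ρ ^ 8 * p → F * a1 ^ 6 = ρ ^ 24 * f →
      (X - v₁) * (X - v₂) * (X - v₃) = F →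
      p ^ 3 - (u₁ + u₂ + u₃) * p ^ 2 + (u₁ * u₂ + u₁ * u₃ + u₂ * u₃) * p - u₁ * u₂ * u₃ = f := by
    intro X F p f hX hF h
    refine mul_left_cancel₀ (pow_ne_zero 24 hρ) ?_
    rw [← hF, ← h, show ∀ A B C : ℂ, A * B * C * a1 ^ 6 = A * a1 ^ 2 * (B * a1 ^ 2) * (C *
        a1 ^ 2) by
      intros; ring, sub_mul X v₁, sub_mul X v₂, sub_mul X v₃, hX, s1, s2, s3]
    ring
  have m3 := scale (X := 0) (p := 0) (by simp) t5 w3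
  have c3 : u₁ * u₂ * u₃ = x ^ 12 * y ^ 4 * (1 - x) ^ 2 / 4 := by linear_combination -m3
  obtain ⟨k1, k2⟩ := cubic_coeffs hc hx hy hs hr (scale t1 t3 w1) (scale t2 t4 w2) c3
  have hd : 16 * ((v₁ - v₂) * (v₁ - v₃) * (v₂ - v₃)) ^ 2 * a1 ^ 12 =
      ρ ^ 48 * (16 * ((u₁ - u₂) * (u₁ - u₃) * (u₂ - u₃)) ^ 2) := by
    rw [show ∀ A B C : ℂ, 16 * (A * B * C) ^ 2 * a1 ^ 12 =
      16 * (A * a1 ^ 2 * (B * a1 ^ 2) * (C * a1 ^ 2)) ^ 2 by intros; ring, sub_mul v₁ v₂,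
      sub_mul v₁ v₃, sub_mul v₂ v₃, s1, s2, s3]
    ring
  linear_combination (1 - x) * hd + ρ ^ 48 * (1 - x) * cubic_disc hc k1 k2 c3 +
    ρ ^ 4 * disc_normal_form hc hR

lemma compZero_eight {ρ x y a1 a2 a3 a4 a5 : ℂ}
    (hc : y ^ 2 + (x ^ 2 + 1) * y + x = 0)
    (hR : ρ ^ 11 * ((1 + x * y) * (1 - x) * x ^ 4 * y) = -1)
    (h1 : a1 = a3 * ρ * x) (h2 : a2 = a3 * ρ ^ 2 * x)
    (h4 : a4 = -(a3 * (1 - x) * x ^ 2 * y * ρ ^ 6)) (h5 : a5 = a3 * (1 - x) * x ^ 3 * y ^ 2 * ρ ^ 9)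
    (n1 : a1 ≠ 0) (n2 : a2 ≠ 0) (n3 : a3 ≠ 0) (n4 : a4 ≠ 0) (n5 : a5 ≠ 0) :
    ρ ^ 8 * compZero x y 8 = 22 * (1 / (a1 ^ 2 * a2 ^ 4 * a3 ^ 2 * a4 ^ 2 * a5 ^ 3) + 1 / (a1 ^ 2
      * a2 * a3 ^ 4 * a4 ^ 3 * a5 ^ 3)) * (a1 ^ 13 * (1 - x)) := by
  have e0 : 1 / (a1 ^ 2 * a2 ^ 4 * a3 ^ 2 * a4 ^ 2 * a5 ^ 3) * (a1 ^ 13 * (1 - x)) = ρ ^ 8 *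
      (x ^ 6 * (1 - 3 * x + x ^ 2 + 2 * x ^ 3 - x ^ 5 + y * (1 - 2 * x - x ^ 2 + 2 * x ^ 3 +
      x ^ 4 - x ^ 6))) := by
    rw [div_mul_eq_mul_div, div_eq_iff (by simp [n1, n2, n3, n4, n5])]
    subst h1 h2 h4 h5
    linear_combination -(a3 ^ 13 * ρ ^ 13 * ρ ^ 44) * (x ^ 25 * y ^ 4 * (-x ^ 3 + 5 * x ^ 4 - 10 *
      x ^ 5 + 10 * x ^ 6 - 5 * x ^ 7 + x ^ 8 + y * (x ^ 2 - 5 * x ^ 3 + 7 * x ^ 4 + 5 * x ^ 5 - 25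
      * x ^ 6 + 29 * x ^ 7 - 15 * x ^ 8 + 3 * x ^ 9) + y ^ 2 * (-x + 6 * x ^ 2 - 13 * x ^ 3 + 10 *
      x ^ 4 + 2 * x ^ 5 + x ^ 6 - 21 * x ^ 7 + 28 * x ^ 8 - 15 * x ^ 9 + 3 * x ^ 10) + y ^ 3 * (1
      - 7 * x + 19 * x ^ 2 - 23 * x ^ 3 + 6 * x ^ 4 + 14 * x ^ 5 - 14 * x ^ 6 + 6 * x ^ 7 - 7 * x
      ^ 8 + 9 * x ^ 9 - 5 * x ^ 10 + x ^ 11))) * hc + (a3 ^ 13 * ρ ^ 13) * (x ^ 13 * (1 - x)) * (1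
      + (-(ρ ^ 11 * ((1 + x * y) * (1 - x) * x ^ 4 * y))) ^ 1 + (-(ρ ^ 11 * ((1 + x * y) * (1 - x)
      * x ^ 4 * y))) ^ 2 + (-(ρ ^ 11 * ((1 + x * y) * (1 - x) * x ^ 4 * y))) ^ 3) * hR
  have e1 : 1 / (a1 ^ 2 * a2 * a3 ^ 4 * a4 ^ 3 * a5 ^ 3) * (a1 ^ 13 * (1 - x)) = ρ ^ 8 * (x ^ 6 *
      (1 - 3 * x + x ^ 2 + x ^ 3 + y * (1 - 2 * x - x ^ 2 + x ^ 3 + x ^ 4))) := by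
    rw [div_mul_eq_mul_div, div_eq_iff (by simp [n1, n2, n3, n4, n5])]
    subst h1 h2 h4 h5
    linear_combination -(a3 ^ 13 * ρ ^ 13 * ρ ^ 44) * (x ^ 24 * y ^ 4 * (-x ^ 4 + 5 * x ^ 5 - 10 *
      x ^ 6 + 10 * x ^ 7 - 5 * x ^ 8 + x ^ 9 + y * (x ^ 3 - 5 * x ^ 4 + 7 * x ^ 5 + 5 * x ^ 6 - 25
      * x ^ 7 + 29 * x ^ 8 - 15 * x ^ 9 + 3 * x ^ 10) + y ^ 2 * (-x ^ 2 + 6 * x ^ 3 - 13 * x ^ 4 +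
      10 * x ^ 5 + 2 * x ^ 6 + x ^ 7 - 21 * x ^ 8 + 28 * x ^ 9 - 15 * x ^ 10 + 3 * x ^ 11) + y ^ 3
      * (x - 7 * x ^ 2 + 19 * x ^ 3 - 23 * x ^ 4 + 6 * x ^ 5 + 14 * x ^ 6 - 14 * x ^ 7 + 6 * x ^ 8
      - 7 * x ^ 9 + 9 * x ^ 10 - 5 * x ^ 11 + x ^ 12) + y ^ 4 * (-1 + 8 * x - 26 * x ^ 2 + 43 * x
      ^ 3 - 35 * x ^ 4 + 7 * x ^ 5 + 7 * x ^ 6 + x ^ 7 - 8 * x ^ 8 + 5 * x ^ 9 - x ^ 10))) * hc +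
      (a3 ^ 13 * ρ ^ 13) * (x ^ 13 * (1 - x)) * (1 + (-(ρ ^ 11 * ((1 + x * y) * (1 - x) * x ^ 4 *
      y))) ^ 1 + (-(ρ ^ 11 * ((1 + x * y) * (1 - x) * x ^ 4 * y))) ^ 2 + (-(ρ ^ 11 * ((1 + x * y)
      * (1 - x) * x ^ 4 * y))) ^ 3) * hR
  simp only [compZero]
  linear_combination (-22) * e0 + (-22) * e1 + ρ ^ 8 * (0) * hc

lemma compFive_eight {ρ x y a1 a2 a3 a4 a5 : ℂ}
    (hc : y ^ 2 + (x ^ 2 + 1) * y + x = 0)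
    (hR : ρ ^ 11 * ((1 + x * y) * (1 - x) * x ^ 4 * y) = -1)
    (h1 : a1 = a3 * ρ * x) (h2 : a2 = a3 * ρ ^ 2 * x)
    (h4 : a4 = -(a3 * (1 - x) * x ^ 2 * y * ρ ^ 6)) (h5 : a5 = a3 * (1 - x) * x ^ 3 * y ^ 2 * ρ ^ 9)
    (n1 : a1 ≠ 0) (n2 : a2 ≠ 0) (n3 : a3 ≠ 0) (n4 : a4 ≠ 0) (n5 : a5 ≠ 0) :
    ρ ^ 8 * compFive x y 8 = -11 * (1 / (a1 ^ 2 * a2 ^ 2 * a3 ^ 2 * a4 ^ 3 * a5 ^ 4) + 1 / (a1 ^ 3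
      * a2 ^ 2 * a3 ^ 2 * a4 ^ 4 * a5 ^ 2) + 1 / (a1 ^ 2 * a2 ^ 3 * a3 ^ 4 * a4 ^ 2 * a5 ^ 2)) *
      (a1 ^ 13 * (1 - x)) := by
  have e0 : 1 / (a1 ^ 2 * a2 ^ 2 * a3 ^ 2 * a4 ^ 3 * a5 ^ 4) * (a1 ^ 13 * (1 - x)) = ρ ^ 8 *
      (x ^ 5 * (1 - 4 * x + 3 * x ^ 2 + 2 * x ^ 3 - x ^ 4 - x ^ 5 + y * (1 - 3 * x + 3 * x ^ 3 +
      x ^ 4 - x ^ 5 - x ^ 6))) := by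
    rw [div_mul_eq_mul_div, div_eq_iff (by simp [n1, n2, n3, n4, n5])]
    subst h1 h2 h4 h5
    linear_combination -(a3 ^ 13 * ρ ^ 13 * ρ ^ 55) * (x ^ 27 * y ^ 5 * (x ^ 5 - 6 * x ^ 6 + 15 *
      x ^ 7 - 20 * x ^ 8 + 15 * x ^ 9 - 6 * x ^ 10 + x ^ 11 + y * (-x ^ 4 + 6 * x ^ 5 - 11 * x ^ 6
      - 4 * x ^ 7 + 45 * x ^ 8 - 74 * x ^ 9 + 59 * x ^ 10 - 24 * x ^ 11 + 4 * x ^ 12) + y ^ 2 * (x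
      ^ 3 - 7 * x ^ 4 + 18 * x ^ 5 - 17 * x ^ 6 - 4 * x ^ 7 + 3 * x ^ 8 + 52 * x ^ 9 - 103 * x ^
      10 + 87 * x ^ 11 - 36 * x ^ 12 + 6 * x ^ 13) + y ^ 3 * (-x ^ 2 + 8 * x ^ 3 - 25 * x ^ 4 + 35
      * x ^ 5 - 10 * x ^ 6 - 31 * x ^ 7 + 36 * x ^ 8 - 19 * x ^ 9 + 35 * x ^ 10 - 65 * x ^ 11 + 57
      * x ^ 12 - 24 * x ^ 13 + 4 * x ^ 14) + y ^ 4 * (x - 9 * x ^ 2 + 33 * x ^ 3 - 61 * x ^ 4 + 52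
      * x ^ 5 - 29 * x ^ 7 - 2 * x ^ 8 + 37 * x ^ 9 - 33 * x ^ 10 + 19 * x ^ 11 - 17 * x ^ 12 + 14
      * x ^ 13 - 6 * x ^ 14 + x ^ 15) + y ^ 5 * (-1 + 10 * x - 42 * x ^ 2 + 95 * x ^ 3 - 120 * x ^
      4 + 71 * x ^ 5 + 8 * x ^ 6 - 34 * x ^ 7 + 11 * x ^ 8 + 10 * x ^ 10 - 13 * x ^ 11 + 6 * x ^
      12 - x ^ 13))) * hc + (a3 ^ 13 * ρ ^ 13) * (x ^ 13 * (1 - x)) * (1 + (-(ρ ^ 11 * ((1 + x *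
      y) * (1 - x) * x ^ 4 * y))) ^ 1 + (-(ρ ^ 11 * ((1 + x * y) * (1 - x) * x ^ 4 * y))) ^ 2 +
      (-(ρ ^ 11 * ((1 + x * y) * (1 - x) * x ^ 4 * y))) ^ 3 + (-(ρ ^ 11 * ((1 + x * y) * (1 - x) *
      x ^ 4 * y))) ^ 4) * hR
  have e1 : 1 / (a1 ^ 3 * a2 ^ 2 * a3 ^ 2 * a4 ^ 4 * a5 ^ 2) * (a1 ^ 13 * (1 - x)) = ρ ^ 8 *
      (x ^ 6 * (1 - 2 * x - x ^ 2 + x ^ 3 + x ^ 4 + y * (1 - x - 2 * x ^ 2 + x ^ 4 + x ^ 5))) := by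
    rw [div_mul_eq_mul_div, div_eq_iff (by simp [n1, n2, n3, n4, n5])]
    subst h1 h2 h4 h5
    linear_combination -(a3 ^ 13 * ρ ^ 13 * ρ ^ 44) * (x ^ 25 * y ^ 4 * (-x ^ 3 + 5 * x ^ 4 - 10 *
      x ^ 5 + 10 * x ^ 6 - 5 * x ^ 7 + x ^ 8 + y * (x ^ 2 - 5 * x ^ 3 + 7 * x ^ 4 + 5 * x ^ 5 - 25
      * x ^ 6 + 29 * x ^ 7 - 15 * x ^ 8 + 3 * x ^ 9) + y ^ 2 * (-x + 6 * x ^ 2 - 13 * x ^ 3 + 10 *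
      x ^ 4 + 2 * x ^ 5 + x ^ 6 - 21 * x ^ 7 + 28 * x ^ 8 - 15 * x ^ 9 + 3 * x ^ 10) + y ^ 3 * (1
      - 7 * x + 19 * x ^ 2 - 23 * x ^ 3 + 6 * x ^ 4 + 14 * x ^ 5 - 14 * x ^ 6 + 6 * x ^ 7 - 7 * x
      ^ 8 + 9 * x ^ 9 - 5 * x ^ 10 + x ^ 11))) * hc + (a3 ^ 13 * ρ ^ 13) * (x ^ 13 * (1 - x)) * (1
      + (-(ρ ^ 11 * ((1 + x * y) * (1 - x) * x ^ 4 * y))) ^ 1 + (-(ρ ^ 11 * ((1 + x * y) * (1 - x)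
      * x ^ 4 * y))) ^ 2 + (-(ρ ^ 11 * ((1 + x * y) * (1 - x) * x ^ 4 * y))) ^ 3) * hR
  have e2 : 1 / (a1 ^ 2 * a2 ^ 3 * a3 ^ 4 * a4 ^ 2 * a5 ^ 2) * (a1 ^ 13 * (1 - x)) = ρ ^ 8 *
      (x ^ 7 * (1 - 2 * x + x ^ 3 + y * (1 - x - x ^ 2 + x ^ 4))) := by
    rw [div_mul_eq_mul_div, div_eq_iff (by simp [n1, n2, n3, n4, n5])]
    subst h1 h2 h4 h5
    linear_combination -(a3 ^ 13 * ρ ^ 13 * ρ ^ 33) * (x ^ 22 * y ^ 3 * (x ^ 2 - 4 * x ^ 3 + 6 * x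
      ^ 4 - 4 * x ^ 5 + x ^ 6 + y * (-x + 4 * x ^ 2 - 4 * x ^ 3 - 4 * x ^ 4 + 11 * x ^ 5 - 8 * x ^
      6 + 2 * x ^ 7) + y ^ 2 * (1 - 5 * x + 9 * x ^ 2 - 6 * x ^ 3 - x ^ 5 + 5 * x ^ 6 - 4 * x ^ 7
      + x ^ 8))) * hc + (a3 ^ 13 * ρ ^ 13) * (x ^ 13 * (1 - x)) * (1 + (-(ρ ^ 11 * ((1 + x * y) *
      (1 - x) * x ^ 4 * y))) ^ 1 + (-(ρ ^ 11 * ((1 + x * y) * (1 - x) * x ^ 4 * y))) ^ 2) * hR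
  simp only [compFive]
  linear_combination (11) * e0 + (11) * e1 + (11) * e2 + ρ ^ 8 * (0) * hc

lemma thetaNorm_param {a1 a2 a3 a4 a5 : ℂ}
    (n1 : a1 ≠ 0) (n2 : a2 ≠ 0) (n3 : a3 ≠ 0) (n4 : a4 ≠ 0) (n5 : a5 ≠ 0)
    (r1 : a5 * a3 * a2 ^ 2 = a3 * a1 * a4 ^ 2 + a5 * a2 * a1 ^ 2)
    (r2 : a4 * a2 ^ 3 = a5 * a1 ^ 3 + a1 * a3 ^ 3)
    (r3 : a5 * a4 * a2 ^ 2 = a3 * a1 * a5 ^ 2 + a4 * a3 * a1 ^ 2) :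
    ∃ ρ x y : ℂ, ρ = a2 / a1 ∧ x = a1 ^ 2 / (a2 * a3) ∧ y = -(a1 * a3 * a5) / (a2 ^ 2 * a4) ∧
      y ^ 2 + (x ^ 2 + 1) * y + x = 0 ∧
      ρ ^ 11 * ((1 + x * y) * (1 - x) * x ^ 4 * y) = -1 ∧
      a1 = a3 * ρ * x ∧ a2 = a3 * ρ ^ 2 * x ∧ a4 = -(a3 * (1 - x) * x ^ 2 * y * ρ ^ 6) ∧
      a5 = a3 * (1 - x) * x ^ 3 * y ^ 2 * ρ ^ 9 := by
  obtain ⟨ρ, hρ⟩ : ∃ ρ, ρ = a2 / a1 := ⟨_, rfl⟩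
  obtain ⟨x, hx⟩ : ∃ x, x = a1 ^ 2 / (a2 * a3) := ⟨_, rfl⟩
  obtain ⟨y, hy⟩ : ∃ y, y = -(a1 * a3 * a5) / (a2 ^ 2 * a4) := ⟨_, rfl⟩
  have s1 : 1 - x = a1 * a4 ^ 2 / (a2 ^ 2 * a5) := by
    rw [hx]; field_simp; linear_combination r1
  have s2 : 1 + x * y = a1 * a3 ^ 3 / (a2 ^ 3 * a4) := by
    rw [hx, hy]; field_simp; linear_combination r2
  have s3 : 1 + y = a1 ^ 2 * a3 / (a2 ^ 2 * a5) := by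
    rw [hy]; field_simp; linear_combination r3
  refine ⟨ρ, x, y, hρ, hx, hy, ?_, ?_, ?_, ?_, ?_, ?_⟩
  · have : y ^ 2 + (x ^ 2 + 1) * y + x = y * (1 + y) + x * (1 + x * y) := by ring
    rw [this, s2, s3, hx, hy]; field_simp; ring
  · rw [s2, s1, hρ, hx, hy]; field_simp
  · rw [hρ, hx]; field_simp
  · rw [hρ, hx]; field_simp
  · rw [s1, hρ, hx, hy]; field_simp
  · rw [s1, hρ, hx, hy]; field_simp

lemma thetaNorm_relations {q : ℂ} (hq : ‖q‖ < 1) (h0 : q ≠ 0) :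
    thetaNorm q 5 * thetaNorm q 3 * thetaNorm q 2 ^ 2 =
        thetaNorm q 3 * thetaNorm q 1 * thetaNorm q 4 ^ 2 +
          thetaNorm q 5 * thetaNorm q 2 * thetaNorm q 1 ^ 2 ∧
      thetaNorm q 4 * thetaNorm q 2 ^ 3 =
        thetaNorm q 5 * thetaNorm q 1 ^ 3 + thetaNorm q 1 * thetaNorm q 3 ^ 3 ∧
      thetaNorm q 5 * thetaNorm q 4 * thetaNorm q 2 ^ 2 =
        thetaNorm q 3 * thetaNorm q 1 * thetaNorm q 5 ^ 2 +
          thetaNorm q 4 * thetaNorm q 3 * thetaNorm q 1 ^ 2 := by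
  have e6 : thetaNorm q 6 = thetaNorm q 5 := thetaNorm_eleven_sub h0 5
  have e7 : thetaNorm q 7 = thetaNorm q 4 := thetaNorm_eleven_sub h0 4
  have m1 : thetaNorm q (-1) = -thetaNorm q 1 := thetaNorm_neg hq h0 1
  have m2 : thetaNorm q (-2) = -thetaNorm q 2 := thetaNorm_neg hq h0 2
  have A := thetaNorm_three_term hq h0 (i := 4) (j := 2) (k := 1)
    (by decide) (by decide) (by decide) (by decide)
  have B := thetaNorm_three_term hq h0 (i := 1) (j := 2) (k := 3)
    (by decide) (by decide) (by decide) (by decide)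
  have C := thetaNorm_three_term hq h0 (i := 5) (j := 2) (k := 1)
    (by decide) (by decide) (by decide) (by decide)
  norm_num [e6, e7, m1, m2] at A B C
  refine ⟨A, ?_, C⟩
  linear_combination -B

lemma weier_rhs_eq_thetaNorm {q : ℂ} (hq : ‖q‖ < 1) (h0 : q ≠ 0) {k : ℤ} (hk : ¬ (11 : ℤ) ∣ k) :
    -(((q ^ 22) ^ k) ^ 2 * thetaQ ((q ^ 121) ^ 2) (((q ^ 22) ^ k) ^ 2) ^ 2) /
        (4 * thetaQ ((q ^ 121) ^ 2) ((q ^ 22) ^ k) ^ 8) =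
      q ^ 60 * (-thetaNorm q (2 * k) ^ 2 / (4 * thetaNorm q k ^ 8)) := by
  have e2 : ((q ^ 22) ^ k) ^ 2 = (q ^ 22) ^ (2 * k) := by
    rw [← zpow_natCast, ← zpow_mul, mul_comm]; rfl
  have hθ : theta11 q k ≠ 0 := theta11_ne_zero hq h0 hk
  rw [e2]
  change -((q ^ 22) ^ (2 * k) * theta11 q (2 * k) ^ 2) / (4 * theta11 q k ^ 8) = _
  rw [thetaNorm, thetaNorm, zpow_twentytwo, mul_pow, mul_pow, ← zpow_natCast (q ^ _),
    ← zpow_natCast (q ^ ((k - 1) * (k - 10))), ← zpow_mul, ← zpow_mul]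
  have e : q ^ (22 * (2 * k)) * q ^ ((k - 1) * (k - 10) * (8 : ℕ)) =
      q ^ 60 * q ^ ((2 * k - 1) * (2 * k - 10) * (2 : ℕ)) := by
    rw [← zpow_natCast q 60, ← zpow_add₀ h0, ← zpow_add₀ h0]
    congr 1
    push_cast
    ring
  have z1 := zpow_ne_zero ((k - 1) * (k - 10) * (8 : ℕ)) h0
  rw [← mul_div_assoc, div_eq_div_iff (by simp [hθ])
    (mul_ne_zero (by norm_num) (mul_ne_zero z1 (pow_ne_zero _ hθ)))]
  linear_combination (-4 * theta11 q (2 * k) ^ 2 * theta11 q k ^ 8) * e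

lemma thetaNorm_disc_param {q : ℂ} (hq : ‖q‖ < 1) (h0 : q ≠ 0) {ρ x y : ℂ}
    (hc : y ^ 2 + (x ^ 2 + 1) * y + x = 0)
    (hR : ρ ^ 11 * ((1 + x * y) * (1 - x) * x ^ 4 * y) = -1)
    (h1 : thetaNorm q 1 = thetaNorm q 3 * ρ * x) (h2 : thetaNorm q 2 = thetaNorm q 3 * ρ ^ 2 * x)
    (h4 : thetaNorm q 4 = -(thetaNorm q 3 * (1 - x) * x ^ 2 * y * ρ ^ 6))
    (h5 : thetaNorm q 5 = thetaNorm q 3 * (1 - x) * x ^ 3 * y ^ 2 * ρ ^ 9) :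
    q ^ 122 * thetaNorm q 1 ^ 12 * (1 - x) =
      ρ ^ 4 * (x ^ 3 * (-1 + 8 * x ^ 2 - 5 * x ^ 3 - x ^ 4 +
        y * (-1 - x + 7 * x ^ 2 + x ^ 3 - 4 * x ^ 4 - x ^ 5))) := by
  have nz : ∀ k : ℤ, ¬ (11 : ℤ) ∣ k → thetaNorm q k ≠ 0 := fun k hk => thetaNorm_ne_zero hq h0 hk
  have n1 := nz 1 (by decide)
  have n2 := nz 2 (by decide)
  have n3 := nz 3 (by decide)
  have n4 := nz 4 (by decide)
  have n5 := nz 5 (by decide)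
  have e6 : thetaNorm q 6 = thetaNorm q 5 := thetaNorm_eleven_sub h0 5
  have m1 : thetaNorm q (-1) = -thetaNorm q 1 := thetaNorm_neg hq h0 1
  have m2 : thetaNorm q (-2) = -thetaNorm q 2 := thetaNorm_neg hq h0 2
  have z0 : thetaNorm q 0 = 0 := by
    have := thetaNorm_neg hq h0 0
    rw [neg_zero] at this
    exact self_eq_neg.mp this
  have ht : q ^ 22 ≠ 0 := pow_ne_zero _ h0
  obtain ⟨w₁, w₂, w₃, hd, hw⟩ := exists_weierDiff_cubic (κ := q ^ 121) (y := (q ^ 22) ^ (3 : ℤ))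
    (norm_pow_lt_one hq (by norm_num)) (pow_ne_zero _ h0) (zpow_ne_zero _ ht)
    (by
      have e : ((q ^ 22) ^ (3 : ℤ)) ^ 2 = (q ^ 22) ^ (6 : ℤ) := by
        rw [← zpow_natCast ((q ^ 22) ^ (3 : ℤ)), ← zpow_mul]; rfl
      rw [e]; exact theta11_ne_zero hq h0 (k := 6) (by decide))
  have hv : ∀ k : ℤ, ¬ (11 : ℤ) ∣ k → ∀ X : ℂ, X = thetaNorm q (k + 3) * thetaNorm q (k - 3) /
      (thetaNorm q k ^ 2 * thetaNorm q 3 ^ 2) →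
      (X - w₁ / q ^ 20) * (X - w₂ / q ^ 20) * (X - w₃ / q ^ 20) =
        -thetaNorm q (2 * k) ^ 2 / (4 * thetaNorm q k ^ 8) := by
    intro k hk X hX
    have h := hw ((q ^ 22) ^ k) (zpow_ne_zero _ ht) (theta11_ne_zero hq h0 hk)
    rw [weierDiff_eq_thetaNorm h0, ← hX, weier_rhs_eq_thetaNorm hq h0 hk] at h
    have hf : ∀ w : ℂ, X - w / q ^ 20 = (q ^ 20 * X - w) / q ^ 20 := fun w => by field_simp
    rw [hf, hf, hf, div_mul_div_comm, div_mul_div_comm, h]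
    field_simp
  have w1 := hv 1 (by decide) _ rfl
  have w2 := hv 2 (by decide) _ rfl
  have w3 := hv 3 (by decide) _ rfl
  norm_num [e6, m1, m2, z0] at w1 w2 w3
  have key := thetaNorm_disc hc hR h1 h2 h4 h5 n1 n2 n3 n4 n5
    (v₁ := w₁ / q ^ 20) (v₂ := w₂ / q ^ 20) (v₃ := w₃ / q ^ 20)
    (by rw [← w1]; ring) (by rw [← w2]; ring) (by rw [← w3]; ring)
  rw [← key]
  have hd' : ((w₁ / q ^ 20 - w₂ / q ^ 20) * (w₁ / q ^ 20 - w₃ / q ^ 20) *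
      (w₂ / q ^ 20 - w₃ / q ^ 20)) ^ 2 = q ^ 122 / 16 := by
    rw [← sub_div, ← sub_div, ← sub_div, div_mul_div_comm, div_mul_div_comm, div_pow, hd]
    field_simp
  rw [hd']
  ring

lemma pentagonalSeries_eq_thetaNorm {q : ℂ} (hq : ‖q‖ ≤ 1 / 3) (h0 : q ≠ 0) :
    pentagonalSeries q = q ^ 10 * qPoch ((q ^ 121) ^ 2) ((q ^ 121) ^ 2) *
      (1 - thetaNorm q 2 / thetaNorm q 1 + thetaNorm q 4 / thetaNorm q 2 -
        thetaNorm q 5 / thetaNorm q 3 + thetaNorm q 3 / thetaNorm q 4 -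
        thetaNorm q 1 / thetaNorm q 5) := by
  have e6 : thetaNorm q 6 = thetaNorm q 5 := thetaNorm_eleven_sub h0 5
  have e8 : thetaNorm q 8 = thetaNorm q 3 := thetaNorm_eleven_sub h0 3
  have e10 : thetaNorm q 10 = thetaNorm q 1 := thetaNorm_eleven_sub h0 1
  have hterm : ∀ j : ℤ, q ^ (3 * j ^ 2 - 11 * j) * (theta11 q (2 * j) / theta11 q j) =
      thetaNorm q (2 * j) / thetaNorm q j := by
    intro j
    rw [theta11_eq_thetaNorm h0, theta11_eq_thetaNorm h0 j, mul_div_mul_comm, ← zpow_sub₀ h0,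
      ← mul_assoc, ← zpow_add₀ h0]
    ring_nf
    simp
  have hs : ∑ j ∈ Finset.Icc (1 : ℤ) 5, (-1 : ℂ) ^ j * q ^ (3 * j ^ 2 - 11 * j) *
      (theta11 q (2 * j) / theta11 q j) =
      -(thetaNorm q 2 / thetaNorm q 1) + thetaNorm q 4 / thetaNorm q 2 -
        thetaNorm q 5 / thetaNorm q 3 + thetaNorm q 3 / thetaNorm q 4 -
        thetaNorm q 1 / thetaNorm q 5 := by
    have hI : Finset.Icc (1 : ℤ) 5 = {1, 2, 3, 4, 5} := rfl
    simp only [mul_assoc, hterm]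
    rw [hI]
    norm_num [e6, e8, e10, zpow_ofNat]
    ring
  rw [pentagonalSeries_dissection hq h0, hs]
  ring

lemma rankBilateral_term_eq_thetaNorm {q : ℂ} (h0 : q ≠ 0) (r j : ℤ) :
    q ^ (3 * r * (11 - r)) * (q ^ (3 * j ^ 2 - 33 * j) * (theta11 q j * theta11 q (2 * j)) /
      (theta11 q (r + j) * theta11 q r * theta11 q (r - j))) =
    q ^ 10 * (thetaNorm q j * thetaNorm q (2 * j) /
      (thetaNorm q (r + j) * thetaNorm q r * thetaNorm q (r - j))) := by
  have e : q ^ (3 * r * (11 - r)) * (q ^ (3 * j ^ 2 - 33 * j) *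
      (q ^ (-((j - 1) * (j - 10))) * q ^ (-((2 * j - 1) * (2 * j - 10))))) /
      (q ^ (-((r + j - 1) * (r + j - 10))) * q ^ (-((r - 1) * (r - 10))) *
        q ^ (-((r - j - 1) * (r - j - 10)))) = q ^ 10 := by
    rw [← zpow_add₀ h0, ← zpow_add₀ h0, ← zpow_add₀ h0, ← zpow_add₀ h0, ← zpow_add₀ h0,
      ← zpow_sub₀ h0, ← zpow_natCast q 10]
    congr 1
    push_cast
    ring
  rw [theta11_eq_thetaNorm h0 j, theta11_eq_thetaNorm h0 (2 * j), theta11_eq_thetaNorm h0 (r + j),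
    theta11_eq_thetaNorm h0 r, theta11_eq_thetaNorm h0 (r - j), ← e]
  simp only [div_eq_mul_inv, mul_inv]
  ring

lemma thetaLog_zero_residue {q : ℂ} (hq : ‖q‖ < 1) (h0 : q ≠ 0) :
    22 * (thetaLog ((q ^ 121) ^ 2) ((q ^ 22) ^ (2 * 2 : ℤ)) +
        thetaLog ((q ^ 121) ^ 2) ((q ^ 22) ^ (2 : ℤ))) - 10 =
      qPoch ((q ^ 121) ^ 2) ((q ^ 121) ^ 2) ^ 2 * q ^ 10 *
        (-(6 * (thetaNorm q 1 ^ 3 / (thetaNorm q 4 * thetaNorm q 5 ^ 3))) +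
          8 * (thetaNorm q 2 * thetaNorm q 3 / (thetaNorm q 4 ^ 2 * thetaNorm q 5)) -
          10 * (thetaNorm q 4 ^ 3 / (thetaNorm q 2 ^ 3 * thetaNorm q 5))) := by
  have nz : ∀ k : ℤ, ¬ (11 : ℤ) ∣ k → thetaNorm q k ≠ 0 := fun k hk => thetaNorm_ne_zero hq h0 hk
  have n1 := nz 1 (by decide)
  have n2 := nz 2 (by decide)
  have n3 := nz 3 (by decide)
  have n4 := nz 4 (by decide)
  have n5 := nz 5 (by decide)
  have e6 : thetaNorm q 6 = thetaNorm q 5 := thetaNorm_eleven_sub h0 5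
  have e8 : thetaNorm q 8 = thetaNorm q 3 := thetaNorm_eleven_sub h0 3
  have e10 : thetaNorm q 10 = thetaNorm q 1 := thetaNorm_eleven_sub h0 1
  have m2 : thetaNorm q (-2) = -thetaNorm q 2 := thetaNorm_neg hq h0 2
  have m4 : thetaNorm q (-4) = -thetaNorm q 4 := thetaNorm_neg hq h0 4
  have l6 : thetaLog ((q ^ 121) ^ 2) ((q ^ 22) ^ (6 : ℤ)) =
      -thetaLog ((q ^ 121) ^ 2) ((q ^ 22) ^ (5 : ℤ)) := thetaLog_eleven_sub hq h0 5
  have lm2 := thetaLog_neg hq h0 (k := 2) (by decide)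
  have lm4 := thetaLog_neg hq h0 (k := 4) (by decide)
  have A := thetaLog_eq_thetaNorm hq h0 (c := 1) (b := 5) (by decide) (by decide) (by decide)
  have B := thetaLog_eq_thetaNorm hq h0 (c := 2) (b := 4) (by decide) (by decide) (by decide)
  have C := thetaLog_eq_thetaNorm hq h0 (c := 4) (b := 2) (by decide) (by decide) (by decide)
  simp only [show (1 : ℤ) + 5 = 6 from rfl,
    show (1 : ℤ) - 5 = -4 from rfl, show (2 : ℤ) + 4 = 6 from rfl, show (2 : ℤ) - 4 = -2 from rfl,
    show (4 : ℤ) + 2 = 6 from rfl, show (4 : ℤ) - 2 = 2 from rfl, show (2 : ℤ) * 2 = 4 from rfl,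
    show (2 : ℤ) * 4 = 8 from rfl, show (2 : ℤ) * 5 = 10 from rfl, e6, e8, e10, m2, m4,
    l6, lm2, lm4] at A B C ⊢
  have fA : thetaNorm q 1 ^ 2 * thetaNorm q 1 / (thetaNorm q 5 ^ 2 * thetaNorm q 5 *
      -thetaNorm q 4) =
      -(thetaNorm q 1 ^ 3 / (thetaNorm q 4 * thetaNorm q 5 ^ 3)) := by field_simp
  have fB : thetaNorm q 2 ^ 2 * thetaNorm q 3 / (thetaNorm q 4 ^ 2 * thetaNorm q 5 *
      -thetaNorm q 2) =
      -(thetaNorm q 2 * thetaNorm q 3 / (thetaNorm q 4 ^ 2 * thetaNorm q 5)) := by field_simp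
  have fC : thetaNorm q 4 ^ 2 * thetaNorm q 4 / (thetaNorm q 2 ^ 2 * thetaNorm q 5 *
      thetaNorm q 2) =
      thetaNorm q 4 ^ 3 / (thetaNorm q 2 ^ 3 * thetaNorm q 5) := by field_simp
  rw [fA] at A
  rw [fB] at B
  rw [fC] at C
  linear_combination 6 * A - 8 * B - 10 * C

lemma thetaLog_five_residue {q : ℂ} (hq : ‖q‖ < 1) (h0 : q ≠ 0) :
    11 * (thetaLog ((q ^ 121) ^ 2) ((q ^ 22) ^ (2 * 4 : ℤ)) +
        thetaLog ((q ^ 121) ^ 2) ((q ^ 22) ^ (4 : ℤ))) + 1 =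
      qPoch ((q ^ 121) ^ 2) ((q ^ 121) ^ 2) ^ 2 * q ^ 10 *
        (-(3 * (thetaNorm q 2 ^ 3 / (thetaNorm q 1 ^ 3 * thetaNorm q 3))) +
          5 * (thetaNorm q 3 ^ 3 / (thetaNorm q 1 * thetaNorm q 4 ^ 3)) +
          4 * (thetaNorm q 4 * thetaNorm q 5 / (thetaNorm q 1 * thetaNorm q 3 ^ 2))) := by
  have nz : ∀ k : ℤ, ¬ (11 : ℤ) ∣ k → thetaNorm q k ≠ 0 := fun k hk => thetaNorm_ne_zero hq h0 hk
  have n1 := nz 1 (by decide)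
  have n2 := nz 2 (by decide)
  have n3 := nz 3 (by decide)
  have n4 := nz 4 (by decide)
  have n5 := nz 5 (by decide)
  have e6 : thetaNorm q 6 = thetaNorm q 5 := thetaNorm_eleven_sub h0 5
  have e7 : thetaNorm q 7 = thetaNorm q 4 := thetaNorm_eleven_sub h0 4
  have e8 : thetaNorm q 8 = thetaNorm q 3 := thetaNorm_eleven_sub h0 3
  have m1 : thetaNorm q (-1) = -thetaNorm q 1 := thetaNorm_neg hq h0 1
  have l7 : thetaLog ((q ^ 121) ^ 2) ((q ^ 22) ^ (7 : ℤ)) =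
      -thetaLog ((q ^ 121) ^ 2) ((q ^ 22) ^ (4 : ℤ)) := thetaLog_eleven_sub hq h0 4
  have l8 : thetaLog ((q ^ 121) ^ 2) ((q ^ 22) ^ (8 : ℤ)) =
      -thetaLog ((q ^ 121) ^ 2) ((q ^ 22) ^ (3 : ℤ)) := thetaLog_eleven_sub hq h0 3
  have lm1 := thetaLog_neg hq h0 (k := 1) (by decide)
  have A := thetaLog_eq_thetaNorm hq h0 (c := 2) (b := 1) (by decide) (by decide) (by decide)
  have B := thetaLog_eq_thetaNorm hq h0 (c := 3) (b := 4) (by decide) (by decide) (by decide)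
  have C := thetaLog_eq_thetaNorm hq h0 (c := 4) (b := 3) (by decide) (by decide) (by decide)
  simp only [show (2 : ℤ) + 1 = 3 from rfl, show (2 : ℤ) - 1 = 1 from rfl,
    show (3 : ℤ) + 4 = 7 from rfl, show (3 : ℤ) - 4 = -1 from rfl,
    show (4 : ℤ) + 3 = 7 from rfl, show (4 : ℤ) - 3 = 1 from rfl, show (2 : ℤ) * 1 = 2 from rfl,
    show (2 : ℤ) * 4 = 8 from rfl, show (2 : ℤ) * 3 = 6 from rfl, e6, e7, e8, m1,
    l7, l8, lm1] at A B C ⊢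
  have fA : thetaNorm q 2 ^ 2 * thetaNorm q 2 / (thetaNorm q 1 ^ 2 * thetaNorm q 3 *
      thetaNorm q 1) =
      thetaNorm q 2 ^ 3 / (thetaNorm q 1 ^ 3 * thetaNorm q 3) := by field_simp
  have fB : thetaNorm q 3 ^ 2 * thetaNorm q 3 / (thetaNorm q 4 ^ 2 * thetaNorm q 4 *
      -thetaNorm q 1) =
      -(thetaNorm q 3 ^ 3 / (thetaNorm q 1 * thetaNorm q 4 ^ 3)) := by field_simp
  have fC : thetaNorm q 4 ^ 2 * thetaNorm q 5 / (thetaNorm q 3 ^ 2 * thetaNorm q 4 *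
      thetaNorm q 1) =
      thetaNorm q 4 * thetaNorm q 5 / (thetaNorm q 1 * thetaNorm q 3 ^ 2) := by field_simp
  rw [fA] at A
  rw [fB] at B
  rw [fC] at C
  linear_combination -3 * A - 5 * B + 4 * C

lemma rankGF_zero_mul_thetaQuot {q : ℂ} (hq : ‖q‖ ≤ 1 / 3) (h0 : q ≠ 0) :
    (qPoch ((q ^ 121) ^ 2) ((q ^ 121) ^ 2) * (11 * rankGF 0 (q ^ 2) - partitionGF (q ^ 2)) +
        22 * q ^ 44 * appell (q ^ 121) ((q ^ 22) ^ (2 : ℤ)) 1) *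
      (1 - thetaNorm q 2 / thetaNorm q 1 + thetaNorm q 4 / thetaNorm q 2 -
        thetaNorm q 5 / thetaNorm q 3 + thetaNorm q 3 / thetaNorm q 4 -
        thetaNorm q 1 / thetaNorm q 5) =
    qPoch ((q ^ 121) ^ 2) ((q ^ 121) ^ 2) ^ 2 *
      (6 * (thetaNorm q 1 ^ 3 / (thetaNorm q 4 * thetaNorm q 5 ^ 3)) -
        8 * (thetaNorm q 2 * thetaNorm q 3 / (thetaNorm q 4 ^ 2 * thetaNorm q 5)) +
        10 * (thetaNorm q 4 ^ 3 / (thetaNorm q 2 ^ 3 * thetaNorm q 5)) +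
        22 * (1 / (thetaNorm q 3)) - 22 * (thetaNorm q 3 / (thetaNorm q 1 * thetaNorm q 2)) +
        22 * (thetaNorm q 3 * thetaNorm q 4 / (thetaNorm q 2 ^ 2 * thetaNorm q 5)) -
        22 * (thetaNorm q 1 * thetaNorm q 5 / (thetaNorm q 2 * thetaNorm q 3 * thetaNorm q 4))) :=
            by
  have hq1 : ‖q‖ < 1 := by linarith
  have nz : ∀ k : ℤ, ¬ (11 : ℤ) ∣ k → thetaNorm q k ≠ 0 := fun k hk => thetaNorm_ne_zero hq1 h0 hk
  have n1 := nz 1 (by decide)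
  have n2 := nz 2 (by decide)
  have n3 := nz 3 (by decide)
  have n4 := nz 4 (by decide)
  have n5 := nz 5 (by decide)
  have hJ : qPoch ((q ^ 121) ^ 2) ((q ^ 121) ^ 2) ≠ 0 :=
    qPoch_self_ne_zero (norm_sq_lt_one (norm_pow_lt_one hq1 (by norm_num)))
  have e6 : thetaNorm q 6 = thetaNorm q 5 := thetaNorm_eleven_sub h0 5
  have e7 : thetaNorm q 7 = thetaNorm q 4 := thetaNorm_eleven_sub h0 4
  have e8 : thetaNorm q 8 = thetaNorm q 3 := thetaNorm_eleven_sub h0 3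
  have e10 : thetaNorm q 10 = thetaNorm q 1 := thetaNorm_eleven_sub h0 1
  have m1 : thetaNorm q (-1) = -thetaNorm q 1 := thetaNorm_neg hq1 h0 1
  have m2 : thetaNorm q (-2) = -thetaNorm q 2 := thetaNorm_neg hq1 h0 2
  have m3 : thetaNorm q (-3) = -thetaNorm q 3 := thetaNorm_neg hq1 h0 3
  have hD := rankGF_zero_mul_pentagonalSeries hq h0
  have hB := rankBilateral_dissection hq h0 (a := 10) (r := 2) (by decide) (by decide) (by decide)
  have hL := thetaLog_zero_residue hq1 h0
  have hE := pentagonalSeries_eq_thetaNorm hq h0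
  have hS : q ^ (3 * 2 * (11 - 2) : ℤ) * ∑ j ∈ (Finset.Icc (1 : ℤ) 5).erase 2,
      (-1) ^ j * q ^ (3 * j ^ 2 - 33 * j) * (theta11 q j * theta11 q (2 * j)) /
        (theta11 q (2 + j) * theta11 q 2 * theta11 q (2 - j)) = q ^ 10 *
      (-(1 / (thetaNorm q 3)) + thetaNorm q 3 / (thetaNorm q 1 * thetaNorm q 2) -
        thetaNorm q 3 * thetaNorm q 4 / (thetaNorm q 2 ^ 2 * thetaNorm q 5) +
        thetaNorm q 1 * thetaNorm q 5 / (thetaNorm q 2 * thetaNorm q 3 * thetaNorm q 4)) := by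
    have hI : (Finset.Icc (1 : ℤ) 5).erase 2 = {1, 3, 4, 5} := rfl
    rw [Finset.mul_sum]
    simp only [mul_assoc ((-1 : ℂ) ^ (_ : ℤ)), mul_div_assoc ((-1 : ℂ) ^ (_ : ℤ)),
      mul_left_comm (q ^ (3 * 2 * (11 - 2) : ℤ)) ((-1 : ℂ) ^ (_ : ℤ)),
          rankBilateral_term_eq_thetaNorm h0]
    rw [hI]
    norm_num [e6, e7, e8, e10, m1, m2, m3, zpow_ofNat]
    field_simp
    ring
  have he : q ^ (3 * 2 * (11 - 2) : ℤ) = q ^ 54 := by norm_num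
  rw [mul_add (q ^ (3 * 2 * (11 - 2) : ℤ)), mul_left_comm (q ^ (3 * 2 * (11 - 2) : ℤ)) (_ * _ ^ 3),
      hS, he] at hB
  generalize 1 - thetaNorm q 2 / thetaNorm q 1 + thetaNorm q 4 / thetaNorm q 2 -
        thetaNorm q 5 / thetaNorm q 3 + thetaNorm q 3 / thetaNorm q 4 -
        thetaNorm q 1 / thetaNorm q 5 = E at *
  rw [hE] at hD hB
  have hq20 : q ^ 20 * qPoch ((q ^ 121) ^ 2) ((q ^ 121) ^ 2) ≠ 0 :=
      mul_ne_zero (pow_ne_zero _ h0) hJ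
  refine mul_left_cancel₀ hq20 ?_
  linear_combination q ^ 10 * qPoch ((q ^ 121) ^ 2) ((q ^ 121) ^ 2) * hD - 22 * hB -
    q ^ 10 * qPoch ((q ^ 121) ^ 2) ((q ^ 121) ^ 2) * hL

lemma rankGF_five_mul_thetaQuot {q : ℂ} (hq : ‖q‖ ≤ 1 / 3) (h0 : q ≠ 0) :
    (qPoch ((q ^ 121) ^ 2) ((q ^ 121) ^ 2) * (11 * rankGF 5 (q ^ 2) - partitionGF (q ^ 2)) +
        11 * q ^ 74 * appell (q ^ 121) ((q ^ 22) ^ (4 : ℤ)) 1) *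
      (1 - thetaNorm q 2 / thetaNorm q 1 + thetaNorm q 4 / thetaNorm q 2 -
        thetaNorm q 5 / thetaNorm q 3 + thetaNorm q 3 / thetaNorm q 4 -
        thetaNorm q 1 / thetaNorm q 5) =
    qPoch ((q ^ 121) ^ 2) ((q ^ 121) ^ 2) ^ 2 *
      (3 * (thetaNorm q 2 ^ 3 / (thetaNorm q 1 ^ 3 * thetaNorm q 3)) -
        5 * (thetaNorm q 3 ^ 3 / (thetaNorm q 1 * thetaNorm q 4 ^ 3)) -
        4 * (thetaNorm q 4 * thetaNorm q 5 / (thetaNorm q 1 * thetaNorm q 3 ^ 2)) +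
        11 * (thetaNorm q 1 * thetaNorm q 2 / (thetaNorm q 3 * thetaNorm q 4 * thetaNorm q 5)) -
        11 * (1 / (thetaNorm q 5)) +
        11 * (thetaNorm q 3 * thetaNorm q 5 / (thetaNorm q 1 * thetaNorm q 4 ^ 2)) -
        11 * (thetaNorm q 5 / (thetaNorm q 2 * thetaNorm q 4))) := by
  have hq1 : ‖q‖ < 1 := by linarith
  have nz : ∀ k : ℤ, ¬ (11 : ℤ) ∣ k → thetaNorm q k ≠ 0 := fun k hk => thetaNorm_ne_zero hq1 h0 hk
  have n1 := nz 1 (by decide)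
  have n2 := nz 2 (by decide)
  have n3 := nz 3 (by decide)
  have n4 := nz 4 (by decide)
  have n5 := nz 5 (by decide)
  have hJ : qPoch ((q ^ 121) ^ 2) ((q ^ 121) ^ 2) ≠ 0 :=
    qPoch_self_ne_zero (norm_sq_lt_one (norm_pow_lt_one hq1 (by norm_num)))
  have e6 : thetaNorm q 6 = thetaNorm q 5 := thetaNorm_eleven_sub h0 5
  have e7 : thetaNorm q 7 = thetaNorm q 4 := thetaNorm_eleven_sub h0 4
  have e8 : thetaNorm q 8 = thetaNorm q 3 := thetaNorm_eleven_sub h0 3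
  have e9 : thetaNorm q 9 = thetaNorm q 2 := thetaNorm_eleven_sub h0 2
  have e10 : thetaNorm q 10 = thetaNorm q 1 := thetaNorm_eleven_sub h0 1
  have m1 : thetaNorm q (-1) = -thetaNorm q 1 := thetaNorm_neg hq1 h0 1
  have hD := rankGF_five_mul_pentagonalSeries hq h0
  have hB := rankBilateral_dissection hq h0 (a := 4) (r := 4) (by decide) (by decide) (by decide)
  have hL := thetaLog_five_residue hq1 h0
  have hE := pentagonalSeries_eq_thetaNorm hq h0
  have hS : q ^ (3 * 4 * (11 - 4) : ℤ) * ∑ j ∈ (Finset.Icc (1 : ℤ) 5).erase 4,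
      (-1) ^ j * q ^ (3 * j ^ 2 - 33 * j) * (theta11 q j * theta11 q (2 * j)) /
        (theta11 q (4 + j) * theta11 q 4 * theta11 q (4 - j)) = q ^ 10 *
      (-(thetaNorm q 1 * thetaNorm q 2 / (thetaNorm q 3 * thetaNorm q 4 * thetaNorm q 5)) +
        1 / (thetaNorm q 5) - thetaNorm q 3 * thetaNorm q 5 / (thetaNorm q 1 * thetaNorm q 4 ^ 2) +
        thetaNorm q 5 / (thetaNorm q 2 * thetaNorm q 4)) := by
    have hI : (Finset.Icc (1 : ℤ) 5).erase 4 = {1, 2, 3, 5} := rfl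
    rw [Finset.mul_sum]
    simp only [mul_assoc ((-1 : ℂ) ^ (_ : ℤ)), mul_div_assoc ((-1 : ℂ) ^ (_ : ℤ)),
      mul_left_comm (q ^ (3 * 4 * (11 - 4) : ℤ)) ((-1 : ℂ) ^ (_ : ℤ)),
          rankBilateral_term_eq_thetaNorm h0]
    rw [hI]
    norm_num [e6, e7, e8, e9, e10, m1, zpow_ofNat]
    field_simp
    ring
  have he : q ^ (3 * 4 * (11 - 4) : ℤ) = q ^ 84 := by norm_num
  rw [mul_add (q ^ (3 * 4 * (11 - 4) : ℤ)), mul_left_comm (q ^ (3 * 4 * (11 - 4) : ℤ)) (_ * _ ^ 3),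
      hS, he] at hB
  generalize 1 - thetaNorm q 2 / thetaNorm q 1 + thetaNorm q 4 / thetaNorm q 2 -
        thetaNorm q 5 / thetaNorm q 3 + thetaNorm q 3 / thetaNorm q 4 -
        thetaNorm q 1 / thetaNorm q 5 = E at *
  rw [hE] at hD hB
  have hq20 : q ^ 20 * qPoch ((q ^ 121) ^ 2) ((q ^ 121) ^ 2) ≠ 0 :=
      mul_ne_zero (pow_ne_zero _ h0) hJ
  refine mul_left_cancel₀ hq20 ?_
  linear_combination q ^ 10 * qPoch ((q ^ 121) ^ 2) ((q ^ 121) ^ 2) * hD - 11 * hB -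
    q ^ 10 * qPoch ((q ^ 121) ^ 2) ((q ^ 121) ^ 2) * hL

/-- The coordinate `x` of the modular curve parametrising the theta quotients. -/
noncomputable def curveX (q : ℂ) : ℂ := thetaNorm q 1 ^ 2 / (thetaNorm q 2 * thetaNorm q 3)

/-- The coordinate `y` of the modular curve parametrising the theta quotients. -/
noncomputable def curveY (q : ℂ) : ℂ :=
  -(thetaNorm q 1 * thetaNorm q 3 * thetaNorm q 5) / (thetaNorm q 2 ^ 2 * thetaNorm q 4)

lemma curve_relations {q : ℂ} (hq : ‖q‖ < 1) (h0 : q ≠ 0) {ρ x y : ℂ}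
    (hρ : ρ = thetaNorm q 2 / thetaNorm q 1) (hx : x = curveX q) (hy : y = curveY q) :
    y ^ 2 + (x ^ 2 + 1) * y + x = 0 ∧
      ρ ^ 11 * ((1 + x * y) * (1 - x) * x ^ 4 * y) = -1 ∧
      thetaNorm q 1 = thetaNorm q 3 * ρ * x ∧ thetaNorm q 2 = thetaNorm q 3 * ρ ^ 2 * x ∧
      thetaNorm q 4 = -(thetaNorm q 3 * (1 - x) * x ^ 2 * y * ρ ^ 6) ∧
      thetaNorm q 5 = thetaNorm q 3 * (1 - x) * x ^ 3 * y ^ 2 * ρ ^ 9 := by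
  obtain ⟨r1, r2, r3⟩ := thetaNorm_relations hq h0
  obtain ⟨ρ', x', y', e1, e2, e3, h⟩ := thetaNorm_param
    (thetaNorm_ne_zero hq h0 (k := 1) (by decide)) (thetaNorm_ne_zero hq h0 (k := 2) (by decide))
    (thetaNorm_ne_zero hq h0 (k := 3) (by decide)) (thetaNorm_ne_zero hq h0 (k := 4) (by decide))
    (thetaNorm_ne_zero hq h0 (k := 5) (by decide)) r1 r2 r3
  rw [curveX] at hx
  rw [curveY] at hy
  rw [hρ, hx, hy, ← e1, ← e2, ← e3]
  exact h

lemma curve_ne_zero {ρ x y : ℂ} (hR : ρ ^ 11 * ((1 + x * y) * (1 - x) * x ^ 4 * y) = -1) :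
    x ^ 5 * (1 - x) ^ 2 ≠ 0 := by
  intro h
  rcases mul_eq_zero.mp h with h | h
  · rw [pow_eq_zero_iff (by norm_num)] at h
    simp [h] at hR
  · rw [pow_eq_zero_iff (by norm_num)] at h
    simp [h] at hR

lemma curve_pow_eleven {ρ x y : ℂ} (hc : y ^ 2 + (x ^ 2 + 1) * y + x = 0)
    (hR : ρ ^ 11 * ((1 + x * y) * (1 - x) * x ^ 4 * y) = -1) :
    ρ ^ 11 * (x ^ 5 * (1 - x) ^ 2) =
      1 - x + 2 * x ^ 2 - 2 * x ^ 3 - x ^ 5 + y * (1 - x - x ^ 3) := by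
  linear_combination ρ ^ 11 * (x ^ 4 * (1 - 2 * x + x ^ 2 +
      y * (x - 2 * x ^ 2 + x ^ 3 - x ^ 4 + x ^ 5))) * hc -
    (1 - x + 2 * x ^ 2 - 2 * x ^ 3 - x ^ 5 + y * (1 - x - x ^ 3)) * hR

theorem rankGF_zero_mul_comp {q : ℂ} (hq : ‖q‖ ≤ 1 / 3) (h0 : q ≠ 0) :
    (qPoch ((q ^ 121) ^ 2) ((q ^ 121) ^ 2) * (11 * rankGF 0 (q ^ 2) - partitionGF (q ^ 2)) +
        22 * q ^ 44 * appell (q ^ 121) ((q ^ 22) ^ (2 : ℤ)) 1) *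
      (q ^ 122 * thetaNorm q 1 ^ 13 * (1 - curveX q)) =
    qPoch ((q ^ 121) ^ 2) ((q ^ 121) ^ 2) ^ 2 *
      ∑ g ∈ Finset.range 11, (thetaNorm q 2 / thetaNorm q 1) ^ g *
        compZero (curveX q) (curveY q) g := by
  have hq1 : ‖q‖ < 1 := by linarith
  obtain ⟨ρ, hρ⟩ : ∃ ρ, ρ = thetaNorm q 2 / thetaNorm q 1 := ⟨_, rfl⟩
  obtain ⟨x, hx⟩ : ∃ x, x = curveX q := ⟨_, rfl⟩
  obtain ⟨y, hy⟩ : ∃ y, y = curveY q := ⟨_, rfl⟩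
  obtain ⟨hc, hR, h1, h2, h4, h5⟩ := curve_relations hq1 h0 hρ hx hy
  have nz : ∀ k : ℤ, ¬ (11 : ℤ) ∣ k → thetaNorm q k ≠ 0 := fun k hk => thetaNorm_ne_zero hq1 h0 hk
  have n1 := nz 1 (by decide)
  have n2 := nz 2 (by decide)
  have n3 := nz 3 (by decide)
  have n4 := nz 4 (by decide)
  have n5 := nz 5 (by decide)
  have hM := rankGF_zero_mul_thetaQuot hq h0
  have hd := thetaNorm_disc_param hq1 h0 hc hR h1 h2 h4 h5
  have hx0 := curve_ne_zero hR
  have hS := mul_left_cancel₀ hx0 (compZero_mul hc (curve_pow_eleven hc hR))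
  rw [← thetaQuot_sum hc hR h1 h2 h4 h5 n1 n2 n3 n4 n5,
    ← thetaNumerZero_eq hc hR h1 h2 h4 h5 n1 n2 n3 n4 n5, ← hd] at hS
  have hE : 1 - thetaNorm q 2 / thetaNorm q 1 + thetaNorm q 4 / thetaNorm q 2 -
        thetaNorm q 5 / thetaNorm q 3 + thetaNorm q 3 / thetaNorm q 4 -
        thetaNorm q 1 / thetaNorm q 5 ≠ 0 := by
    intro hz
    have hP := partitionGF_mul_pentagonalSeries hq
    rw [pentagonalSeries_eq_thetaNorm hq h0, hz] at hP
    simp at hP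
  have hx1 : 1 - x ≠ 0 := fun h => hx0 (by simp [h])
  rw [← hρ, ← hx, ← hy]
  refine mul_left_cancel₀ (mul_ne_zero hE hx1) ?_
  linear_combination q ^ 122 * thetaNorm q 1 ^ 13 * (1 - x) ^ 2 * hM -
    qPoch ((q ^ 121) ^ 2) ((q ^ 121) ^ 2) ^ 2 * hS

theorem rankGF_five_mul_comp {q : ℂ} (hq : ‖q‖ ≤ 1 / 3) (h0 : q ≠ 0) :
    (qPoch ((q ^ 121) ^ 2) ((q ^ 121) ^ 2) * (11 * rankGF 5 (q ^ 2) - partitionGF (q ^ 2)) +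
        11 * q ^ 74 * appell (q ^ 121) ((q ^ 22) ^ (4 : ℤ)) 1) *
      (q ^ 122 * thetaNorm q 1 ^ 13 * (1 - curveX q)) =
    qPoch ((q ^ 121) ^ 2) ((q ^ 121) ^ 2) ^ 2 *
      ∑ g ∈ Finset.range 11, (thetaNorm q 2 / thetaNorm q 1) ^ g *
        compFive (curveX q) (curveY q) g := by
  have hq1 : ‖q‖ < 1 := by linarith
  obtain ⟨ρ, hρ⟩ : ∃ ρ, ρ = thetaNorm q 2 / thetaNorm q 1 := ⟨_, rfl⟩
  obtain ⟨x, hx⟩ : ∃ x, x = curveX q := ⟨_, rfl⟩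
  obtain ⟨y, hy⟩ : ∃ y, y = curveY q := ⟨_, rfl⟩
  obtain ⟨hc, hR, h1, h2, h4, h5⟩ := curve_relations hq1 h0 hρ hx hy
  have nz : ∀ k : ℤ, ¬ (11 : ℤ) ∣ k → thetaNorm q k ≠ 0 := fun k hk => thetaNorm_ne_zero hq1 h0 hk
  have n1 := nz 1 (by decide)
  have n2 := nz 2 (by decide)
  have n3 := nz 3 (by decide)
  have n4 := nz 4 (by decide)
  have n5 := nz 5 (by decide)
  have hM := rankGF_five_mul_thetaQuot hq h0
  have hd := thetaNorm_disc_param hq1 h0 hc hR h1 h2 h4 h5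
  have hx0 := curve_ne_zero hR
  have hS := mul_left_cancel₀ hx0 (compFive_mul hc (curve_pow_eleven hc hR))
  rw [← thetaQuot_sum hc hR h1 h2 h4 h5 n1 n2 n3 n4 n5,
    ← thetaNumerFive_eq hc hR h1 h2 h4 h5 n1 n2 n3 n4 n5, ← hd] at hS
  have hE : 1 - thetaNorm q 2 / thetaNorm q 1 + thetaNorm q 4 / thetaNorm q 2 -
        thetaNorm q 5 / thetaNorm q 3 + thetaNorm q 3 / thetaNorm q 4 -
        thetaNorm q 1 / thetaNorm q 5 ≠ 0 := by
    intro hz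
    have hP := partitionGF_mul_pentagonalSeries hq
    rw [pentagonalSeries_eq_thetaNorm hq h0, hz] at hP
    simp at hP
  have hx1 : 1 - x ≠ 0 := fun h => hx0 (by simp [h])
  rw [← hρ, ← hx, ← hy]
  refine mul_left_cancel₀ (mul_ne_zero hE hx1) ?_
  linear_combination q ^ 122 * thetaNorm q 1 ^ 13 * (1 - x) ^ 2 * hM -
    qPoch ((q ^ 121) ^ 2) ((q ^ 121) ^ 2) ^ 2 * hS

lemma theta11_root_mul {z q : ℂ} (hz : z ^ 11 = 1) (k : ℤ) : theta11 (z * q) k = theta11 q k := by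
  have e1 : (z * q) ^ 121 = q ^ 121 := by
    rw [mul_pow, show 121 = 11 * 11 from rfl, pow_mul z, hz, one_pow, one_mul]
  have e2 : (z * q) ^ 22 = q ^ 22 := by
    rw [mul_pow, show 22 = 11 * 2 from rfl, pow_mul z, hz, one_pow, one_mul]
  rw [theta11, theta11, e1, e2]

lemma thetaNorm_root_mul {z q : ℂ} (hz : z ^ 11 = 1) (k : ℤ) :
    thetaNorm (z * q) k = z ^ ((k - 1) * (k - 10)) * thetaNorm q k := by
  rw [thetaNorm, theta11_root_mul hz, mul_zpow, mul_assoc, thetaNorm]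

lemma curve_root_mul {z q : ℂ} (hz : z ^ 11 = 1) :
    thetaNorm (z * q) 1 = thetaNorm q 1 ∧ curveX (z * q) = curveX q ∧ curveY (z * q) = curveY q ∧
      thetaNorm (z * q) 2 / thetaNorm (z * q) 1 = z ^ 3 * (thetaNorm q 2 / thetaNorm q 1) := by
  have z0 : z ≠ 0 := by rintro rfl; norm_num at hz
  have h : ∀ (e : ℤ) (m : ℕ) (r : ℤ), e = m - 11 * r → z ^ e = z ^ m := by
    intro e m r he
    rw [he, zpow_sub₀ z0, zpow_natCast, zpow_mul]
    norm_cast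
    rw [hz]
    simp
  have t1 : thetaNorm (z * q) 1 = thetaNorm q 1 := by simp [thetaNorm_root_mul hz]
  have t2 : thetaNorm (z * q) 2 = z ^ 3 * thetaNorm q 2 := by
    rw [thetaNorm_root_mul hz, h _ 3 1 (by norm_num)]
  have t3 : thetaNorm (z * q) 3 = z ^ 8 * thetaNorm q 3 := by
    rw [thetaNorm_root_mul hz, h _ 8 2 (by norm_num)]
  have t4 : thetaNorm (z * q) 4 = z ^ 4 * thetaNorm q 4 := by
    rw [thetaNorm_root_mul hz, h _ 4 2 (by norm_num)]
  have t5 : thetaNorm (z * q) 5 = z ^ 2 * thetaNorm q 5 := by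
    rw [thetaNorm_root_mul hz, h _ 2 2 (by norm_num)]
  refine ⟨t1, ?_, ?_, ?_⟩
  · rw [curveX, curveX, t1, t2, t3]
    rw [show z ^ 3 * thetaNorm q 2 * (z ^ 8 * thetaNorm q 3) =
      z ^ 11 * (thetaNorm q 2 * thetaNorm q 3) by ring, hz, one_mul]
  · rw [curveY, curveY, t1, t2, t3, t4, t5]
    rw [show -(thetaNorm q 1 * (z ^ 8 * thetaNorm q 3) * (z ^ 2 * thetaNorm q 5)) =
      z ^ 10 * -(thetaNorm q 1 * thetaNorm q 3 * thetaNorm q 5) by ring,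
      show (z ^ 3 * thetaNorm q 2) ^ 2 * (z ^ 4 * thetaNorm q 4) =
      z ^ 10 * (thetaNorm q 2 ^ 2 * thetaNorm q 4) by ring,
      mul_div_mul_left _ _ (pow_ne_zero _ z0)]
  · rw [t1, t2, mul_div_assoc]

lemma sum_root_pow {ζ : ℂ} (hζ : IsPrimitiveRoot ζ 11) (k : ℕ) :
    ∑ i ∈ Finset.range 11, (ζ ^ i) ^ k = if 11 ∣ k then 11 else 0 := by
  simp_rw [← pow_mul, mul_comm _ k, pow_mul]
  split_ifs with h
  · rw [(hζ.pow_eq_one_iff_dvd k).mpr h]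
    simp
  · have h1 : ζ ^ k - 1 ≠ 0 := fun h' => h ((hζ.pow_eq_one_iff_dvd k).mp (sub_eq_zero.mp h'))
    refine (mul_eq_zero.mp ?_).resolve_right h1
    rw [geom_sum_mul, ← pow_mul, mul_comm, pow_mul, hζ.pow_eq_one, one_pow, sub_self]

lemma sum_root_tsum {ζ q : ℂ} (hζ : IsPrimitiveRoot ζ 11) {d : ℕ → ℂ} {D : ℂ → ℂ}
    (hD : ∀ z : ℂ, z ^ 11 = 1 → HasSum (fun n => d n * ((z * q) ^ 2) ^ n) (D z)) :
    HasSum (fun m => 11 * (q ^ 12 * (d (11 * m + 6) * (q ^ 22) ^ m)))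
      (∑ i ∈ Finset.range 11, (ζ ^ i) ^ 10 * D (ζ ^ i)) := by
  have hz : ∀ i : ℕ, (ζ ^ i) ^ 11 = 1 := fun i => by
    rw [← pow_mul, mul_comm, pow_mul, hζ.pow_eq_one, one_pow]
  have h := hasSum_sum (s := Finset.range 11) fun i _ => (hD _ (hz i)).mul_left ((ζ ^ i) ^ 10)
  have he : (fun n => ∑ i ∈ Finset.range 11, (ζ ^ i) ^ 10 * (d n * ((ζ ^ i * q) ^ 2) ^ n)) =
      fun n => (if 11 ∣ 2 * n + 10 then 11 else 0) * (d n * (q ^ 2) ^ n) := by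
    funext n
    rw [← sum_root_pow hζ, Finset.sum_mul]
    refine Finset.sum_congr rfl fun i _ => ?_
    rw [mul_pow, mul_pow _ _ n, ← pow_mul (ζ ^ i) 2, pow_add]
    ring
  rw [he] at h
  have hinj : Function.Injective fun m : ℕ => 11 * m + 6 := fun a b hab => by
    simp only at hab; omega
  rw [← hinj.hasSum_iff] at h
  · refine h.congr_fun fun m => ?_
    have e : (q ^ 2) ^ (11 * m + 6) = q ^ 12 * (q ^ 22) ^ m := by
      rw [← pow_mul, ← pow_mul, ← pow_add]
      ring
    rw [Function.comp_apply, if_pos (by omega), e]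
    ring
  · intro n hn
    rw [if_neg, zero_mul]
    intro hd
    refine hn ⟨n / 11, ?_⟩
    simp only
    omega

lemma rankCount_le_partitionCount (a r : ℤ) (n : ℕ) : rankCount a r n ≤ partitionCount n :=
  Finset.card_le_univ _

lemma hasSum_rank_sub_partition {x : ℂ} (hx : ‖x‖ ≤ 1 / 9) (a : ℤ) :
    HasSum (fun n => (11 * (rankCount a 11 n : ℂ) - partitionCount n) * x ^ n)
      (11 * rankGF a x - partitionGF x) := by
  simp only [sub_mul, mul_assoc]
  exact ((summable_coeff_mul_pow hx fun n => rankCount_le_partitionCount a 11 n).hasSum.mul_left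
    11).sub (summable_coeff_mul_pow hx fun n => le_rfl).hasSum

lemma hasSum_residue_six {q : ℂ} (hq : ‖q‖ ≤ 1 / 3) (h0 : q ≠ 0) (a : ℤ) {J A C S : ℂ} {e : ℕ}
    {c : ℕ → ℂ} (hJ : J ≠ 0) (hC : C ≠ 0) (he : ¬ 11 ∣ e + 10)
    (h : ∀ z : ℂ, z ^ 11 = 1 →
      (J * (11 * rankGF a ((z * q) ^ 2) - partitionGF ((z * q) ^ 2)) + z ^ e * A) * (z * C) =
        J ^ 2 * ∑ g ∈ Finset.range 11, z ^ (3 * g) * c g)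
    (hS : J * c 8 = q ^ 12 * S * C) :
    HasSum (fun m : ℕ => (11 * (rankCount a 11 (11 * m + 6) : ℂ) - partitionCount (11 * m + 6)) *
      (q ^ 22) ^ m) S := by
  have hζ := Complex.isPrimitiveRoot_exp 11 (by norm_num)
  set ζ := Complex.exp (2 * Real.pi * Complex.I / (11 : ℕ)) with hζd
  have hz : ∀ i : ℕ, (ζ ^ i) ^ 11 = 1 := fun i => by
    rw [← pow_mul, mul_comm, pow_mul, hζ.pow_eq_one, one_pow]
  have hn : ∀ z : ℂ, z ^ 11 = 1 → ‖(z * q) ^ 2‖ ≤ 1 / 9 := fun z hz => by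
    refine norm_sq_le ?_
    rw [norm_mul, Complex.norm_eq_one_of_pow_eq_one hz (by norm_num), one_mul]
    exact hq
  have hs := sum_root_tsum (q := q) hζ fun z hz => hasSum_rank_sub_partition (hn z hz) a
  have key : J * C * ∑ i ∈ Finset.range 11, (ζ ^ i) ^ 10 *
      (11 * rankGF a ((ζ ^ i * q) ^ 2) - partitionGF ((ζ ^ i * q) ^ 2)) = J ^ 2 * (11 * c 8) := by
    have h1 : ∑ i ∈ Finset.range 11, (ζ ^ i) ^ 9 * ((J * (11 * rankGF a ((ζ ^ i * q) ^ 2) -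
        partitionGF ((ζ ^ i * q) ^ 2)) + (ζ ^ i) ^ e * A) * (ζ ^ i * C)) =
        ∑ i ∈ Finset.range 11, (ζ ^ i) ^ 9 *
          (J ^ 2 * ∑ g ∈ Finset.range 11, (ζ ^ i) ^ (3 * g) * c g) :=
      Finset.sum_congr rfl fun i _ => by rw [h _ (hz i)]
    have h2 : ∑ i ∈ Finset.range 11, (ζ ^ i) ^ 9 *
          (J ^ 2 * ∑ g ∈ Finset.range 11, (ζ ^ i) ^ (3 * g) * c g) = J ^ 2 * (11 * c 8) := by
      have : ∀ i, (ζ ^ i) ^ 9 * (J ^ 2 * ∑ g ∈ Finset.range 11, (ζ ^ i) ^ (3 * g) * c g) =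
          ∑ g ∈ Finset.range 11, (ζ ^ i) ^ (3 * g + 9) * (J ^ 2 * c g) := fun i => by
        rw [Finset.mul_sum, Finset.mul_sum]
        exact Finset.sum_congr rfl fun g _ => by ring
      simp_rw [this]
      rw [Finset.sum_comm]
      simp_rw [← Finset.sum_mul, sum_root_pow hζ]
      rw [Finset.sum_eq_single 8]
      · rw [if_pos (by norm_num)]; ring
      · intro g hg hg8
        rw [Finset.mem_range] at hg
        rw [if_neg (by omega), zero_mul]
      · simp
    have h3 := sum_root_pow hζ (e + 10)
    rw [if_neg he] at h3
    rw [← h2, ← h1, ← add_zero (J * C * _), ← mul_zero (A * C), ← h3, Finset.mul_sum,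
      Finset.mul_sum, ← Finset.sum_add_distrib]
    exact Finset.sum_congr rfl fun i _ => by ring
  have hq12 : (11 : ℂ) * q ^ 12 ≠ 0 := mul_ne_zero (by norm_num) (pow_ne_zero _ h0)
  have h4 : ∑ i ∈ Finset.range 11, (ζ ^ i) ^ 10 *
      (11 * rankGF a ((ζ ^ i * q) ^ 2) - partitionGF ((ζ ^ i * q) ^ 2)) = 11 * q ^ 12 * S := by
    refine mul_left_cancel₀ (mul_ne_zero hJ hC) ?_
    rw [key]
    linear_combination 11 * J * hS
  rw [h4] at hs
  simp only [← mul_assoc] at hs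
  simp only [mul_assoc (11 * q ^ 12)] at hs
  exact (hasSum_mul_left_iff hq12).mp hs

lemma thetaNorm_eq_div {q : ℂ} (h0 : q ≠ 0) :
    thetaNorm q 1 = theta11 q 1 ∧ thetaNorm q 2 = theta11 q 2 / q ^ 8 ∧
      thetaNorm q 3 = theta11 q 3 / q ^ 14 ∧ thetaNorm q 4 = theta11 q 4 / q ^ 18 ∧
      thetaNorm q 5 = theta11 q 5 / q ^ 20 := by
  have h : ∀ n : ℕ, q ^ (-(n : ℤ)) = (q ^ n)⁻¹ := fun n => by rw [zpow_neg, zpow_natCast]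
  refine ⟨?_, ?_, ?_, ?_, ?_⟩
  · simp [thetaNorm]
  · rw [thetaNorm, show ((2 : ℤ) - 1) * (2 - 10) = -(8 : ℕ) by norm_num, h]; field_simp
  · rw [thetaNorm, show ((3 : ℤ) - 1) * (3 - 10) = -(14 : ℕ) by norm_num, h]; field_simp
  · rw [thetaNorm, show ((4 : ℤ) - 1) * (4 - 10) = -(18 : ℕ) by norm_num, h]; field_simp
  · rw [thetaNorm, show ((5 : ℤ) - 1) * (5 - 10) = -(20 : ℕ) by norm_num, h]; field_simp

theorem hasSum_rank_residue_zero {q : ℂ} (hq : ‖q‖ ≤ 1 / 3) (h0 : q ≠ 0) :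
    HasSum (fun m : ℕ => (11 * (rankCount 0 11 (11 * m + 6) : ℂ) - partitionCount (11 * m + 6)) *
      (q ^ 22) ^ m) (22 * (q ^ 22 * (qPoch ((q ^ 121) ^ 2) ((q ^ 121) ^ 2) / (theta11 q 1 ^ 2 *
          theta11 q 2 ^ 4 * theta11 q 3 ^ 2 * theta11 q 4 ^ 2 * theta11 q 5 ^ 3)) +
        (q ^ 22) ^ 2 * (qPoch ((q ^ 121) ^ 2) ((q ^ 121) ^ 2) / (theta11 q 1 ^ 2 * theta11 q 2 *
            theta11 q 3 ^ 4 * theta11 q 4 ^ 3 * theta11 q 5 ^ 3)))) := by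
  have hq1 : ‖q‖ < 1 := by linarith
  obtain ⟨hc, hR, h1, h2, h4, h5⟩ := curve_relations hq1 h0 rfl rfl rfl
  have nz : ∀ k : ℤ, ¬ (11 : ℤ) ∣ k → thetaNorm q k ≠ 0 := fun k hk => thetaNorm_ne_zero hq1 h0 hk
  have n1 := nz 1 (by decide)
  have n2 := nz 2 (by decide)
  have n3 := nz 3 (by decide)
  have n4 := nz 4 (by decide)
  have n5 := nz 5 (by decide)
  have hJ : qPoch ((q ^ 121) ^ 2) ((q ^ 121) ^ 2) ≠ 0 :=
    qPoch_self_ne_zero (norm_sq_lt_one (norm_pow_lt_one hq1 (by norm_num)))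
  have hx1 : 1 - curveX q ≠ 0 := fun h => curve_ne_zero hR (by simp [h])
  refine hasSum_residue_six hq h0 0 (e := 44) (A := 22 * q ^ 44 *
      appell (q ^ 121) ((q ^ 22) ^ (2 : ℤ)) 1)
    (C := q ^ 122 * thetaNorm q 1 ^ 13 * (1 - curveX q))
    (c := fun g => (thetaNorm q 2 / thetaNorm q 1) ^ g * compZero (curveX q) (curveY q) g)
    hJ (mul_ne_zero (mul_ne_zero (pow_ne_zero _ h0) (pow_ne_zero _ n1)) hx1) (by norm_num) ?_ ?_
  · intro z hz
    have z0 : z ≠ 0 := by rintro rfl; norm_num at hz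
    have hzq : ‖z * q‖ ≤ 1 / 3 := by
      rw [norm_mul, Complex.norm_eq_one_of_pow_eq_one hz (by norm_num), one_mul]
      exact hq
    have h := rankGF_zero_mul_comp hzq (mul_ne_zero z0 h0)
    obtain ⟨b1, b2, b3, b4⟩ := curve_root_mul (q := q) hz
    have e1 : (z * q) ^ 121 = q ^ 121 := by
      rw [mul_pow, show 121 = 11 * 11 from rfl, pow_mul z, hz, one_pow, one_mul]
    have e2 : (z * q) ^ 22 = q ^ 22 := by
      rw [mul_pow, show 22 = 11 * 2 from rfl, pow_mul z, hz, one_pow, one_mul]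
    have e3 : (z * q) ^ 122 = z * q ^ 122 := by
      rw [mul_pow, show 122 = 11 * 11 + 1 from rfl, pow_succ z, pow_mul z, hz, one_pow, one_mul]
    rw [b4, b1, b2, b3, e1, e2, e3, mul_pow z q 44] at h
    simp only [mul_pow _ (thetaNorm q 2 / thetaNorm q 1), ← pow_mul, mul_assoc (z ^ _)] at h
    simp only [← pow_mul]
    linear_combination h
  · have g := compZero_eight hc hR h1 h2 h4 h5 n1 n2 n3 n4 n5
    obtain ⟨t1, t2, t3, t4, t5⟩ := thetaNorm_eq_div h0
    have m1 : theta11 q 1 ≠ 0 := theta11_ne_zero hq1 h0 (by decide)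
    have m2 : theta11 q 2 ≠ 0 := theta11_ne_zero hq1 h0 (by decide)
    have m3 : theta11 q 3 ≠ 0 := theta11_ne_zero hq1 h0 (by decide)
    have m4 : theta11 q 4 ≠ 0 := theta11_ne_zero hq1 h0 (by decide)
    have m5 : theta11 q 5 ≠ 0 := theta11_ne_zero hq1 h0 (by decide)
    have f0 : 1 / (thetaNorm q 1 ^ 2 * thetaNorm q 2 ^ 4 * thetaNorm q 3 ^ 2 * thetaNorm q 4 ^ 2 *
        thetaNorm q 5 ^ 3) =
        q ^ 156 * (1 / (theta11 q 1 ^ 2 * theta11 q 2 ^ 4 * theta11 q 3 ^ 2 * theta11 q 4 ^ 2 *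
            theta11 q 5 ^ 3)) := by
      rw [t1, t2, t3, t4, t5]; field_simp
    have f1 : 1 / (thetaNorm q 1 ^ 2 * thetaNorm q 2 * thetaNorm q 3 ^ 4 * thetaNorm q 4 ^ 3 *
        thetaNorm q 5 ^ 3) =
        q ^ 178 * (1 / (theta11 q 1 ^ 2 * theta11 q 2 * theta11 q 3 ^ 4 * theta11 q 4 ^ 3 *
            theta11 q 5 ^ 3)) := by
      rw [t1, t2, t3, t4, t5]; field_simp
    rw [f0, f1] at g
    linear_combination qPoch ((q ^ 121) ^ 2) ((q ^ 121) ^ 2) * g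

theorem hasSum_rank_residue_five {q : ℂ} (hq : ‖q‖ ≤ 1 / 3) (h0 : q ≠ 0) :
    HasSum (fun m : ℕ => (11 * (rankCount 5 11 (11 * m + 6) : ℂ) - partitionCount (11 * m + 6)) *
      (q ^ 22) ^ m) (-11 * ((q ^ 22) ^ 2 *
          (qPoch ((q ^ 121) ^ 2) ((q ^ 121) ^ 2) / (theta11 q 1 ^ 2 * theta11 q 2 ^ 2 *
          theta11 q 3 ^ 2 * theta11 q 4 ^ 3 * theta11 q 5 ^ 4)) +
        q ^ 22 * (qPoch ((q ^ 121) ^ 2) ((q ^ 121) ^ 2) / (theta11 q 1 ^ 3 * theta11 q 2 ^ 2 *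
            theta11 q 3 ^ 2 * theta11 q 4 ^ 4 * theta11 q 5 ^ 2)) +
        q ^ 22 * (qPoch ((q ^ 121) ^ 2) ((q ^ 121) ^ 2) / (theta11 q 1 ^ 2 * theta11 q 2 ^ 3 *
            theta11 q 3 ^ 4 * theta11 q 4 ^ 2 * theta11 q 5 ^ 2)))) := by
  have hq1 : ‖q‖ < 1 := by linarith
  obtain ⟨hc, hR, h1, h2, h4, h5⟩ := curve_relations hq1 h0 rfl rfl rfl
  have nz : ∀ k : ℤ, ¬ (11 : ℤ) ∣ k → thetaNorm q k ≠ 0 := fun k hk => thetaNorm_ne_zero hq1 h0 hk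
  have n1 := nz 1 (by decide)
  have n2 := nz 2 (by decide)
  have n3 := nz 3 (by decide)
  have n4 := nz 4 (by decide)
  have n5 := nz 5 (by decide)
  have hJ : qPoch ((q ^ 121) ^ 2) ((q ^ 121) ^ 2) ≠ 0 :=
    qPoch_self_ne_zero (norm_sq_lt_one (norm_pow_lt_one hq1 (by norm_num)))
  have hx1 : 1 - curveX q ≠ 0 := fun h => curve_ne_zero hR (by simp [h])
  refine hasSum_residue_six hq h0 5 (e := 74) (A := 11 * q ^ 74 *
      appell (q ^ 121) ((q ^ 22) ^ (4 : ℤ)) 1)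
    (C := q ^ 122 * thetaNorm q 1 ^ 13 * (1 - curveX q))
    (c := fun g => (thetaNorm q 2 / thetaNorm q 1) ^ g * compFive (curveX q) (curveY q) g)
    hJ (mul_ne_zero (mul_ne_zero (pow_ne_zero _ h0) (pow_ne_zero _ n1)) hx1) (by norm_num) ?_ ?_
  · intro z hz
    have z0 : z ≠ 0 := by rintro rfl; norm_num at hz
    have hzq : ‖z * q‖ ≤ 1 / 3 := by
      rw [norm_mul, Complex.norm_eq_one_of_pow_eq_one hz (by norm_num), one_mul]
      exact hq
    have h := rankGF_five_mul_comp hzq (mul_ne_zero z0 h0)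
    obtain ⟨b1, b2, b3, b4⟩ := curve_root_mul (q := q) hz
    have e1 : (z * q) ^ 121 = q ^ 121 := by
      rw [mul_pow, show 121 = 11 * 11 from rfl, pow_mul z, hz, one_pow, one_mul]
    have e2 : (z * q) ^ 22 = q ^ 22 := by
      rw [mul_pow, show 22 = 11 * 2 from rfl, pow_mul z, hz, one_pow, one_mul]
    have e3 : (z * q) ^ 122 = z * q ^ 122 := by
      rw [mul_pow, show 122 = 11 * 11 + 1 from rfl, pow_succ z, pow_mul z, hz, one_pow, one_mul]
    rw [b4, b1, b2, b3, e1, e2, e3, mul_pow z q 74] at h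
    simp only [mul_pow _ (thetaNorm q 2 / thetaNorm q 1), ← pow_mul, mul_assoc (z ^ _)] at h
    simp only [← pow_mul]
    linear_combination h
  · have g := compFive_eight hc hR h1 h2 h4 h5 n1 n2 n3 n4 n5
    obtain ⟨t1, t2, t3, t4, t5⟩ := thetaNorm_eq_div h0
    have m1 : theta11 q 1 ≠ 0 := theta11_ne_zero hq1 h0 (by decide)
    have m2 : theta11 q 2 ≠ 0 := theta11_ne_zero hq1 h0 (by decide)
    have m3 : theta11 q 3 ≠ 0 := theta11_ne_zero hq1 h0 (by decide)
    have m4 : theta11 q 4 ≠ 0 := theta11_ne_zero hq1 h0 (by decide)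
    have m5 : theta11 q 5 ≠ 0 := theta11_ne_zero hq1 h0 (by decide)
    have f0 : 1 / (thetaNorm q 1 ^ 2 * thetaNorm q 2 ^ 2 * thetaNorm q 3 ^ 2 * thetaNorm q 4 ^ 3 *
        thetaNorm q 5 ^ 4) =
        q ^ 178 * (1 / (theta11 q 1 ^ 2 * theta11 q 2 ^ 2 * theta11 q 3 ^ 2 * theta11 q 4 ^ 3 *
            theta11 q 5 ^ 4)) := by
      rw [t1, t2, t3, t4, t5]; field_simp
    have f1 : 1 / (thetaNorm q 1 ^ 3 * thetaNorm q 2 ^ 2 * thetaNorm q 3 ^ 2 * thetaNorm q 4 ^ 4 *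
        thetaNorm q 5 ^ 2) =
        q ^ 156 * (1 / (theta11 q 1 ^ 3 * theta11 q 2 ^ 2 * theta11 q 3 ^ 2 * theta11 q 4 ^ 4 *
            theta11 q 5 ^ 2)) := by
      rw [t1, t2, t3, t4, t5]; field_simp
    have f2 : 1 / (thetaNorm q 1 ^ 2 * thetaNorm q 2 ^ 3 * thetaNorm q 3 ^ 4 * thetaNorm q 4 ^ 2 *
        thetaNorm q 5 ^ 2) =
        q ^ 156 * (1 / (theta11 q 1 ^ 2 * theta11 q 2 ^ 3 * theta11 q 3 ^ 4 * theta11 q 4 ^ 2 *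
            theta11 q 5 ^ 2)) := by
      rw [t1, t2, t3, t4, t5]; field_simp
    rw [f0, f1, f2] at g
    linear_combination qPoch ((q ^ 121) ^ 2) ((q ^ 121) ^ 2) * g

open scoped ComplexOrder Topology in
/-- `f` is holomorphic on the disc of radius `1 / 2` with nonnegative Taylor coefficients at `0`. -/
def HasNonnegTaylor (f : ℂ → ℂ) : Prop :=
  DifferentiableOn ℂ f (Metric.ball 0 (1 / 2)) ∧ ∀ n, 0 ≤ iteratedDeriv n f 0

namespace HasNonnegTaylor

open Finset
open scoped ComplexOrder

lemma contDiffAt {f : ℂ → ℂ} (hf : HasNonnegTaylor f) (n : ℕ) : ContDiffAt ℂ n f 0 :=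
  (hf.1.analyticAt (Metric.ball_mem_nhds _ (by norm_num))).contDiffAt

lemma add {f g : ℂ → ℂ} (hf : HasNonnegTaylor f) (hg : HasNonnegTaylor g) :
    HasNonnegTaylor fun t => f t + g t :=
  ⟨hf.1.add hg.1, fun n => by
    rw [iteratedDeriv_fun_add (hf.contDiffAt n) (hg.contDiffAt n)]
    exact add_nonneg (hf.2 n) (hg.2 n)⟩

lemma mul {f g : ℂ → ℂ} (hf : HasNonnegTaylor f) (hg : HasNonnegTaylor g) :
    HasNonnegTaylor fun t => f t * g t :=
  ⟨hf.1.mul hg.1, fun n => by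
    rw [iteratedDeriv_fun_mul (hf.contDiffAt n) (hg.contDiffAt n)]
    exact sum_nonneg fun i _ => mul_nonneg (mul_nonneg (Nat.cast_nonneg _) (hf.2 i)) (hg.2 _)⟩

lemma pow_id (m : ℕ) : HasNonnegTaylor fun t => t ^ m :=
  ⟨(differentiable_id.pow m).differentiableOn, fun n => by
    rw [iteratedDeriv_fun_pow_zero]
    exact Nat.cast_nonneg (α := ℂ) _⟩

lemma one : HasNonnegTaylor fun _ => 1 := by simpa using pow_id 0

lemma zero : HasNonnegTaylor fun _ => 0 :=
  ⟨differentiableOn_const 0, fun n => by simp⟩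

lemma sum {ι : Type*} {f : ι → ℂ → ℂ} (s : Finset ι) (hf : ∀ i, HasNonnegTaylor (f i)) :
    HasNonnegTaylor fun t => ∑ i ∈ s, f i t := by
  classical
  induction s using Finset.induction_on with
  | empty => simpa using zero
  | insert i s hi ih => simpa [sum_insert hi] using (hf i).add ih

lemma prod {ι : Type*} {f : ι → ℂ → ℂ} (s : Finset ι) (hf : ∀ i, HasNonnegTaylor (f i)) :
    HasNonnegTaylor fun t => ∏ i ∈ s, f i t := by
  classical
  induction s using Finset.induction_on with
  | empty => simpa using one
  | insert i s hi ih => simpa [prod_insert hi] using (hf i).mul ih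

lemma pow {f : ℂ → ℂ} (hf : HasNonnegTaylor f) (n : ℕ) : HasNonnegTaylor fun t => f t ^ n := by
  simpa using prod (range n) fun _ => hf

lemma of_tendsto {ι : Type*} {l : Filter ι} [l.NeBot] {F : ι → ℂ → ℂ} {f : ℂ → ℂ}
    (hF : ∀ i, HasNonnegTaylor (F i))
    (h : TendstoLocallyUniformlyOn F f l (Metric.ball 0 (1 / 2))) : HasNonnegTaylor f := by
  have key : ∀ n : ℕ, (∀ i, DifferentiableOn ℂ (iteratedDeriv n (F i)) (Metric.ball 0 (1 / 2))) ∧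
      TendstoLocallyUniformlyOn (fun i => iteratedDeriv n (F i)) (iteratedDeriv n f) l
        (Metric.ball 0 (1 / 2)) := by
    intro n
    induction n with
    | zero => simpa only [iteratedDeriv_zero] using ⟨fun i => (hF i).1, h⟩
    | succ n ih =>
      simp only [iteratedDeriv_succ]
      exact ⟨fun i => (ih.1 i).deriv Metric.isOpen_ball,
        ih.2.deriv (Eventually.of_forall ih.1) Metric.isOpen_ball⟩
  refine ⟨h.differentiableOn (Eventually.of_forall fun i => (hF i).1) Metric.isOpen_ball,
    fun n => ge_of_tendsto ((key n).2.tendsto_at (Metric.mem_ball_self (by norm_num))) ?_⟩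
  exact Eventually.of_forall fun i => (hF i).2 n

lemma tsum {f : ℕ → ℂ → ℂ} {u : ℕ → ℝ} (hu : Summable u) (hf : ∀ n, HasNonnegTaylor (f n))
    (h : ∀ n, ∀ t ∈ Metric.ball (0 : ℂ) (1 / 2), ‖f n t‖ ≤ u n) :
    HasNonnegTaylor fun t => ∑' n, f n t :=
  of_tendsto (fun N => sum (range N) hf)
    (tendstoUniformlyOn_tsum_nat hu h).tendstoLocallyUniformlyOn

lemma tprod {f : ℕ → ℂ → ℂ} {u : ℕ → ℝ} (hu : Summable u) (hf : ∀ n, HasNonnegTaylor (f n))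
    (h : ∀ n, ∀ t ∈ Metric.ball (0 : ℂ) (1 / 2), ‖f n t‖ ≤ u n) :
    HasNonnegTaylor fun t => ∏' n, (1 + f n t) := by
  exact of_tendsto (fun s => prod s fun n => one.add (hf n))
    (Summable.hasProdLocallyUniformlyOn_nat_one_add Metric.isOpen_ball hu (Eventually.of_forall h)
      fun n => (hf n).1.continuousOn)

lemma norm_pow_le {t : ℂ} (ht : t ∈ Metric.ball (0 : ℂ) (1 / 2)) (e : ℕ) :
    ‖t ^ e‖ ≤ (1 / 2) ^ e := by
  rw [norm_pow]
  exact pow_le_pow_left₀ (norm_nonneg _) (mem_ball_zero_iff.1 ht).le _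

lemma norm_pow_le_half {t : ℂ} (ht : t ∈ Metric.ball (0 : ℂ) (1 / 2)) {e : ℕ} (he : e ≠ 0) :
    ‖t ^ e‖ ≤ 1 / 2 :=
  (norm_pow_le ht e).trans (pow_le_of_le_one (by norm_num) (by norm_num) he)

lemma norm_pow_div_le {t : ℂ} (ht : t ∈ Metric.ball (0 : ℂ) (1 / 2)) {e : ℕ} (he : e ≠ 0) :
    ‖t ^ e / (1 - t ^ e)‖ ≤ 2 * (1 / 2) ^ e := by
  have h1 := norm_pow_le ht e
  have h2 := norm_pow_le_half ht he
  have h3 : 1 / 2 ≤ ‖1 - t ^ e‖ := by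
    have := norm_sub_norm_le 1 (t ^ e)
    rw [norm_one] at this
    linarith
  rw [norm_div, div_le_iff₀ (by linarith)]
  nlinarith [pow_nonneg (show (0 : ℝ) ≤ 1 / 2 by norm_num) e]

lemma pow_div {e : ℕ} (he : e ≠ 0) : HasNonnegTaylor fun t => t ^ e / (1 - t ^ e) := by
  have h := tsum (f := fun n t => t ^ (e * (n + 1))) (u := fun n => (1 / 2) ^ (n + 1))
    ((summable_nat_add_iff 1).2 (summable_geometric_of_lt_one (by norm_num) (by norm_num)))
    (fun n => pow_id _) fun n t ht => by
      rw [pow_mul, norm_pow]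
      exact pow_le_pow_left₀ (norm_nonneg _) (norm_pow_le_half ht he) _
  have e1 : ∀ t ∈ Metric.ball (0 : ℂ) (1 / 2),
      t ^ e / (1 - t ^ e) = ∑' n : ℕ, t ^ (e * (n + 1)) := fun t ht => by
    simp_rw [pow_mul, pow_succ' (t ^ e)]
    rw [tsum_mul_left, tsum_geometric_of_norm_lt_one
      ((norm_pow_le_half ht he).trans_lt (by norm_num)), div_eq_mul_inv]
  refine ⟨h.1.congr e1, fun n => ?_⟩
  rw [Filter.EventuallyEq.iteratedDeriv_eq n (g := fun t => ∑' n : ℕ, t ^ (e * (n + 1)))]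
  · exact h.2 n
  · filter_upwards [Metric.ball_mem_nhds (0 : ℂ) (by norm_num : (0 : ℝ) < 1 / 2)] with t ht
    exact e1 t ht

/-- A power series with sum a function with nonnegative Taylor coefficients near `0`
has nonnegative coefficients. -/
lemma coeff_nonneg {f : ℂ → ℂ} (hf : HasNonnegTaylor f) {c : ℕ → ℂ} {r : ℝ} (hr : 0 < r)
    (h : ∀ t : ℂ, t ≠ 0 → ‖t‖ < r → HasSum (fun n => c n * t ^ n) (f t)) (n : ℕ) : 0 ≤ c n := by
  have h1 : ∀ t ∈ Metric.ball (0 : ℂ) (1 / 2),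
      HasSum (fun n : ℕ => iteratedDeriv n f 0 / n.factorial * t ^ n) (f t) := fun t ht => by
    refine (Complex.hasSum_taylorSeries_on_ball hf.1 ht).congr_fun fun n => ?_
    simp only [smul_eq_mul, sub_zero]
    ring
  have hb : Metric.ball (0 : ℂ) (1 / 2) ∈ 𝓝 0 := Metric.ball_mem_nhds _ (by norm_num)
  have f1 : HasFPowerSeriesAt f
      (FormalMultilinearSeries.ofScalars ℂ fun n => iteratedDeriv n f 0 / n.factorial) 0 := by
    rw [hasFPowerSeriesAt_iff']
    filter_upwards [hb] with t ht
    simpa [mul_comm] using h1 t ht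
  have f2 : HasFPowerSeriesAt (fun t => ∑' n, c n * t ^ n)
      (FormalMultilinearSeries.ofScalars ℂ c) 0 := by
    rw [hasFPowerSeriesAt_iff']
    filter_upwards [Metric.ball_mem_nhds (0 : ℂ) hr] with t ht
    rcases eq_or_ne t 0 with rfl | h0
    · have : ∀ n, n ≠ 0 → c n * (0 : ℂ) ^ n = 0 := fun n hn => by simp [hn]
      have hs := hasSum_single 0 this
      rw [hs.tsum_eq]
      simpa [mul_comm] using hs
    · have hs := h t h0 (mem_ball_zero_iff.1 ht)
      rw [hs.tsum_eq]
      simpa [mul_comm] using hs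
  have e : f =ᶠ[𝓝 0] fun t => ∑' n, c n * t ^ n := by
    refine (ContinuousAt.eventuallyEq_nhds_iff_eventuallyEq_nhdsNE f1.continuousAt
      f2.continuousAt).1 ?_
    rw [Filter.EventuallyEq, eventually_nhdsWithin_iff]
    filter_upwards [Metric.ball_mem_nhds (0 : ℂ) hr] with t ht h0
    exact (h t h0 (mem_ball_zero_iff.1 ht)).tsum_eq.symm
  have hc : c n = iteratedDeriv n f 0 / n.factorial := by
    have := congrArg (fun p => p.coeff n) ((f1.congr e).eq_formalMultilinearSeries f2)
    simpa using this.symm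
  rw [hc]
  exact div_nonneg (hf.2 n) (Nat.cast_nonneg _)

lemma const {c : ℂ} (hc : 0 ≤ c) : HasNonnegTaylor fun _ => c :=
  ⟨differentiableOn_const c, fun n => by
    rw [iteratedDeriv_const]
    split_ifs
    · exact hc
    · exact le_refl (0 : ℂ)⟩

end HasNonnegTaylor

open HasNonnegTaylor

lemma summable_half_pow_mul_add (C : ℝ) (a : ℕ) :
    Summable fun i : ℕ => C * (1 / 2 : ℝ) ^ (11 * i + a) := by
  have h : Summable fun i : ℕ => C * (1 / 2 : ℝ) ^ a * ((1 / 2) ^ 11) ^ i :=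
    (summable_geometric_of_lt_one (by norm_num) (by norm_num)).mul_left _
  refine h.congr fun i => ?_
  rw [pow_add, pow_mul]
  ring

lemma one_sub_pow_ne_zero {t : ℂ} (ht : t ∈ Metric.ball (0 : ℂ) (1 / 2)) {e : ℕ} (he : e ≠ 0) :
    1 - t ^ e ≠ 0 := fun h => by
  have := norm_pow_le_half ht he
  rw [← sub_eq_zero.1 h, norm_one] at this
  norm_num at this

lemma norm_lt_one_of_mem_ball {t : ℂ} (ht : t ∈ Metric.ball (0 : ℂ) (1 / 2)) {e : ℕ} (he : e ≠ 0) :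
    ‖t ^ e‖ < 1 :=
  (norm_pow_le_half ht he).trans_lt (by norm_num)

lemma multipliable_one_add_of_norm_le {f : ℕ → ℂ} {u : ℕ → ℝ} (hu : Summable u)
    (h : ∀ n, ‖f n‖ ≤ u n) : Multipliable fun n => 1 + f n :=
  multipliable_one_add_of_summable (Summable.of_nonneg_of_le (fun _ => norm_nonneg _) h hu)

lemma exists_inv_qPoch {a : ℕ} (ha : a ≠ 0) : ∃ v : ℂ → ℂ, HasNonnegTaylor v ∧
    ∀ t ∈ Metric.ball (0 : ℂ) (1 / 2), v t * qPoch (t ^ 11) (t ^ a) = 1 := by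
  have hu := summable_half_pow_mul_add 2 a
  have hb : ∀ (i : ℕ), ∀ t ∈ Metric.ball (0 : ℂ) (1 / 2),
      ‖t ^ (11 * i + a) / (1 - t ^ (11 * i + a))‖ ≤ 2 * (1 / 2) ^ (11 * i + a) :=
    fun i t ht => norm_pow_div_le ht (by omega)
  refine ⟨_, HasNonnegTaylor.tprod hu (fun i => pow_div (e := 11 * i + a) (by omega)) hb,
    fun t ht => ?_⟩
  rw [qPoch, ← (multipliable_one_add_of_norm_le hu fun i => hb i t ht).tprod_mul
    (multipliable_qPoch (norm_lt_one_of_mem_ball ht (by norm_num)) _)]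
  refine (tprod_congr fun i => ?_).trans tprod_one
  have := one_sub_pow_ne_zero ht (e := 11 * i + a) (by omega)
  rw [show t ^ a * (t ^ 11) ^ i = t ^ (11 * i + a) by rw [← pow_mul, ← pow_add, add_comm]]
  field_simp
  ring

lemma exists_qPoch_div {a b : ℕ} (ha : a ≠ 0) (hb : b ≠ 0) : ∃ w : ℂ → ℂ, HasNonnegTaylor w ∧
    ∀ t ∈ Metric.ball (0 : ℂ) (1 / 2), w t * (qPoch (t ^ 11) (t ^ a) * qPoch (t ^ 11) (t ^ b)) =
      qPoch ((t ^ 11) ^ 2) (t ^ (a + b)) := by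
  have hu := (summable_half_pow_mul_add 2 a).add (summable_half_pow_mul_add 2 b)
  have hn : ∀ (i : ℕ), ∀ t ∈ Metric.ball (0 : ℂ) (1 / 2),
      ‖t ^ (11 * i + a) / (1 - t ^ (11 * i + a)) + t ^ (11 * i + b) / (1 - t ^ (11 * i + b))‖ ≤
        2 * (1 / 2) ^ (11 * i + a) + 2 * (1 / 2) ^ (11 * i + b) :=
    fun i t ht => (norm_add_le _ _).trans
      (add_le_add (norm_pow_div_le ht (by omega)) (norm_pow_div_le ht (by omega)))
  refine ⟨_, HasNonnegTaylor.tprod hu (fun i => (pow_div (e := 11 * i + a) (by omega)).add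
    (pow_div (e := 11 * i + b) (by omega))) hn, fun t ht => ?_⟩
  have hQ := norm_lt_one_of_mem_ball ht (e := 11) (by norm_num)
  have ma := multipliable_qPoch hQ (t ^ a)
  have mb := multipliable_qPoch hQ (t ^ b)
  rw [qPoch, qPoch, ← ma.tprod_mul mb,
    ← (multipliable_one_add_of_norm_le hu fun i => hn i t ht).tprod_mul (ma.mul mb), qPoch]
  refine tprod_congr fun i => ?_
  have h1 := one_sub_pow_ne_zero ht (e := 11 * i + a) (by omega)
  have h2 := one_sub_pow_ne_zero ht (e := 11 * i + b) (by omega)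
  rw [show t ^ a * (t ^ 11) ^ i = t ^ (11 * i + a) by rw [← pow_mul, ← pow_add, add_comm],
    show t ^ b * (t ^ 11) ^ i = t ^ (11 * i + b) by rw [← pow_mul, ← pow_add, add_comm],
    show t ^ (a + b) * ((t ^ 11) ^ 2) ^ i = t ^ (11 * i + a) * t ^ (11 * i + b) by
      rw [← pow_mul, ← pow_mul, ← pow_add, ← pow_add]; congr 1; ring]
  generalize t ^ (11 * i + a) = x at *
  generalize t ^ (11 * i + b) = y at *
  field_simp
  ring

lemma pow_mem_ball_half {q : ℂ} (hq : ‖q‖ ≤ 1 / 3) : q ^ 22 ∈ Metric.ball (0 : ℂ) (1 / 2) := by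
  rw [mem_ball_zero_iff, norm_pow]
  exact (pow_le_pow_left₀ (norm_nonneg _) hq _).trans_lt (by norm_num)

lemma theta11_eq {q : ℂ} (h0 : q ≠ 0) {j k : ℕ} (h : j + k = 11) :
    theta11 q j = qPoch ((q ^ 22) ^ 11) ((q ^ 22) ^ j) * qPoch ((q ^ 22) ^ 11) ((q ^ 22) ^ k) := by
  rw [theta11, thetaQ, zpow_natCast, ← pow_mul, show 121 * 2 = 22 * 11 from rfl, pow_mul q 22]
  congr 2
  rw [← h, pow_add, mul_div_cancel_left₀ _ (pow_ne_zero _ (pow_ne_zero _ h0))]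

lemma exists_inv_theta11 {j k : ℕ} (h : j + k = 11) (hj : j ≠ 0) (hk : k ≠ 0) :
    ∃ v : ℂ → ℂ, HasNonnegTaylor v ∧ ∀ q : ℂ, q ≠ 0 → ‖q‖ ≤ 1 / 3 →
      v (q ^ 22) * theta11 q j = 1 := by
  obtain ⟨u, hu, eu⟩ := exists_inv_qPoch hj
  obtain ⟨v, hv, ev⟩ := exists_inv_qPoch hk
  refine ⟨_, hu.mul hv, fun q h0 hq => ?_⟩
  have ht := pow_mem_ball_half hq
  rw [theta11_eq h0 h]
  linear_combination eu _ ht * (v (q ^ 22) * qPoch ((q ^ 22) ^ 11) ((q ^ 22) ^ k)) + ev _ ht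

lemma exists_qPoch_div_theta11 : ∃ s : ℂ → ℂ, HasNonnegTaylor s ∧ ∀ q : ℂ, q ≠ 0 → ‖q‖ ≤ 1 / 3 →
    s (q ^ 22) * (theta11 q 1 * theta11 q 2) = qPoch ((q ^ 121) ^ 2) ((q ^ 121) ^ 2) := by
  obtain ⟨u, hu, eu⟩ := exists_qPoch_div (a := 1) (b := 10) (by norm_num) (by norm_num)
  obtain ⟨v, hv, ev⟩ := exists_qPoch_div (a := 2) (b := 20) (by norm_num) (by norm_num)
  have hg := one.add (pow_div (e := 9) (by norm_num))
  refine ⟨_, (hg.mul hu).mul hv, fun q h0 hq => ?_⟩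
  have ht := pow_mem_ball_half hq
  have e1 := theta11_eq h0 (j := 1) (k := 10) rfl
  have e2 := theta11_eq h0 (j := 2) (k := 9) rfl
  rw [Nat.cast_one] at e1
  rw [Nat.cast_ofNat] at e2
  have hQ := norm_lt_one_of_mem_ball ht (e := 11) (by norm_num)
  have e3 := qPoch_eq hQ ((q ^ 22) ^ 9)
  have e4 := qPoch_sq_base hQ ((q ^ 22) ^ 11)
  have e5 := eu _ ht
  have e6 := ev _ ht
  have n9 := one_sub_pow_ne_zero ht (e := 9) (by norm_num)
  rw [← pow_add] at e3 e4
  norm_num only at e3 e4 e5 e6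
  rw [e1, e2, e3, ← pow_mul q 121, show 121 * 2 = 22 * 11 from rfl, pow_mul q 22, e4, ← e5, ← e6]
  generalize (q ^ 22) ^ 9 = x at *
  field_simp
  ring

open scoped ComplexOrder in
lemma HasNonnegTaylor.coeff_nonneg_of_pow {f : ℂ → ℂ} (hf : HasNonnegTaylor f) {c : ℕ → ℂ}
    (h : ∀ q : ℂ, q ≠ 0 → ‖q‖ ≤ 1 / 3 → HasSum (fun n => c n * (q ^ 22) ^ n) (f (q ^ 22)))
    (n : ℕ) : 0 ≤ c n := by
  refine hf.coeff_nonneg (r := (1 / 3) ^ 22) (by norm_num) (fun t h0 ht => ?_) n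
  obtain ⟨q, rfl⟩ := IsAlgClosed.exists_pow_nat_eq t (show 0 < 22 by norm_num)
  refine h q (fun hq => h0 (by simp [hq])) ?_
  rw [norm_pow] at ht
  exact (lt_of_pow_lt_pow_left₀ 22 (by norm_num) ht).le

open scoped ComplexOrder in
theorem partitionCount_le_and_le (n : ℕ) :
    partitionCount (11 * n + 6) ≤ 11 * rankCount 0 11 (11 * n + 6) ∧
      11 * rankCount 5 11 (11 * n + 6) ≤ partitionCount (11 * n + 6) := by
  obtain ⟨s, hs, es⟩ := exists_qPoch_div_theta11
  obtain ⟨v1, h1, e1⟩ := exists_inv_theta11 (j := 1) (k := 10) rfl (by norm_num) (by norm_num)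
  obtain ⟨v2, h2, e2⟩ := exists_inv_theta11 (j := 2) (k := 9) rfl (by norm_num) (by norm_num)
  obtain ⟨v3, h3, e3⟩ := exists_inv_theta11 (j := 3) (k := 8) rfl (by norm_num) (by norm_num)
  obtain ⟨v4, h4, e4⟩ := exists_inv_theta11 (j := 4) (k := 7) rfl (by norm_num) (by norm_num)
  obtain ⟨v5, h5, e5⟩ := exists_inv_theta11 (j := 5) (k := 6) rfl (by norm_num) (by norm_num)
  have hx := HasNonnegTaylor.pow_id
  have key : ∀ q : ℂ, q ≠ 0 → ‖q‖ ≤ 1 / 3 → ∀ a b c d e : ℕ,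
      qPoch ((q ^ 121) ^ 2) ((q ^ 121) ^ 2) / (theta11 q 1 ^ (a + 1) * theta11 q 2 ^ (b + 1) *
        theta11 q 3 ^ c * theta11 q 4 ^ d * theta11 q 5 ^ e) =
      s (q ^ 22) * (v1 (q ^ 22) ^ a * v2 (q ^ 22) ^ b * v3 (q ^ 22) ^ c * v4 (q ^ 22) ^ d *
        v5 (q ^ 22) ^ e) := by
    intro q h0 hq a b c d e
    have g1 := e1 q h0 hq
    have g2 := e2 q h0 hq
    have g3 := e3 q h0 hq
    have g4 := e4 q h0 hq
    have g5 := e5 q h0 hq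
    push_cast at g1 g2 g3 g4 g5
    have n1 := right_ne_zero_of_mul_eq_one g1
    have n2 := right_ne_zero_of_mul_eq_one g2
    rw [← es q h0 hq, eq_inv_of_mul_eq_one_left g1, eq_inv_of_mul_eq_one_left g2,
      eq_inv_of_mul_eq_one_left g3, eq_inv_of_mul_eq_one_left g4, eq_inv_of_mul_eq_one_left g5]
    simp only [inv_pow]
    field_simp
    ring
  have hm : ∀ a b c d e : ℕ, HasNonnegTaylor fun t =>
      s t * (v1 t ^ a * v2 t ^ b * v3 t ^ c * v4 t ^ d * v5 t ^ e) := fun a b c d e =>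
    hs.mul (((((h1.pow a).mul (h2.pow b)).mul (h3.pow c)).mul (h4.pow d)).mul (h5.pow e))
  constructor
  · have := ((HasNonnegTaylor.const (c := 22) (by norm_num)).mul (((hx 1).mul (hm 1 3 2 2 3)).add
      ((hx 2).mul (hm 1 0 4 3 3)))).coeff_nonneg_of_pow (c := fun m =>
      11 * (rankCount 0 11 (11 * m + 6) : ℂ) - partitionCount (11 * m + 6))
      (fun q h0 hq => by
        have h := hasSum_rank_residue_zero hq h0
        have k1 := key q h0 hq 1 3 2 2 3
        have k2 := key q h0 hq 1 0 4 3 3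
        norm_num only [pow_one] at k1 k2
        simp only [pow_one]
        rw [k1, k2] at h
        exact h) n
    exact_mod_cast sub_nonneg.1 this
  · have := ((HasNonnegTaylor.const (c := 11) (by norm_num)).mul ((((hx 2).mul (hm 1 1 2 3 4)).add
      ((hx 1).mul (hm 2 1 2 4 2))).add ((hx 1).mul (hm 1 2 4 2 2)))).coeff_nonneg_of_pow
      (c := fun m => (partitionCount (11 * m + 6) : ℂ) - 11 * rankCount 5 11 (11 * m + 6))
      (fun q h0 hq => by
        have h := (hasSum_rank_residue_five hq h0).neg
        have k1 := key q h0 hq 1 1 2 3 4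
        have k2 := key q h0 hq 2 1 2 4 2
        have k3 := key q h0 hq 1 2 4 2 2
        norm_num only [pow_one] at k1 k2 k3
        simp only [pow_one]
        rw [k1, k2, k3] at h
        have h' := (hasSum_iff_of_eq (g := fun m : ℕ => ((partitionCount (11 * m + 6) : ℂ) -
          11 * rankCount 5 11 (11 * m + 6)) * (q ^ 22) ^ m) fun m => by ring).1 h
        rw [neg_mul, neg_neg] at h'
        exact h') n
    exact_mod_cast sub_nonneg.1 this

/-- `N(0,11,11n+6)` is at least the average `p(11n+6)/11`, and `N(5,11,11n+6)` is at most it. -/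
theorem rank_residue_six_average_bounds (n : ℕ) :
    11 * rankCount 0 11 (11 * n + 6) ≥ partitionCount (11 * n + 6)
    ∧ partitionCount (11 * n + 6) ≥ 11 * rankCount 5 11 (11 * n + 6) :=
  partitionCount_le_and_le n
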